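/- There exists an infinite-dimensional Banach space 𝒳_GM with a Schauder basis which is hereditarily indecomposable, tight, and whose basis is sequentially minimal. -/

import Mathlib

section BanachDefs

variable {X : Type*} [NormedAddCommGroup X] [NormedSpace ℝ X]

/-- A sequence is seminormalized if its norms are bounded away from `0` and `∞`. -/
def Seminormalized (x : ℕ → X) : Prop :=
  ∃ c C : ℝ, 0 < c ∧ ∀ n, c ≤ ‖x n‖ ∧ ‖x n‖ ≤ C

/-- A sequence of nonzero vectors is basic if partial sums of expansions are uniformly
dominated by longer ones. -/
def IsBasicSeq (x : ℕ → X) : Prop :=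
  (∀ n, x n ≠ 0) ∧ ∃ K : ℝ, 1 ≤ K ∧ ∀ (a : ℕ → ℝ) (m n : ℕ), m ≤ n →
    ‖∑ i ∈ Finset.range m, a i • x i‖ ≤ K * ‖∑ i ∈ Finset.range n, a i • x i‖

/-- `(e_n)` is a Schauder basis of `X`: nonzero vectors with dense linear span and uniformly
bounded basis projections. -/
def IsSchauderBasis (e : ℕ → X) : Prop :=
  (∀ n, e n ≠ 0) ∧ Dense (↑(Submodule.span ℝ (Set.range e)) : Set X) ∧
  ∃ K : ℝ, 1 ≤ K ∧ ∀ (a : ℕ → ℝ) (m n : ℕ), m ≤ n →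
    ‖∑ i ∈ Finset.range m, a i • e i‖ ≤ K * ‖∑ i ∈ Finset.range n, a i • e i‖

/-- `(y_n)` is a block sequence of `(e_n)`: nonzero finite linear combinations of the `e_i`
with successive supports `supp y₀ < supp y₁ < …`. -/
def IsBlockSeq (e y : ℕ → X) : Prop :=
  (∀ n, y n ≠ 0) ∧ ∃ (I : ℕ → Finset ℕ) (a : ℕ → ℕ → ℝ),
    (∀ n, y n = ∑ i ∈ I n, a n i • e i) ∧
    (∀ n m, n < m → ∀ i ∈ I n, ∀ j ∈ I m, i < j)

/-- Two sequences are equivalent: the map `u_n ↦ v_n` extends to an isomorphism between the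
closed linear spans. -/
def SeqEquiv (u v : ℕ → X) : Prop :=
  ∃ c C : ℝ, 0 < c ∧ ∀ (a : ℕ → ℝ) (s : Finset ℕ),
    c * ‖∑ n ∈ s, a n • u n‖ ≤ ‖∑ n ∈ s, a n • v n‖ ∧
    ‖∑ n ∈ s, a n • v n‖ ≤ C * ‖∑ n ∈ s, a n • u n‖

/-- The closed linear span of a set. -/
def closedSpan (s : Set X) : Submodule ℝ X :=
  (Submodule.span ℝ s).topologicalClosure

/-- A sequence is weakly null if it tends to `0` in the weak topology. -/
def WeaklyNull (x : ℕ → X) : Prop :=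
  ∀ φ : X →L[ℝ] ℝ, Filter.Tendsto (fun n => φ (x n)) Filter.atTop (nhds 0)

end BanachDefs

/-- `Y` embeds into `Z`: there is a bounded linear injection which is an isomorphism onto its
range (bounded below). -/
def Embeds (Y Z : Type*) [NormedAddCommGroup Y] [NormedSpace ℝ Y]
    [NormedAddCommGroup Z] [NormedSpace ℝ Z] : Prop :=
  ∃ T : Y →L[ℝ] Z, ∃ c : ℝ, 0 < c ∧ ∀ y, c * ‖y‖ ≤ ‖T y‖

section StructDefs

variable {X : Type*} [NormedAddCommGroup X] [NormedSpace ℝ X]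

/-- `X` is hereditarily indecomposable: no infinite-dimensional closed subspace is the direct
sum of two infinite-dimensional closed subspaces. -/
def HeredIndec (X : Type*) [NormedAddCommGroup X] [NormedSpace ℝ X] : Prop :=
  ∀ Y U V : Submodule ℝ X,
    IsClosed (Y : Set X) → ¬FiniteDimensional ℝ ↥Y →
    IsClosed (U : Set X) → IsClosed (V : Set X) →
    ¬FiniteDimensional ℝ ↥U → ¬FiniteDimensional ℝ ↥V →
    U ⊓ V = ⊥ → U ⊔ V ≠ Y

/-- The basis `(e_n)` of `X` is tight: for every infinite-dimensional closed subspace `Y` there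
are successive finite sets `I₀ < I₁ < …` such that for every infinite `J ⊆ ℕ`, `Y` does not
embed into `[e_i : i ∈ ℕ ∖ ⋃_{j ∈ J} I_j]`. -/
def TightBasis (e : ℕ → X) : Prop :=
  ∀ Y : Submodule ℝ X, IsClosed (Y : Set X) → ¬FiniteDimensional ℝ ↥Y →
    ∃ I : ℕ → Finset ℕ, (∀ n, (I n).Nonempty) ∧
      (∀ n m, n < m → ∀ i ∈ I n, ∀ j ∈ I m, i < j) ∧
      ∀ J : Set ℕ, J.Infinite →
        ¬ Embeds ↥Y ↥(closedSpan (e '' {i : ℕ | ∀ j ∈ J, i ∉ I j}))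

/-- The sequence `(x_n)` is a subsequentially minimal basis of its closed linear span: every
infinite-dimensional closed subspace of `[x_n]` contains an isomorphic copy of the closed span
of a subsequence of `(x_n)`. -/
def SubseqMinimalBasis (x : ℕ → X) : Prop :=
  ∀ Y : Submodule ℝ X, Y ≤ closedSpan (Set.range x) →
    IsClosed (Y : Set X) → ¬FiniteDimensional ℝ ↥Y →
    ∃ φ : ℕ → ℕ, StrictMono φ ∧ Embeds ↥(closedSpan (Set.range (x ∘ φ))) ↥Y

/-- `X` is quasi-minimal: any two infinite-dimensional closed subspaces contain further
infinite-dimensional closed subspaces which are isomorphic. -/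
def QuasiMinimal (X : Type*) [NormedAddCommGroup X] [NormedSpace ℝ X] : Prop :=
  ∀ Y Z : Submodule ℝ X,
    IsClosed (Y : Set X) → ¬FiniteDimensional ℝ ↥Y →
    IsClosed (Z : Set X) → ¬FiniteDimensional ℝ ↥Z →
    ∃ Y' Z' : Submodule ℝ X, Y' ≤ Y ∧ Z' ≤ Z ∧
      IsClosed (Y' : Set X) ∧ ¬FiniteDimensional ℝ ↥Y' ∧
      IsClosed (Z' : Set X) ∧ ¬FiniteDimensional ℝ ↥Z' ∧
      Nonempty (↥Y' ≃L[ℝ] ↥Z')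

/-- The basis `(x_n)` is sequentially minimal: its closed span is quasi-minimal and every block
sequence of `(x_n)` has a further block sequence which is a subsequentially minimal basis of its
closed linear span. -/
def SeqMinimalBasis (x : ℕ → X) : Prop :=
  QuasiMinimal X ∧
  ∀ y : ℕ → X, IsBlockSeq x y → ∃ z : ℕ → X, IsBlockSeq y z ∧ SubseqMinimalBasis z

/-- `X` is locally minimal: there is `K ≥ 1` such that every finite-dimensional subspace
`K`-embeds into every infinite-dimensional closed subspace. -/
def LocallyMinimal (X : Type*) [NormedAddCommGroup X] [NormedSpace ℝ X] : Prop :=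
  ∃ K : ℝ, 1 ≤ K ∧
    ∀ F : Submodule ℝ X, FiniteDimensional ℝ ↥F →
      ∀ Y : Submodule ℝ X, IsClosed (Y : Set X) → ¬FiniteDimensional ℝ ↥Y →
        ∃ T : ↥F →L[ℝ] ↥Y, ∃ c C : ℝ, 0 < c ∧ C ≤ K * c ∧
          ∀ v : ↥F, c * ‖v‖ ≤ ‖T v‖ ∧ ‖T v‖ ≤ C * ‖v‖

end StructDefs



namespace TS
noncomputable section

open Finset

/-! ### Parameters -/

/-- exponents of the weights -/
def ex (j : ℕ) : ℕ := (j + 3) ^ 2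

/-- the weights `m_j` -/
def mm (j : ℕ) : ℝ := 2 ^ (ex j)

/-- counting bounds -/
def Nrec (γ nh : ℕ) : ℕ → ℕ
  | 0 => 0
  | i + 1 => γ * (nh * (Nrec γ nh i + 1)) + i + 8

/-- auxiliary growth function -/
def QQ (γ nh : ℕ) : ℕ :=
  nh ^ (ex γ + 2) * (2 ^ (ex γ) * 4 ^ (γ + 2) * (nh + 1) * (Nrec γ nh (ex γ - 2) + 1) * 8)

/-- the lengths `n_j` -/
def nn : ℕ → ℕ
  | 0 => QQ 0 2
  | j + 1 => QQ (j + 1) (nn j)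

/-- previous length -/
def npv : ℕ → ℕ
  | 0 => 2
  | j + 1 => nn j

lemma nn_eq (j : ℕ) : nn j = QQ j (npv j) := by cases j <;> rfl

lemma QQ_ge (γ nh : ℕ) (h : 1 ≤ nh) : nh ≤ QQ γ nh := by
  unfold QQ
  have h1 : nh ≤ nh ^ (ex γ + 2) := Nat.le_self_pow (by omega) nh
  refine h1.trans (Nat.le_mul_of_pos_right _ (by positivity))

lemma npv_ge (j : ℕ) : 2 ≤ npv j := by
  induction j with
  | zero => simp [npv]
  | succ j ih =>
    show 2 ≤ nn j
    rw [nn_eq]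
    exact ih.trans (QQ_ge _ _ (by omega))

lemma npv_le_nn (j : ℕ) : npv j ≤ nn j := by
  rw [nn_eq]; exact QQ_ge _ _ (by have := npv_ge j; omega)

lemma nn_mono : Monotone nn := monotone_nat_of_le_succ fun n => npv_le_nn (n + 1)

lemma nn_le_npv {j γ : ℕ} (h : j < γ) : nn j ≤ npv γ := by
  cases γ with
  | zero => omega
  | succ γ => exact nn_mono (by omega)

lemma nn_ge_two (j : ℕ) : 2 ≤ nn j := (npv_ge j).trans (npv_le_nn j)

lemma nn_pow_le (c : ℕ) : nn c ^ (ex (c + 1) + 2) ≤ nn (c + 1) := by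
  show _ ≤ QQ (c + 1) (nn c)
  exact Nat.le_mul_of_pos_right _ (by positivity)

lemma mm_pos (j : ℕ) : 0 < mm j := by unfold mm; positivity

lemma mm_ne (j : ℕ) : mm j ≠ 0 := (mm_pos j).ne'

lemma ex_mono : Monotone ex := fun a b h => by unfold ex; gcongr

lemma mm_mono : Monotone mm := fun a b h => by
  unfold mm; exact pow_le_pow_right₀ (by norm_num) (ex_mono h)

lemma ex_ge (j : ℕ) : j + 9 ≤ ex j := by unfold ex; nlinarith

lemma mm_ge_pow (j : ℕ) : (2:ℝ) ^ (j + 9) ≤ mm j := by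
  unfold mm; exact pow_le_pow_right₀ (by norm_num) (ex_ge j)

lemma mm_ge_pow' (j : ℕ) : (2:ℝ) ^ j ≤ mm j :=
  le_trans (pow_le_pow_right₀ (by norm_num) (by omega)) (mm_ge_pow j)

lemma mm_ge_two (j : ℕ) : (2:ℝ) ≤ mm j := by
  have := mm_ge_pow j
  have h2 : (2:ℝ) ^ 1 ≤ 2 ^ (j + 9) := pow_le_pow_right₀ (by norm_num) (by omega)
  linarith

lemma mm_succ (j : ℕ) : mm (j + 1) = mm j * (2 ^ 7 * 4 ^ j) := by
  unfold mm ex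
  rw [show (4:ℝ) = 2 ^ 2 by norm_num, ← pow_mul, ← pow_add, ← pow_add]
  congr 1; ring

/-- big inequality about `n_γ` -/
lemma QQ_facts (γ : ℕ) :
    12 * 4 ^ γ ≤ nn γ ∧ 4 * 2 ^ (ex γ) * 4 ^ γ ≤ nn γ ∧
    2 ^ ex γ * Nrec γ (npv γ) (ex γ - 2) ≤ nn γ ∧
    2 ^ ex γ * (4 * (npv γ * (Nrec γ (npv γ) (ex γ - 2) + 1))) ≤ nn γ := by
  rw [nn_eq]
  unfold QQ
  set nh := npv γ
  set N := Nrec γ nh (ex γ - 2)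
  have hnh : 2 ≤ nh := npv_ge γ
  have h1 : 1 ≤ nh ^ (ex γ + 2) := Nat.one_le_pow _ _ (by omega)
  have h2 : 1 ≤ 2 ^ ex γ := Nat.one_le_two_pow
  have h3 : 1 ≤ 4 ^ γ := Nat.one_le_pow _ _ (by omega)
  generalize 2 ^ ex γ = a at *
  generalize nh ^ (ex γ + 2) = b at *
  rw [pow_add]
  generalize 4 ^ γ = d at *
  have key : a * (d * 4^2) * (nh+1) * (N+1) * 8 ≤ b * (a * (d * 4^2) * (nh+1) * (N+1) * 8) :=
    Nat.le_mul_of_pos_left _ (by omega)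
  have k1 : 1 ≤ (nh+1) * (N+1) := Nat.one_le_iff_ne_zero.2 (by positivity)
  refine ⟨le_trans ?_ key, le_trans ?_ key, le_trans ?_ key, le_trans ?_ key⟩
  · calc 12 * d ≤ (1 * (d * 4^2)) * 1 * 8 := by omega
      _ ≤ (a * (d * 4^2)) * ((nh+1) * (N+1)) * 8 := by gcongr
      _ = _ := by ring
  · calc 4 * a * d ≤ (a * (d * 4^2)) * 1 * 8 := by nlinarith
      _ ≤ (a * (d * 4^2)) * ((nh+1) * (N+1)) * 8 := by gcongr
      _ = _ := by ring
  · calc a * N ≤ (a * (1 * 4^2)) * ((0+1) * (N+1)) * 8 := by nlinarith [Nat.zero_le (a*N)]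
      _ ≤ (a * (d * 4^2)) * ((nh+1) * (N+1)) * 8 := by gcongr; omega
      _ = _ := by ring
  · calc a * (4 * (nh * (N+1))) ≤ (a * (1 * 4^2)) * ((nh+1) * (N+1)) * 8 := by
          nlinarith [Nat.zero_le (a*(nh * (N+1))), Nat.zero_le (a * (N+1))]
      _ ≤ (a * (d * 4^2)) * ((nh+1) * (N+1)) * 8 := by gcongr
      _ = _ := by ring

lemma nn_pos (j : ℕ) : (0:ℝ) < nn j := by
  have := nn_ge_two j
  exact_mod_cast (by omega : 0 < nn j)

/-- tail sums of `1/m_j` -/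
lemma sum_inv_mm (A : Finset ℕ) (J : ℕ) (h : ∀ j ∈ A, J ≤ j) :
    ∑ j ∈ A, 1 / mm j ≤ 2 / mm J := by
  have hb : ∀ k, 1 / mm (J + k) ≤ (1 / mm J) * (1/2)^k := by
    intro k
    induction k with
    | zero => simp
    | succ k ih =>
      rw [← add_assoc, mm_succ]
      have h4 : (1:ℝ) ≤ 4 ^ (J + k) := one_le_pow₀ (by norm_num)
      have hm := mm_pos (J + k)
      calc 1 / (mm (J+k) * (2^7 * 4 ^ (J+k))) ≤ 1 / (mm (J+k) * 2) := by
            gcongr; nlinarith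
        _ = (1 / mm (J+k)) * (1/2) := by field_simp
        _ ≤ (1 / mm J) * (1/2)^k * (1/2) := by gcongr
        _ = _ := by ring
  obtain ⟨M, hM⟩ : ∃ M, ∀ j ∈ A, j < J + M := by
    refine ⟨A.sup id + 1, fun j hj => ?_⟩
    have : j ≤ A.sup id := Finset.le_sup (f := id) hj
    omega
  have hsub : A ⊆ (Finset.range M).map (addLeftEmbedding J) := by
    intro j hj
    simp only [Finset.mem_map, Finset.mem_range, addLeftEmbedding_apply]
    exact ⟨j - J, by have := hM j hj; have := h j hj; omega, by have := h j hj; omega⟩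
  calc ∑ j ∈ A, 1 / mm j ≤ ∑ j ∈ (Finset.range M).map (addLeftEmbedding J), 1 / mm j :=
        Finset.sum_le_sum_of_subset_of_nonneg hsub
          fun i _ _ => (div_pos one_pos (mm_pos i)).le
    _ = ∑ k ∈ Finset.range M, 1 / mm (J + k) := by simp
    _ ≤ ∑ k ∈ Finset.range M, (1 / mm J) * (1/2)^k := Finset.sum_le_sum fun k _ => hb k
    _ = (1 / mm J) * ∑ k ∈ Finset.range M, (1/2:ℝ)^k := by rw [Finset.mul_sum]
    _ ≤ (1 / mm J) * 2 := by
        have hm := mm_pos J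
        gcongr
        exact sum_geometric_two_le M
    _ = _ := by ring

lemma sum_inv_mm_all (A : Finset ℕ) : ∑ j ∈ A, 1 / mm j ≤ 1 / 4 := by
  refine (sum_inv_mm A 0 (by simp)).trans ?_
  have := mm_ge_pow 0
  rw [div_le_iff₀ (mm_pos 0)]
  norm_num at this ⊢
  linarith

lemma sum_half (s : Finset ℕ) : ∑ k ∈ s, (1/2:ℝ)^k ≤ 2 := by
  obtain ⟨M, hM⟩ : ∃ M, s ⊆ range M := ⟨s.sup id + 1, fun j hj => by
    have : j ≤ s.sup id := Finset.le_sup (f := id) hj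
    simp; omega⟩
  exact (Finset.sum_le_sum_of_subset_of_nonneg hM fun i _ _ => by positivity).trans
    (sum_geometric_two_le M)

end
end TS


namespace TS
noncomputable section

open Finset

/-! ### Vectors and functionals -/

/-- finitely supported vectors -/
abbrev Vec := ℕ →₀ ℝ

/-- the pairing -/
def pr (f : ℕ → ℝ) : Vec →ₗ[ℝ] ℝ := Finsupp.linearCombination ℝ f

/-- the `ℓ₁` norm -/
def l1 (x : Vec) : ℝ := ∑ n ∈ x.support, |x n|

/-- restriction to an interval -/
def res (a b : ℕ) (f : ℕ → ℝ) : ℕ → ℝ := fun n => if a ≤ n ∧ n < b then f n else 0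

lemma pr_apply (f : ℕ → ℝ) (x : Vec) : pr f x = ∑ n ∈ x.support, x n * f n := by
  simp [pr, Finsupp.linearCombination_apply, Finsupp.sum]

lemma pr_congr {f g : ℕ → ℝ} {x : Vec} (h : ∀ n, x n ≠ 0 → f n = g n) : pr f x = pr g x := by
  rw [pr_apply, pr_apply]
  exact Finset.sum_congr rfl fun n hn => by rw [h n (Finsupp.mem_support_iff.1 hn)]

lemma pr_eq_zero {f : ℕ → ℝ} {x : Vec} (h : ∀ n, x n ≠ 0 → f n = 0) : pr f x = 0 := by
  rw [pr_apply]
  exact Finset.sum_eq_zero fun n hn => by rw [h n (Finsupp.mem_support_iff.1 hn), mul_zero]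

lemma pr_sum {ι : Type*} (s : Finset ι) (f : ι → ℕ → ℝ) (x : Vec) :
    pr (fun n => ∑ r ∈ s, f r n) x = ∑ r ∈ s, pr (f r) x := by
  simp only [pr_apply]
  rw [Finset.sum_comm]
  simp only [Finset.mul_sum]

lemma pr_smul (c : ℝ) (f : ℕ → ℝ) (x : Vec) : pr (fun n => c * f n) x = c * pr f x := by
  simp only [pr_apply, Finset.mul_sum]
  exact Finset.sum_congr rfl fun n _ => by ring

lemma pr_div (c : ℝ) (f : ℕ → ℝ) (x : Vec) : pr (fun n => f n / c) x = pr f x / c := by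
  have h : (fun n => f n / c) = fun n => c⁻¹ * f n := by ext n; rw [div_eq_inv_mul]
  rw [h, pr_smul, div_eq_inv_mul]

lemma pr_single (f : ℕ → ℝ) (n : ℕ) (a : ℝ) : pr f (Finsupp.single n a) = a * f n := by
  simp [pr]

lemma exists_of_pr_ne {f : ℕ → ℝ} {x : Vec} (h : pr f x ≠ 0) : ∃ n, x n ≠ 0 ∧ f n ≠ 0 := by
  by_contra hc
  push Not at hc
  exact h (pr_eq_zero hc)

lemma pr_le_l1 {f : ℕ → ℝ} {C : ℝ} (hf : ∀ n, |f n| ≤ C) (x : Vec) : |pr f x| ≤ C * l1 x := by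
  rw [pr_apply, l1, Finset.mul_sum]
  refine (Finset.abs_sum_le_sum_abs _ _).trans (Finset.sum_le_sum fun n _ => ?_)
  rw [abs_mul, mul_comm]
  exact mul_le_mul_of_nonneg_right (hf n) (abs_nonneg _)

lemma l1_nonneg (x : Vec) : 0 ≤ l1 x := Finset.sum_nonneg fun _ _ => abs_nonneg _

lemma res_ne {a b : ℕ} {f : ℕ → ℝ} {n : ℕ} (h : res a b f n ≠ 0) : (a ≤ n ∧ n < b) ∧ f n ≠ 0 := by
  unfold res at h
  split_ifs at h with h1
  · exact ⟨h1, h⟩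
  · exact absurd rfl h

/-- successive functionals -/
def SuccF (f : ℕ → ℕ → ℝ) : Prop :=
  ∀ r r', r < r' → ∀ n n', f r n ≠ 0 → f r' n' ≠ 0 → n < n'

def SuccV (x : ℕ → Vec) : Prop :=
  ∀ r r', r < r' → ∀ n n', x r n ≠ 0 → x r' n' ≠ 0 → n < n'

abbrev Code := (ℕ →₀ ℚ) × ℕ

lemma exists_cod : ∃ f : List Code → ℕ, Function.Injective f := exists_injective_nat _

/-- injective coding -/
def cod : List Code → ℕ := exists_cod.choose

lemma cod_inj : Function.Injective cod := exists_cod.choose_spec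

/-- the coded weights -/
def sg (p : ℕ → Code) (l : ℕ) : ℕ := 2 * cod ((List.range l).map p) + 1

lemma sg_inj {p q : ℕ → Code} {l i : ℕ} (h : sg p l = sg q i) : l = i ∧ ∀ k < i, p k = q k := by
  unfold sg at h
  have h1 : (List.range l).map p = (List.range i).map q := cod_inj (by omega)
  have h2 : l = i := by simpa using congrArg List.length h1
  subst h2
  refine ⟨rfl, fun k hk => ?_⟩
  exact List.map_inj_left.1 h1 k (List.mem_range.2 hk)

lemma sg_congr {p q : ℕ → Code} {i : ℕ} (h : ∀ k < i, p k = q k) : sg p i = sg q i := by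
  unfold sg
  rw [List.map_congr_left fun k hk => h k (List.mem_range.1 hk)]

lemma sg_odd (p : ℕ → Code) (l : ℕ) : sg p l % 2 = 1 := by unfold sg; omega

/-- cast rational vectors -/
def castV (q : ℕ →₀ ℚ) : Vec := q.mapRange (fun a : ℚ => (a : ℝ)) (by simp)

/-- functional with a single coordinate -/
def bas (n : ℕ) (a : ℝ) : ℕ → ℝ := fun k => if k = n then a else 0

/-- The norming set, with weights. -/
inductive W : Option ℕ → (ℕ → ℝ) → Prop
  | basis (n : ℕ) (a : ℝ) (ha : |a| ≤ 1) : W none (bas n a)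
  | op (j d : ℕ) (f : ℕ → ℕ → ℝ) (τ : ℕ → Option ℕ) (hd : d ≤ nn j)
      (hf : ∀ r, W (τ r) (f r)) (hs : SuccF f) : W (some j) (fun n => (∑ r ∈ range d, f r n) / mm j)
  | spec (p : ℕ → Code) (g : ℕ → ℕ → ℝ) (S : Finset ℕ) (a b : ℕ)
      (hg : ∀ l, W (some (sg p l)) (g l)) (hs : SuccF g) (h0 : ∀ l, l ∉ S → g l = 0)
      (hn : ∀ l n, g l n ≠ 0 → S.card ≤ n)
      (hc : ∀ t, |pr (g (2*t)) (castV (p (2*t)).1) - pr (g (2*t+1)) (castV (p (2*t+1)).1)|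
        ≤ (1/2)^t) : W none (res a b (fun n => ∑ l ∈ S, g l n))

/-- membership in the norming set -/
def Wm (f : ℕ → ℝ) : Prop := ∃ τ, W τ f

lemma W_zero_none : W none 0 := by
  have := W.basis 0 0 (by simp)
  convert this using 1
  ext n; simp [bas]

lemma W_zero (j : ℕ) : W (some j) 0 := by
  have := W.op j 0 (fun _ => 0) (fun _ => none) (by simp) (fun _ => W_zero_none)
    (fun _ _ _ _ _ h => by simp at h)
  convert this using 1
  ext n; simp

lemma res_res (a b c d : ℕ) (f : ℕ → ℝ) : res a b (res c d f) = res (max a c) (min b d) f := by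
  ext n
  unfold res
  by_cases h1 : a ≤ n ∧ n < b <;> by_cases h2 : c ≤ n ∧ n < d
  · rw [if_pos h1, if_pos h2, if_pos]; omega
  · rw [if_pos h1, if_neg h2, if_neg]; omega
  · rw [if_neg h1, if_neg]; omega
  · rw [if_neg h1, if_neg]; omega

lemma W_res {τ f} (h : W τ f) (a b : ℕ) : W τ (res a b f) := by
  induction h with
  | basis n x hx =>
    by_cases hn : a ≤ n ∧ n < b
    · convert W.basis n x hx using 1
      ext k; simp only [res, bas]; grind
    · convert W_zero_none using 1
      ext k; simp only [res, bas, Pi.zero_apply]; grind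
  | op j d f τ hd hf hs ih =>
    convert W.op j d (fun r => res a b (f r)) τ hd ih ?_ using 1
    · ext n
      simp only [res]
      split_ifs <;> simp
    · intro r r' hr n n' h h'
      exact hs r r' hr n n' (res_ne h).2 (res_ne h').2
  | spec p g S a' b' hg hs h0 hn hc ih =>
    rw [res_res]
    exact W.spec p g S _ _ hg hs h0 hn hc

lemma W_smul {τ f} (h : W τ f) (c : ℝ) (hc1 : |c| ≤ 1) : W τ (fun n => c * f n) := by
  induction h with
  | basis n x hx =>
    convert W.basis n (c * x) ?_ using 1
    · ext k; simp only [bas]; split_ifs <;> simp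
    · rw [abs_mul]; exact mul_le_one₀ hc1 (abs_nonneg _) hx
  | op j d f τ hd hf hs ih =>
    convert W.op j d (fun r n => c * f r n) τ hd ih ?_ using 1
    · ext n
      rw [← Finset.mul_sum]; ring
    · intro r r' hr n n' h h'
      exact hs r r' hr n n' (right_ne_zero_of_mul h) (right_ne_zero_of_mul h')
  | spec p g S a' b' hg hs h0 hn hc ih =>
    convert W.spec p (fun r n => c * g r n) S a' b' ih ?_ ?_ ?_ ?_ using 1
    · ext n
      simp only [res]
      rw [← Finset.mul_sum]; split_ifs <;> simp
    · intro r r' hr n n' h h'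
      exact hs r r' hr n n' (right_ne_zero_of_mul h) (right_ne_zero_of_mul h')
    · intro l hl; ext n; simp [h0 l hl]
    · intro l n h
      exact hn l n (right_ne_zero_of_mul h)
    · intro t
      rw [pr_smul, pr_smul, ← mul_sub, abs_mul]
      calc _ ≤ 1 * (1/2:ℝ)^t := mul_le_mul hc1 (hc t) (abs_nonneg _) (by norm_num)
        _ = _ := one_mul _

/-- sum of successive functionals at a point: at most one is nonzero -/
lemma abs_sum_le_of_succ {f : ℕ → ℕ → ℝ} (hs : SuccF f) (A : Finset ℕ) (n : ℕ) {C : ℝ} (hC : 0 ≤ C)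
    (h : ∀ r, |f r n| ≤ C) : |∑ r ∈ A, f r n| ≤ C := by
  by_cases hz : ∃ r ∈ A, f r n ≠ 0
  · obtain ⟨r, hr, hrn⟩ := hz
    rw [Finset.sum_eq_single_of_mem r hr]
    · exact h r
    · intro b _ hb
      by_contra hc
      rcases lt_or_gt_of_ne hb with h1 | h1
      · exact absurd (hs _ _ h1 _ _ hc hrn) (lt_irrefl _)
      · exact absurd (hs _ _ h1 _ _ hrn hc) (lt_irrefl _)
  · push Not at hz
    rw [Finset.sum_eq_zero hz]; simpa

lemma W_bound {τ f} (h : W τ f) : (∀ n, |f n| ≤ 1) ∧ (∀ j, τ = some j → ∀ n, |f n| ≤ 1 / mm j) ∧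
    ∃ R, ∀ n, f n ≠ 0 → n < R := by
  induction h with
  | basis n x hx =>
    refine ⟨fun k => ?_, fun j hj => by simp at hj, n + 1, fun k hk => ?_⟩
    · unfold bas; split_ifs <;> simp [hx]
    · unfold bas at hk
      have : k = n := by by_contra hc; simp [hc] at hk
      omega
  | op j d f τ hd hf hs ih =>
    have key : ∀ n, |(∑ r ∈ range d, f r n) / mm j| ≤ 1 / mm j := by
      intro n
      rw [abs_div, abs_of_pos (mm_pos j)]
      have := mm_pos j
      gcongr
      exact abs_sum_le_of_succ hs _ n zero_le_one fun r => (ih r).1 n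
    refine ⟨fun n => (key n).trans ?_, fun j' hj' n => ?_, ?_⟩
    · rw [div_le_one (mm_pos j)]; linarith [mm_ge_two j]
    · rw [← Option.some_inj.1 hj']; exact key n
    · choose R hR using fun r => (ih r).2.2
      refine ⟨∑ r ∈ range d, R r, fun n hn => ?_⟩
      have : ∑ r ∈ range d, f r n ≠ 0 := fun h => hn (by simp [h])
      obtain ⟨r, hr, hrn⟩ := Finset.exists_ne_zero_of_sum_ne_zero this
      exact (hR r n hrn).trans_le (Finset.single_le_sum (f := R) (fun _ _ => Nat.zero_le _) hr)
  | spec p g S a' b' hg hs h0 hn hc ih =>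
    refine ⟨fun n => ?_, fun j hj => by simp at hj, b', fun n hn => (res_ne hn).1.2⟩
    unfold res
    split_ifs
    · exact abs_sum_le_of_succ hs _ n zero_le_one fun r => (ih r).1 n
    · simp

lemma Wm_l1 {f} (h : Wm f) (x : Vec) : |pr f x| ≤ l1 x := by
  obtain ⟨τ, h⟩ := h
  simpa using pr_le_l1 (W_bound h).1 x

lemma Wj_l1 {f j} (h : W (some j) f) (x : Vec) : |pr f x| ≤ l1 x / mm j := by
  have := pr_le_l1 ((W_bound h).2.1 j rfl) x
  rwa [one_div, ← div_eq_inv_mul] at this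

lemma Wm_res {f} (h : Wm f) (a b : ℕ) : Wm (res a b f) := by
  obtain ⟨τ, h⟩ := h
  exact ⟨τ, W_res h a b⟩

lemma Wm_smul {f} (h : Wm f) (c : ℝ) (hc : |c| ≤ 1) : Wm (fun n => c * f n) := by
  obtain ⟨τ, h⟩ := h
  exact ⟨τ, W_smul h c hc⟩

lemma W.mem {τ f} (h : W τ f) : Wm f := ⟨τ, h⟩

/-! ### Combinatorial lemmas -/

lemma SuccV.unique {x : ℕ → Vec} (hx : SuccV x) {k k' n : ℕ} (h : x k n ≠ 0) (h' : x k' n ≠ 0) :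
    k = k' := by
  rcases lt_trichotomy k k' with h1 | h1 | h1
  · exact absurd (hx _ _ h1 _ _ h h') (lt_irrefl _)
  · exact h1
  · exact absurd (hx _ _ h1 _ _ h' h) (lt_irrefl _)

lemma SuccV.comp {x : ℕ → Vec} (hx : SuccV x) {φ : ℕ → ℕ} (hφ : StrictMono φ) :
    SuccV (fun k => x (φ k)) := fun r r' h n n' => hx _ _ (hφ h) n n'

lemma count_weight {j : ℕ} {f : ℕ → ℝ} (hf : W (some j) f) {x : ℕ → Vec} (hx : SuccV x)
    {θ : ℝ} (hθ : 0 ≤ θ) {N : ℕ}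
    (hN : ∀ f' : ℕ → ℝ, Wm f' → ∀ A' : Finset ℕ, (∀ k ∈ A', 2 * θ < |pr f' (x k)|) → A'.card ≤ N)
    (A : Finset ℕ) (hA : ∀ k ∈ A, 2 / mm j * θ < |pr f (x k)|) : A.card ≤ nn j * (N + 1) := by
  cases hf with
  | op _ d f τ hd hf hs =>
  classical
  set A1 : Finset ℕ := (range d).biUnion fun r => A.filter fun k => 2 * θ < |pr (f r) (x k)|
  have h1 : A1.card ≤ d * N := by
    have := Finset.card_biUnion_le_card_mul (range d)
      (fun r => A.filter fun k => 2 * θ < |pr (f r) (x k)|) N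
      (fun r _ => hN (f r) (hf r).mem _ fun k hk => (Finset.mem_filter.1 hk).2)
    simpa using this
  -- for the remaining k there are two nonzero terms
  have h2 : ∀ k ∈ A \ A1, ∃ r r', r < r' ∧ r' < d ∧ pr (f r) (x k) ≠ 0 ∧ pr (f r') (x k) ≠ 0 := by
    intro k hk
    obtain ⟨hkA, hk1⟩ := Finset.mem_sdiff.1 hk
    have hsm : ∀ r ∈ range d, |pr (f r) (x k)| ≤ 2 * θ := by
      intro r hr
      by_contra hc
      push Not at hc
      exact hk1 (Finset.mem_biUnion.2 ⟨r, hr, Finset.mem_filter.2 ⟨hkA, hc⟩⟩)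
    have hval := hA k hkA
    rw [pr_div, pr_sum, abs_div, abs_of_pos (mm_pos j)] at hval
    have hval2 : 2 * θ < |∑ r ∈ range d, pr (f r) (x k)| := by
      rw [div_mul_eq_mul_div] at hval
      have := mm_pos j
      exact (div_lt_div_iff_of_pos_right this).1 hval
    by_contra hc
    push Not at hc
    have hne : ∑ r ∈ range d, pr (f r) (x k) ≠ 0 := by
      intro h; rw [h] at hval2; simp at hval2; linarith
    obtain ⟨r, hr, hrn⟩ := Finset.exists_ne_zero_of_sum_ne_zero hne
    rw [Finset.sum_eq_single_of_mem r hr] at hval2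
    · linarith [hsm r hr]
    · intro b hb hbr
      by_contra hbn
      rcases lt_or_gt_of_ne hbr with h | h
      · exact hrn (hc b r h (Finset.mem_range.1 hr) hbn)
      · exact hbn (hc r b h (Finset.mem_range.1 hb) hrn)
  choose! R R' hR using h2
  have h3 : (A \ A1).card ≤ d := by
    have := Finset.card_le_card_of_injOn (s := A \ A1) (t := range d) R
      (fun k hk => Finset.mem_coe.2 (Finset.mem_range.2 ((hR k hk).1.trans (hR k hk).2.1))) ?_
    · simpa using this
    · have key : ∀ k ∈ A \ A1, ∀ k' ∈ A \ A1, k < k' → R k = R k' → False := by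
        intro k hk k' hk' hlt he
        obtain ⟨a1, a2, a3, a4⟩ := hR k hk
        obtain ⟨b1, b2, b3, b4⟩ := hR k' hk'
        obtain ⟨n, hn1, hn2⟩ := exists_of_pr_ne a4
        obtain ⟨n', hn1', hn2'⟩ := exists_of_pr_ne b3
        have c1 := hx k k' hlt _ _ hn1 hn1'
        have c2 := hs (R k') (R' k) (he ▸ a1) _ _ hn2' hn2
        omega
      intro k hk k' hk' he
      rcases lt_trichotomy k k' with h | h | h
      · exact (key k hk k' hk' h he).elim
      · exact h
      · exact (key k' hk' k hk h he.symm).elim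
  have h4 : A.card ≤ (A \ A1).card + A1.card := by
    have := Finset.card_le_card_sdiff_add_card (s := A) (t := A1)
    omega
  calc A.card ≤ d + d * N := by omega
    _ = d * (N + 1) := by ring
    _ ≤ _ := Nat.mul_le_mul_right _ hd

/-- staircase lemma -/
lemma stair {f : ℕ → ℕ → ℝ} (hs : SuccF f) {x : ℕ → Vec} (hx : SuccV x) (d N : ℕ) :
    (((range d) ×ˢ (range N)).filter fun q => pr (f q.1) (x q.2) ≠ 0).card ≤ d + N := by
  classical
  have := Finset.card_le_card_of_injOn
    (s := ((range d) ×ˢ (range N)).filter fun q => pr (f q.1) (x q.2) ≠ 0)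
    (t := range (d + N)) (fun q => q.1 + q.2) ?_ ?_
  · simpa using this
  · intro q hq
    simp only [Finset.coe_filter, Set.mem_ofPred_eq, Finset.mem_product, Finset.mem_range] at hq
    simp only [Finset.coe_range, Set.mem_Iio]; omega
  · have key : ∀ a b a' b', pr (f a) (x b) ≠ 0 → pr (f a') (x b') ≠ 0 → a < a' → b' < b → False := by
      intro a b a' b' h h' ha hb
      obtain ⟨n, hn1, hn2⟩ := exists_of_pr_ne h
      obtain ⟨n', hn1', hn2'⟩ := exists_of_pr_ne h'
      have c1 := hx _ _ hb _ _ hn1' hn1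
      have c2 := hs _ _ ha _ _ hn2 hn2'
      omega
    rintro ⟨a, b⟩ hq ⟨a', b'⟩ hq' he
    simp only [Finset.coe_filter, Set.mem_ofPred_eq, Finset.mem_product, Finset.mem_range] at hq hq'
    simp only at he
    rcases lt_trichotomy a a' with h | h | h
    · exact (key a b a' b' hq.2 hq'.2 h (by omega)).elim
    · have : b = b' := by omega
      simp [h, this]
    · exact (key a' b' a b hq'.2 hq.2 h (by omega)).elim

lemma stair_bound {f : ℕ → ℕ → ℝ} (hs : SuccF f) {x : ℕ → Vec} (hx : SuccV x) (d N : ℕ) {C : ℝ}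
    (hC : ∀ r k, |pr (f r) (x k)| ≤ C) :
    ∑ r ∈ range d, ∑ k ∈ range N, |pr (f r) (x k)| ≤ (d + N) * C := by
  classical
  have hC0 : 0 ≤ C := (abs_nonneg _).trans (hC 0 0)
  rw [← Finset.sum_product' (range d) (range N) fun r k => |pr (f r) (x k)|]
  rw [← Finset.sum_filter_of_ne (p := fun q : ℕ × ℕ => pr (f q.1) (x q.2) ≠ 0)]
  · calc _ ≤ ∑ q ∈ ((range d) ×ˢ (range N)).filter fun q => pr (f q.1) (x q.2) ≠ 0, C :=
          Finset.sum_le_sum fun q _ => hC _ _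
      _ = (((range d) ×ˢ (range N)).filter fun q => pr (f q.1) (x q.2) ≠ 0).card * C := by simp
      _ ≤ _ := by
          gcongr
          exact_mod_cast stair hs hx d N
  · intro q _ h hc
    simp [hc] at h

end
end TS


namespace TS
noncomputable section

open Finset

/-- data of a special functional -/
structure SpecData (p : ℕ → Code) (g : ℕ → ℕ → ℝ) (S : Finset ℕ) : Prop where
  hg : ∀ l, W (some (sg p l)) (g l)
  hs : SuccF g
  h0 : ∀ l, l ∉ S → g l = 0
  hn : ∀ l n, g l n ≠ 0 → S.card ≤ n
  hc : ∀ t, |pr (g (2*t)) (castV (p (2*t)).1) - pr (g (2*t+1)) (castV (p (2*t+1)).1)| ≤ (1/2)^t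

lemma SpecData.toW {p g S} (h : SpecData p g S) (a b : ℕ) :
    W none (res a b (fun n => ∑ l ∈ S, g l n)) :=
  W.spec p g S a b h.hg h.hs h.h0 h.hn h.hc

/-- the counting property -/
structure HP (C : ℝ) (x : ℕ → Vec) : Prop where
  pos : 0 < C
  succ : SuccV x
  ha : ∀ j f, W (some j) f → ∃ k0, ∀ k, k ≠ k0 → |pr f (x k)| ≤ C / mm j + C * (1/2)^k
  hb : ∀ p g S a b, SpecData p g S → ∃ Ex : Finset ℕ, Ex.card ≤ 4 ∧ ∀ k, k ∉ Ex → ∀ J,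
    |pr (res a b (fun n => ∑ l ∈ S, g l n)) (x k)| ≤
      ∑ l ∈ S.filter (fun l => sg p l < J), |pr (res a b (g l)) (x k)| + C / mm J + C * (1/2)^k
  hc : ∀ f, Wm f → ∀ k, |pr f (x k)| ≤ C

lemma sg_inj_self {p : ℕ → Code} {l i : ℕ} (h : sg p l = sg p i) : l = i := (sg_inj h).1

lemma pow_half_le {i k : ℕ} (h : i ≤ k) : (1/2:ℝ)^k ≤ (1/2)^i :=
  pow_le_pow_of_le_one (by norm_num) (by norm_num) h

lemma sum_inv_sg (p : ℕ → Code) (S : Finset ℕ) (J : ℕ) (h : ∀ l ∈ S, J ≤ sg p l) :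
    ∑ l ∈ S, 1 / mm (sg p l) ≤ 2 / mm J := by
  classical
  have : ∑ l ∈ S, 1 / mm (sg p l) = ∑ j ∈ S.image (sg p), 1 / mm j := by
    rw [Finset.sum_image]
    intro a _ b _ hab
    exact sg_inj_self hab
  rw [this]
  refine sum_inv_mm _ _ ?_
  intro j hj
  obtain ⟨l, hl, rfl⟩ := Finset.mem_image.1 hj
  exact h l hl

lemma sum_inv_sg_all (p : ℕ → Code) (S : Finset ℕ) : ∑ l ∈ S, 1 / mm (sg p l) ≤ 1 / 4 := by
  refine (sum_inv_sg p S 0 (by simp)).trans ?_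
  have := mm_ge_pow 0
  rw [div_le_iff₀ (mm_pos 0)]
  norm_num at this ⊢
  linarith

/-- The counting lemma. -/
lemma counting {C : ℝ} {x : ℕ → Vec} (H : HP C x) {γ nh : ℕ} (hnh : ∀ j < γ, nn j ≤ nh) :
    ∀ i, (2:ℝ)^(i+2) ≤ mm γ → ∀ f, Wm f → ∀ A : Finset ℕ,
      (∀ k ∈ A, C * (1/2)^i < |pr f (x k)|) → A.card ≤ Nrec γ nh i := by
  classical
  intro i
  have hC := H.pos
  induction i with
  | zero =>
    intro _ f hf A hA
    have : A = ∅ := by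
      refine Finset.eq_empty_of_forall_notMem fun k hk => ?_
      have h1 := hA k hk
      have h2 := H.hc f hf k
      simp at h1
      linarith
    simp [this, Nrec]
  | succ i ih =>
    intro hm f hf A hA
    have hm1 : (2:ℝ)^(i+2) ≤ mm γ := le_trans (pow_le_pow_right₀ (by norm_num) (by omega)) hm
    have ih := ih hm1
    -- basic estimate of small terms
    have hsmall : ∀ j, γ ≤ j → C / mm j ≤ C * (1/2)^(i+3) := by
      intro j hj
      have h1 : (2:ℝ)^(i+3) ≤ mm j := le_trans (by simpa [add_assoc] using hm) (mm_mono hj)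
      rw [one_div, inv_pow, ← div_eq_mul_inv]
      gcongr
    have hpi : (1/2:ℝ)^(i+3) = (1/2)^(i+1) / 4 := by rw [pow_add, pow_add]; ring
    have hpi0 : (0:ℝ) < (1/2)^(i+1) := by positivity
    set θ : ℝ := C * (1/2)^(i+1) with hθ
    have hθ0 : 0 < θ := by positivity
    have h2θ : 2 * θ = C * (1/2)^i := by rw [hθ, pow_succ]; ring
    -- weights less than γ
    have hwt : ∀ j < γ, ∀ f', W (some j) f' → ∀ A' : Finset ℕ,
        (∀ k ∈ A', 2 / mm j * θ < |pr f' (x k)|) → A'.card ≤ nh * (Nrec γ nh i + 1) := by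
      intro j hj f' hf' A' hA'
      refine (count_weight hf' H.succ hθ0.le (N := Nrec γ nh i) ?_ A' hA').trans
        (Nat.mul_le_mul_right _ (hnh j hj))
      intro f'' hf'' A'' hA''
      exact ih f'' hf'' A'' fun k hk => by rw [← h2θ]; exact hA'' k hk
    show A.card ≤ γ * (nh * (Nrec γ nh i + 1)) + i + 8
    obtain ⟨τ, hf⟩ := hf
    have weighted : ∀ j, W (some j) f → A.card ≤ γ * (nh * (Nrec γ nh i + 1)) + i + 8 := by
      intro j hj
      by_cases hjγ : j < γ
      · have h1 : A.card ≤ nh * (Nrec γ nh i + 1) := by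
          refine hwt j hjγ f hj A fun k hk => lt_of_le_of_lt ?_ (hA k hk)
          have : 2 / mm j ≤ 1 := by rw [div_le_one (mm_pos j)]; exact mm_ge_two j
          nlinarith
        have h2 : nh * (Nrec γ nh i + 1) ≤ γ * (nh * (Nrec γ nh i + 1)) :=
          Nat.le_mul_of_pos_left _ (by omega)
        omega
      · push Not at hjγ
        obtain ⟨k0, hk0⟩ := H.ha j f hj
        have hsub : A ⊆ insert k0 (range (i + 3)) := by
          intro k hk
          by_contra hc
          simp only [Finset.mem_insert, Finset.mem_range, not_or, not_lt] at hc
          have h1 := hk0 k hc.1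
          have h2 := hA k hk
          have h3 := hsmall j hjγ
          have h4 : C * (1/2:ℝ)^k ≤ C * (1/2)^(i+3) := by
            gcongr C * ?_; exact pow_half_le hc.2
          rw [hpi] at h3 h4
          nlinarith
        have := (Finset.card_le_card hsub).trans (Finset.card_insert_le _ _)
        simp at this
        omega
    cases hf with
    | basis n a ha =>
      have : A.card ≤ 1 := by
        refine Finset.card_le_one.2 fun k hk k' hk' => ?_
        have h1 : ∀ k ∈ A, x k n ≠ 0 := by
          intro k hk
          have : pr (bas n a) (x k) ≠ 0 := by
            intro h
            have := hA k hk
            rw [h] at this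
            simp at this
            linarith
          obtain ⟨n', hn1, hn2⟩ := exists_of_pr_ne this
          have : n' = n := by
            by_contra hc; simp [bas, hc] at hn2
          rwa [this] at hn1
        exact H.succ.unique (h1 k hk) (h1 k' hk')
      omega
    | op j d f τ hd hf hs => exact weighted j (W.op j d f τ hd hf hs)
    | spec p g S a b hg hs h0 hn hc =>
      obtain ⟨Ex, hEx, hE⟩ := H.hb p g S a b ⟨hg, hs, h0, hn, hc⟩
      set S' := S.filter (fun l => sg p l < γ) with hS'
      set Al : ℕ → Finset ℕ := fun l =>
        A.filter fun k => 2 / mm (sg p l) * θ < |pr (res a b (g l)) (x k)|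
      have hcardS : S'.card ≤ γ := by
        have := Finset.card_le_card_of_injOn (s := S') (t := range γ) (sg p) ?_ ?_
        · simpa using this
        · intro l hl
          have := (Finset.mem_filter.1 (Finset.mem_coe.1 hl)).2
          simpa using this
        · intro l _ l' _ h
          exact sg_inj_self h
      have hbi : (S'.biUnion Al).card ≤ γ * (nh * (Nrec γ nh i + 1)) := by
        refine (Finset.card_biUnion_le_card_mul S' Al (nh * (Nrec γ nh i + 1)) ?_).trans
          (Nat.mul_le_mul_right _ hcardS)
        intro l hl
        refine hwt (sg p l) (Finset.mem_filter.1 hl).2 _ (W_res (hg l) a b) _ ?_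
        intro k hk
        exact (Finset.mem_filter.1 hk).2
      have hsub : A ⊆ (S'.biUnion Al) ∪ (Ex ∪ range (i+3)) := by
        intro k hk
        by_contra hcon
        simp only [Finset.mem_union, not_or, Finset.mem_range, not_lt] at hcon
        obtain ⟨hc1, hc2, hc3⟩ := hcon
        have h1 := hE k hc2 γ
        have h2 := hA k hk
        have h3 := hsmall γ le_rfl
        have h4 : C * (1/2:ℝ)^k ≤ C * (1/2)^(i+3) := by
          gcongr C * ?_; exact pow_half_le hc3
        have h5 : ∑ l ∈ S', |pr (res a b (g l)) (x k)| ≤ 1/2 * θ := by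
          calc _ ≤ ∑ l ∈ S', (2 * θ) * (1 / mm (sg p l)) := by
                refine Finset.sum_le_sum fun l hl => ?_
                have : k ∉ Al l := fun h => hc1 (Finset.mem_biUnion.2 ⟨l, hl, h⟩)
                have h6 : ¬ (2 / mm (sg p l) * θ < |pr (res a b (g l)) (x k)|) :=
                  fun h => this (Finset.mem_filter.2 ⟨hk, h⟩)
                push Not at h6
                calc _ ≤ _ := h6
                  _ = _ := by ring
            _ = (2 * θ) * ∑ l ∈ S', 1 / mm (sg p l) := by rw [Finset.mul_sum]
            _ ≤ (2 * θ) * (1/4) := by gcongr; exact sum_inv_sg_all p S'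
            _ = _ := by ring
        rw [hpi] at h3 h4
        nlinarith
      have h1 := Finset.card_le_card hsub
      have h2 := Finset.card_union_le (S'.biUnion Al) (Ex ∪ range (i+3))
      have h3 := Finset.card_union_le Ex (range (i+3))
      simp only [Finset.card_range] at h3
      omega

/-- universal counts -/
def Ncnt (s : ℕ) : ℕ := Nrec s (npv s) s

/-- monotone universal counts -/
def NN (s : ℕ) : ℕ := ∑ i ∈ range (s + 1), Ncnt i

lemma NN_mono : Monotone NN := fun a b h => by
  unfold NN
  exact Finset.sum_le_sum_of_subset (Finset.range_mono (by omega))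

lemma count_univ {C : ℝ} {x : ℕ → Vec} (H : HP C x) (s : ℕ) {f} (hf : Wm f) (A : Finset ℕ)
    (hA : ∀ k ∈ A, C * (1/2)^s < |pr f (x k)|) : A.card ≤ NN s := by
  have h1 : A.card ≤ Ncnt s := counting H
    (fun j hj => nn_le_npv hj) s
    (le_trans (pow_le_pow_right₀ (by norm_num) (by omega)) (mm_ge_pow s)) f hf A hA
  exact h1.trans (Finset.single_le_sum (f := Ncnt) (fun _ _ => Nat.zero_le _)
    (Finset.mem_range.2 (by omega)))

/-! ### RIS -/

/-- second order rapidly increasing sequences -/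
structure RIS (w : ℕ → Vec) (c : ℕ → ℕ) : Prop where
  succ : SuccV w
  bdd : ∀ f, Wm f → ∀ k, |pr f (w k)| ≤ 1
  lo : ∀ j f, W (some j) f → ∀ k, j ≤ c k → |pr f (w k)| ≤ 4 / mm j
  hi : ∀ j f, W (some j) f → ∀ k, c k + 2 ≤ j → |pr f (w k)| ≤ (1/4)^(c k)
  mono : StrictMono c
  odd : ∀ k, c k % 2 = 1
  sup : ∀ k n, w k n ≠ 0 → n + k + 10 ≤ c (k+1)

lemma RIS.comp {w c} (h : RIS w c) {φ : ℕ → ℕ} (hφ : StrictMono φ) :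
    RIS (fun k => w (φ k)) (fun k => c (φ k)) where
  succ := h.succ.comp hφ
  bdd f hf k := h.bdd f hf _
  lo j f hf k := h.lo j f hf _
  hi j f hf k := h.hi j f hf _
  mono := h.mono.comp hφ
  odd k := h.odd _
  sup k n hn := by
    have h1 := h.sup _ n hn
    have h2 : c (φ k + 1) ≤ c (φ (k+1)) := h.mono.monotone (hφ (Nat.lt_succ_self k))
    have h3 := hφ.id_le k
    simp only [id] at h3
    omega

lemma RIS.ck {w c} (h : RIS w c) (k : ℕ) : k < c k := by
  induction k with
  | zero => have := h.odd 0; omega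
  | succ k ih => have := h.mono (Nat.lt_add_one k); omega

lemma quarter_le_half (n : ℕ) : (1/4:ℝ)^n ≤ (1/2)^n := by gcongr; norm_num

lemma nat_mul_quarter {N n : ℕ} (h : N ≤ n) : (N:ℝ) * (1/4)^n ≤ (1/2)^n := by
  have h1 : (N:ℝ) ≤ 2^n := by exact_mod_cast h.trans Nat.lt_two_pow_self.le
  calc (N:ℝ) * (1/4)^n ≤ 2^n * (1/4)^n := by gcongr
    _ = (1/2)^n := by rw [← mul_pow]; norm_num

lemma pr_res_sum (a b : ℕ) (S : Finset ℕ) (g : ℕ → ℕ → ℝ) (x : Vec) :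
    pr (res a b (fun n => ∑ l ∈ S, g l n)) x = ∑ l ∈ S, pr (res a b (g l)) x := by
  rw [← pr_sum]
  apply pr_congr
  intro n _
  simp only [res]
  split_ifs <;> simp

lemma exists_bound (x : Vec) : ∃ B, ∀ n, x n ≠ 0 → n < B := by
  refine ⟨x.support.sup id + 1, fun n hn => ?_⟩
  have : n ≤ x.support.sup id := Finset.le_sup (f := id) (Finsupp.mem_support_iff.2 hn)
  omega

lemma RIS.HP {w c} (h : RIS w c) : HP 8 w where
  pos := by norm_num
  succ := h.succ
  ha j f hf := by
    have base : ∀ k, c k + 1 ≠ j → |pr f (w k)| ≤ 8 / mm j + 8 * (1/2)^k := by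
      intro k hk
      have hm := mm_pos j
      have hp : (0:ℝ) < (1/2)^k := by positivity
      rcases Nat.lt_or_ge (c k) j with h1 | h1
      · have h2 := h.hi j f hf k (by omega)
        have h3 := quarter_le_half (c k)
        have h4 := pow_half_le (h.ck k).le
        have : 0 < 8 / mm j := by positivity
        linarith
      · have h2 := h.lo j f hf k h1
        have : 4 / mm j ≤ 8 / mm j := by gcongr; norm_num
        linarith
    by_cases he : ∃ k0, c k0 + 1 = j
    · obtain ⟨k0, hk0⟩ := he
      refine ⟨k0, fun k hk => base k fun hc => hk (h.mono.injective (by omega))⟩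
    · push Not at he
      exact ⟨0, fun k _ => base k (he k)⟩
  hb p g S a b hS := by
    classical
    set P : ℕ → Prop := fun k => ∃ n, w k n ≠ 0 ∧ S.card ≤ n with hP
    have hzero : ∀ k, ¬ P k → pr (res a b (fun n => ∑ l ∈ S, g l n)) (w k) = 0 := by
      intro k hk
      rw [pr_res_sum]
      refine Finset.sum_eq_zero fun l _ => pr_eq_zero fun n hn => ?_
      by_contra hc
      exact hk ⟨n, hn, hS.hn l n (res_ne hc).2⟩
    have hrhs : ∀ k J, 0 ≤ ∑ l ∈ S.filter (fun l => sg p l < J), |pr (res a b (g l)) (w k)| + 8 / mm J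
        + 8 * (1/2)^k := by
      intro k J
      have := mm_pos J
      positivity
    by_cases hex : ∃ k, P k
    · refine ⟨{Nat.find hex}, by simp, fun k hk J => ?_⟩
      simp only [Finset.mem_singleton] at hk
      by_cases hPk : P k
      · have hlt : Nat.find hex < k := lt_of_le_of_ne (Nat.find_min' hex hPk) (Ne.symm hk)
        obtain ⟨n, hn, hSn⟩ := Nat.find_spec hex
        have hSc : S.card ≤ c k := by
          have h1 := h.sup _ n hn
          have h2 : c (Nat.find hex + 1) ≤ c k := h.mono.monotone hlt
          omega
        rw [pr_res_sum]
        have hm := mm_pos J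
        -- termwise
        have hterm : ∀ l ∈ S, |pr (res a b (g l)) (w k)| ≤
            (if sg p l < J then |pr (res a b (g l)) (w k)| else 0) +
            (if J ≤ sg p l then 4 * (1 / mm (sg p l)) else 0) + (1/4)^(c k) := by
          intro l _
          have hW := W_res (hS.hg l) a b
          have h4 : (0:ℝ) < (1/4)^(c k) := by positivity
          have hm' := mm_pos (sg p l)
          by_cases h1 : sg p l < J
          · rw [if_pos h1, if_neg (by omega)]; linarith
          · rw [if_neg h1, if_pos (by omega)]
            rcases Nat.lt_or_ge (c k) (sg p l) with h2 | h2
            · have h3 := h.hi _ _ hW k (by have := h.odd k; have := sg_odd p l; omega)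
              have : 0 ≤ 4 * (1 / mm (sg p l)) := by positivity
              linarith
            · have h3 := h.lo _ _ hW k h2
              have : 4 / mm (sg p l) = 4 * (1 / mm (sg p l)) := by ring
              linarith
        refine (Finset.abs_sum_le_sum_abs _ _).trans ((Finset.sum_le_sum hterm).trans ?_)
        rw [Finset.sum_add_distrib, Finset.sum_add_distrib, ← Finset.sum_filter,
          ← Finset.sum_filter, ← Finset.mul_sum]
        have h1 := sum_inv_sg p (S.filter fun l => J ≤ sg p l) J
          (fun l hl => (Finset.mem_filter.1 hl).2)
        have h2 : ∑ l ∈ S, (1/4:ℝ)^(c k) ≤ 8 * (1/2)^k := by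
          rw [Finset.sum_const, nsmul_eq_mul]
          have := nat_mul_quarter hSc
          have h4 := pow_half_le (h.ck k).le
          have hp : (0:ℝ) < (1/2)^k := by positivity
          linarith
        have h3 : 4 * (2 / mm J) = 8 / mm J := by ring
        gcongr
        linarith
      · rw [hzero k hPk, abs_zero]; exact hrhs k J
    · push Not at hex
      refine ⟨∅, by simp, fun k _ J => ?_⟩
      rw [hzero k (hex k), abs_zero]; exact hrhs k J
  hc f hf k := (h.bdd f hf k).trans (by norm_num)

/-! ### Exact vectors -/

/-- the estimates of an exact vector -/
structure Exact (γ : ℕ) (v : Vec) : Prop where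
  e1 : ∀ f, Wm f → |pr f v| ≤ 33
  e2 : ∀ j f, W (some j) f → j < γ → |pr f v| ≤ 33 / mm j
  e3 : ∀ j f, W (some j) f → γ < j → |pr f v| ≤ (1/4)^γ

/-- averaging over counted sets -/
lemma sum_split {a : ℕ → ℝ} {n N : ℕ} {θ M : ℝ} (hM : 0 ≤ M) (hθ : 0 ≤ θ) (ha : ∀ k, a k ≤ M)
    (hcard : ((range n).filter fun k => θ < a k).card ≤ N) :
    ∑ k ∈ range n, a k ≤ N * M + n * θ := by
  classical
  rw [← Finset.sum_filter_add_sum_filter_not (range n) fun k => θ < a k]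
  gcongr
  · calc _ ≤ ∑ k ∈ (range n).filter fun k => θ < a k, M := Finset.sum_le_sum fun k _ => ha k
      _ = ((range n).filter fun k => θ < a k).card * M := by simp
      _ ≤ _ := by gcongr
  · calc _ ≤ ∑ k ∈ (range n).filter fun k => ¬ θ < a k, θ :=
          Finset.sum_le_sum fun k hk => not_lt.1 (Finset.mem_filter.1 hk).2
      _ = ((range n).filter fun k => ¬ θ < a k).card * θ := by simp
      _ ≤ n * θ := by
          gcongr
          exact (Finset.card_filter_le _ _).trans (by simp)

/-- exact vectors -/
def exv (γ : ℕ) (w : ℕ → Vec) : Vec := (mm γ / nn γ) • ∑ k ∈ range (nn γ), w k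

lemma pr_exv (f : ℕ → ℝ) (γ : ℕ) (w : ℕ → Vec) :
    pr f (exv γ w) = mm γ / nn γ * ∑ k ∈ range (nn γ), pr f (w k) := by
  simp [exv, map_sum]

lemma abs_pr_exv (f : ℕ → ℝ) (γ : ℕ) (w : ℕ → Vec) :
    |pr f (exv γ w)| ≤ mm γ / nn γ * ∑ k ∈ range (nn γ), |pr f (w k)| := by
  have h1 := mm_pos γ
  have h2 := nn_pos γ
  rw [pr_exv, abs_mul, abs_of_pos (div_pos h1 h2)]
  gcongr
  exact Finset.abs_sum_le_sum_abs _ _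

lemma exv_exact {γ : ℕ} {w c} (h : RIS w c) (hγ : γ < c 0) : Exact γ (exv γ w) := by
  have hm := mm_pos γ
  have hn := nn_pos γ
  have he := ex_ge γ
  obtain ⟨q1, q2, q3, q4⟩ := QQ_facts γ
  set i := ex γ - 2 with hi
  set N := Nrec γ (npv γ) i with hN
  have hmi : mm γ = 2^(i+2) := by unfold mm; congr 1
  have q2' : 4 * mm γ * 4 ^ γ ≤ nn γ := by unfold mm; exact_mod_cast q2
  have q3' : mm γ * N ≤ nn γ := by unfold mm; exact_mod_cast q3
  have q4' : mm γ * (4 * (npv γ * (N + 1))) ≤ nn γ := by unfold mm; exact_mod_cast q4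
  have hcnt : ∀ f, Wm f → ∀ A : Finset ℕ, (∀ k ∈ A, 8 * (1/2)^i < |pr f (w k)|) → A.card ≤ N :=
    counting h.HP (fun j hj => nn_le_npv hj) i hmi.ge
  have hmt : mm γ * (8 * (1/2)^i) = 32 := by
    rw [hmi, pow_add]
    have : (2:ℝ)^i * (1/2)^i = 1 := by rw [← mul_pow]; norm_num
    linear_combination 32 * this
  refine ⟨fun f hf => ?_, fun j f hf hj => ?_, fun j f hf hj => ?_⟩
  · refine (abs_pr_exv f γ w).trans ?_
    have h1 := sum_split (a := fun k => |pr f (w k)|) (n := nn γ) (N := N) (θ := 8 * (1/2)^i) (M := 1)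
      zero_le_one (by positivity) (h.bdd f hf)
      (hcnt f hf _ fun k hk => (Finset.mem_filter.1 hk).2)
    calc _ ≤ mm γ / nn γ * (N * 1 + nn γ * (8 * (1/2)^i)) := by gcongr
      _ = (mm γ * N) / nn γ + mm γ * (8 * (1/2)^i) := by field_simp
      _ ≤ 1 + 32 := by
          rw [hmt]; gcongr; rwa [div_le_one hn]
      _ = 33 := by norm_num
  · refine (abs_pr_exv f γ w).trans ?_
    have hmj := mm_pos j
    have h1 := sum_split (a := fun k => |pr f (w k)|) (n := nn γ) (N := npv γ * (N+1))
      (θ := 2 / mm j * (8 * (1/2)^i / 2)) (M := 4 / mm j)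
      (by positivity) (by positivity)
      (fun k => h.lo j f hf k (by have := h.mono.monotone (Nat.zero_le k); omega))
      ((count_weight hf h.succ (θ := 8 * (1/2)^i / 2) (by positivity) (N := N)
        (fun f' hf' A' hA' => hcnt f' hf' A' fun k hk => by
          have := hA' k hk; linarith) _
        fun k hk => (Finset.mem_filter.1 hk).2).trans (Nat.mul_le_mul_right _ (nn_le_npv hj)))
    push_cast at h1
    calc _ ≤ mm γ / nn γ * ((npv γ * (N+1)) * (4 / mm j) + nn γ * (2 / mm j * (8 * (1/2)^i / 2))) := by
          gcongr
      _ = ((mm γ * (4 * (npv γ * (N + 1)))) / nn γ + mm γ * (8 * (1/2)^i)) / mm j := by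
          field_simp
      _ ≤ (1 + 32) / mm j := by
          rw [hmt]; gcongr; rwa [div_le_one hn]
      _ = _ := by norm_num
  · refine (abs_pr_exv f γ w).trans ?_
    have hmj : mm (γ+1) ≤ mm j := mm_mono hj
    have hmj0 := mm_pos j
    have hb : ∀ k, |pr f (w k)| ≤ (if c k + 1 = j then 1 else 0) + (4 / mm j + (1/2)^(k+1)) := by
      intro k
      have hk : k + 1 ≤ c k := h.ck k
      have h4 : 0 < 4 / mm j := by positivity
      have hp : (0:ℝ) < (1/2)^(k+1) := by positivity
      split_ifs with h1
      · have := h.bdd f hf.mem k; linarith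
      · rcases Nat.lt_or_ge (c k) j with h2 | h2
        · have h3 := h.hi j f hf k (by omega)
          have := quarter_le_half (c k)
          have := pow_half_le hk
          linarith
        · have h3 := h.lo j f hf k h2
          linarith
    have hs1 : ∑ k ∈ range (nn γ), (if c k + 1 = j then (1:ℝ) else 0) ≤ 1 := by
      rw [Finset.sum_boole]
      have : ((range (nn γ)).filter fun k => c k + 1 = j).card ≤ 1 := by
        refine Finset.card_le_one.2 fun a ha b hb => ?_
        have h1 := (Finset.mem_filter.1 ha).2
        have h2 := (Finset.mem_filter.1 hb).2
        exact h.mono.injective (by omega)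
      exact_mod_cast this
    have hs2 : ∑ k ∈ range (nn γ), (1/2:ℝ)^(k+1) ≤ 1 := by
      have := sum_half (range (nn γ))
      simp only [pow_succ, ← Finset.sum_mul]
      linarith
    have hs : ∑ k ∈ range (nn γ), |pr f (w k)| ≤ 2 + nn γ * (4 / mm j) := by
      calc _ ≤ ∑ k ∈ range (nn γ), ((if c k + 1 = j then (1:ℝ) else 0) + (4 / mm j + (1/2)^(k+1))) :=
            Finset.sum_le_sum fun k _ => hb k
        _ = ∑ k ∈ range (nn γ), (if c k + 1 = j then (1:ℝ) else 0) + (nn γ * (4 / mm j)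
              + ∑ k ∈ range (nn γ), (1/2:ℝ)^(k+1)) := by
            rw [Finset.sum_add_distrib, Finset.sum_add_distrib]; simp
        _ ≤ _ := by linarith
    have hq : (0:ℝ) < 4^γ := by positivity
    have e1 : mm γ / nn γ * 2 ≤ (1/2) * (1/4)^γ := by
      rw [one_div_pow, div_mul_eq_mul_div, div_le_iff₀ hn]
      rw [show (1/2 * (1 / 4^γ)) * (nn γ : ℝ) = nn γ / (2 * 4^γ) by field_simp]
      rw [le_div_iff₀ (by positivity)]
      linarith
    have e2 : mm γ * (4 / mm j) ≤ (1/2) * (1/4)^γ := by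
      calc mm γ * (4 / mm j) ≤ mm γ * (4 / mm (γ+1)) := by
            have := mm_pos (γ+1)
            gcongr
        _ = (1/32) * (1/4)^γ := by
            rw [mm_succ, one_div_pow]; field_simp; norm_num
        _ ≤ _ := by gcongr; norm_num
    calc _ ≤ mm γ / nn γ * (2 + nn γ * (4 / mm j)) := by gcongr
      _ = mm γ / nn γ * 2 + mm γ * (4 / mm j) := by field_simp
      _ ≤ (1/2) * (1/4)^γ + (1/2) * (1/4)^γ := by linarith
      _ = _ := by ring

end
end TS


namespace TS
noncomputable section

open Finset

/-- special sequences -/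
structure SSeq (v : ℕ → Vec) (p : ℕ → Code) (A B : ℕ → ℕ) : Prop where
  exact : ∀ i, Exact (sg p i) (v i)
  supp : ∀ i n, v i n ≠ 0 → A i ≤ n ∧ n < B i
  hAB : ∀ i, A i ≤ B i
  hBA : ∀ i, B i ≤ A (i+1)
  gr : ∀ i, B i + i + 1 ≤ sg p (i+1)
  ap : ∀ i, l1 (v i - castV (p i).1) ≤ (1/2)^(i+1)

namespace SSeq

variable {v : ℕ → Vec} {p : ℕ → Code} {A B : ℕ → ℕ}

lemma B_mono (h : SSeq v p A B) : Monotone B :=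
  monotone_nat_of_le_succ fun n => (h.hBA n).trans (h.hAB (n+1))

lemma A_mono (h : SSeq v p A B) : Monotone A :=
  monotone_nat_of_le_succ fun n => (h.hAB n).trans (h.hBA n)

lemma BA (h : SSeq v p A B) {i i' : ℕ} (hi : i < i') : B i ≤ A i' :=
  (h.hBA i).trans (h.A_mono hi)

lemma sg_ge (h : SSeq v p A B) (i : ℕ) : i ≤ sg p i := by
  cases i with
  | zero => simp
  | succ i => have := h.gr i; omega

lemma sg_gt (h : SSeq v p A B) {i i' : ℕ} (hi : i < i') : B i < sg p i' := by
  obtain ⟨k, rfl⟩ : ∃ k, i' = k + 1 := ⟨i' - 1, by omega⟩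
  have := h.gr k
  have : B i ≤ B k := h.B_mono (by omega)
  omega

lemma nonmatch (h : SSeq v p A B) {i j : ℕ} {f : ℕ → ℝ} (hf : W (some j) f) (hj : j ≠ sg p i) :
    |pr f (v i)| ≤ 33 / mm j + (1/4)^(sg p i) := by
  have hm := mm_pos j
  have h1 : 0 < 33 / mm j := by positivity
  have h2 : (0:ℝ) < (1/4)^(sg p i) := by positivity
  rcases lt_or_gt_of_ne hj with h3 | h3
  · have := (h.exact i).e2 j f hf h3; linarith
  · have := (h.exact i).e3 j f hf h3; linarith

lemma quarter_sg (h : SSeq v p A B) {t i : ℕ} (hi : t ≤ i) : (1/4:ℝ)^(sg p i) ≤ (1/2)^t :=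
  (quarter_le_half _).trans (pow_half_le (hi.trans (h.sg_ge i)))

end SSeq

lemma at_most_one (Q : ℕ → Prop) (h : ∀ t t', t < t' → Q t → Q t' → False) :
    ∃ E : Finset ℕ, E.card ≤ 1 ∧ ∀ t, Q t → t ∈ E := by
  by_cases hex : ∃ t, Q t
  · obtain ⟨t, ht⟩ := hex
    refine ⟨{t}, by simp, fun t' ht' => ?_⟩
    rcases lt_trichotomy t t' with h1 | h1 | h1
    · exact (h t t' h1 ht ht').elim
    · simp [h1]
    · exact (h t' t h1 ht' ht).elim
  · push Not at hex
    exact ⟨∅, by simp, fun t ht => (hex t ht).elim⟩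

/-- differences -/
def dif (v : ℕ → Vec) (t : ℕ) : Vec := v (2*t) - v (2*t+1)

lemma pr_dif (f : ℕ → ℝ) (v : ℕ → Vec) (t : ℕ) :
    pr f (dif v t) = pr f (v (2*t)) - pr f (v (2*t+1)) := by simp [dif]

lemma dif_ne {v : ℕ → Vec} {t n : ℕ} (h : dif v t n ≠ 0) : v (2*t) n ≠ 0 ∨ v (2*t+1) n ≠ 0 := by
  by_contra hc
  push Not at hc
  exact h (by simp [dif, hc.1, hc.2])

namespace SSeq

variable {v : ℕ → Vec} {p : ℕ → Code} {A B : ℕ → ℕ}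

lemma dif_supp (h : SSeq v p A B) {t n : ℕ} (hn : dif v t n ≠ 0) :
    A (2*t) ≤ n ∧ n < B (2*t+1) := by
  rcases dif_ne hn with h1 | h1
  · have := h.supp _ _ h1
    exact ⟨this.1, this.2.trans_le (h.B_mono (by omega))⟩
  · have := h.supp _ _ h1
    exact ⟨(h.A_mono (by omega)).trans this.1, this.2⟩

lemma nonmatch_dif (h : SSeq v p A B) {t j : ℕ} {f : ℕ → ℝ} (hf : W (some j) f)
    (h1 : j ≠ sg p (2*t)) (h2 : j ≠ sg p (2*t+1)) :
    |pr f (dif v t)| ≤ 66 * (1 / mm j) + ((1/4)^(sg p (2*t)) + (1/4)^(sg p (2*t+1))) := by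
  rw [pr_dif]
  have e1 := h.nonmatch hf h1
  have e2 := h.nonmatch hf h2
  have e3 := abs_sub (pr f (v (2*t))) (pr f (v (2*t+1)))
  have e4 : 33 / mm j = 33 * (1 / mm j) := by ring
  linarith

theorem mainB (h : SSeq v p A B) : HP 256 (dif v) where
  pos := by norm_num
  succ := by
    intro r r' hr n n' hn hn'
    have h1 := h.dif_supp hn
    have h2 := h.dif_supp hn'
    have := h.BA (i := 2*r+1) (i' := 2*r') (by omega)
    omega
  ha j f hf := by
    have base : ∀ t, j ≠ sg p (2*t) → j ≠ sg p (2*t+1) →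
        |pr f (dif v t)| ≤ 256 / mm j + 256 * (1/2)^t := by
      intro t h1 h2
      have e := h.nonmatch_dif hf h1 h2
      have e1 := h.quarter_sg (t := t) (i := 2*t) (by omega)
      have e2 := h.quarter_sg (t := t) (i := 2*t+1) (by omega)
      have hm := mm_pos j
      have e3 : 256 / mm j = 256 * (1 / mm j) := by ring
      have e4 : 0 < 1 / mm j := by positivity
      have e5 : (0:ℝ) < (1/2)^t := by positivity
      linarith
    by_cases he : ∃ t0, j = sg p (2*t0) ∨ j = sg p (2*t0+1)
    · obtain ⟨t0, ht0⟩ := he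
      refine ⟨t0, fun t ht => base t (fun h1 => ht ?_) (fun h1 => ht ?_)⟩
      · rcases ht0 with h2 | h2
        · have := sg_inj_self (h1.symm.trans h2); omega
        · have := sg_inj_self (h1.symm.trans h2); omega
      · rcases ht0 with h2 | h2
        · have := sg_inj_self (h1.symm.trans h2); omega
        · have := sg_inj_self (h1.symm.trans h2); omega
    · push Not at he
      exact ⟨0, fun t _ => base t (he t).1 (he t).2⟩
  hb q g S a b hS := by
    classical
    set P : ℕ → Prop := fun t => ∃ n, dif v t n ≠ 0 ∧ S.card ≤ n with hP
    have hzero : ∀ k, ¬ P k → pr (res a b (fun n => ∑ l ∈ S, g l n)) (dif v k) = 0 := by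
      intro k hk
      rw [pr_res_sum]
      refine Finset.sum_eq_zero fun l _ => pr_eq_zero fun n hn => ?_
      by_contra hc
      exact hk ⟨n, hn, hS.hn l n (res_ne hc).2⟩
    set ag : ℕ → Prop := fun i => ∀ k < i, q k = p k with hag
    set gs : ℕ → ℕ → Prop := fun t n => g (2*t) n ≠ 0 ∨ g (2*t+1) n ≠ 0 with hgs
    have gss : ∀ t t', t < t' → ∀ n n', gs t n → gs t' n' → n < n' := by
      intro t t' htt n n' h1 h2
      rcases h1 with h1 | h1 <;> rcases h2 with h2 | h2 <;>
        exact hS.hs _ _ (by omega) _ _ h1 h2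
    obtain ⟨E1, hE1, hE1'⟩ := at_most_one (fun t => P t ∧ ∀ t' < t, ¬ P t')
      (fun t t' htt h1 h2 => h2.2 t htt h1.1)
    obtain ⟨E2, hE2, hE2'⟩ := at_most_one (fun t => ag (2*t) ∧ ¬ ag (2*t+2))
      (fun t t' htt h1 h2 => h1.2 fun k hk => h2.1 k (by omega))
    have cutuniq : ∀ c : ℕ, ∀ t t', t < t' → (∃ n n', n < c ∧ c ≤ n' ∧ gs t n ∧ gs t n') →
        (∃ n n', n < c ∧ c ≤ n' ∧ gs t' n ∧ gs t' n') → False := by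
      rintro c t t' htt ⟨n1, n2, h1, h2, h3, h4⟩ ⟨n1', n2', h1', h2', h3', h4'⟩
      have := gss t t' htt n2 n1' h4 h3'
      omega
    obtain ⟨E3, hE3, hE3'⟩ := at_most_one (fun t => ∃ n n', n < a ∧ a ≤ n' ∧ gs t n ∧ gs t n')
      (cutuniq a)
    obtain ⟨E4, hE4, hE4'⟩ := at_most_one (fun t => ∃ n n', n < b ∧ b ≤ n' ∧ gs t n ∧ gs t n')
      (cutuniq b)
    refine ⟨E1 ∪ (E2 ∪ (E3 ∪ E4)), ?_, fun t ht J => ?_⟩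
    · have h1 := Finset.card_union_le E1 (E2 ∪ (E3 ∪ E4))
      have h2 := Finset.card_union_le E2 (E3 ∪ E4)
      have h3 := Finset.card_union_le E3 E4
      omega
    simp only [Finset.mem_union, not_or] at ht
    obtain ⟨ht1, ht2, ht3, ht4⟩ := ht
    have ht1 := fun hh => ht1 (hE1' t hh)
    have ht2 := fun hh => ht2 (hE2' t hh)
    have ht3 := fun hh => ht3 (hE3' t hh)
    have ht4 := fun hh => ht4 (hE4' t hh)
    have hmJ := mm_pos J
    have hp : (0:ℝ) < (1/2)^t := by positivity
    by_cases hPt : P t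
    swap
    · rw [hzero t hPt, abs_zero]; positivity
    obtain ⟨t', htt', hPt'⟩ : ∃ t' < t, P t' := by
      by_contra hc; push Not at hc; exact ht1 ⟨hPt, hc⟩
    obtain ⟨n, hn, hSn⟩ := hPt'
    have hScard : S.card ≤ B (2*t'+1) := hSn.trans (h.dif_supp hn).2.le
    have hS1 : S.card ≤ sg p (2*t) := hScard.trans (h.sg_gt (by omega)).le
    have hS2 : S.card ≤ sg p (2*t+1) := hScard.trans (h.sg_gt (by omega)).le
    -- sums over non matching indices
    have nm : ∀ S' ⊆ S, (∀ l ∈ S', sg q l ≠ sg p (2*t) ∧ sg q l ≠ sg p (2*t+1)) →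
        ∑ l ∈ S', |pr (res a b (g l)) (dif v t)| ≤
          ∑ l ∈ S.filter (fun l => sg q l < J), |pr (res a b (g l)) (dif v t)| + 132 / mm J +
            2 * (1/2)^t := by
      intro S' hS' hnm
      have hterm : ∀ l ∈ S', |pr (res a b (g l)) (dif v t)| ≤
          (if sg q l < J then |pr (res a b (g l)) (dif v t)| else 0) +
          (if J ≤ sg q l then 66 * (1 / mm (sg q l)) else 0) +
          ((1/4)^(sg p (2*t)) + (1/4)^(sg p (2*t+1))) := by
        intro l hl
        have hW := W_res (hS.hg l) a b
        have e4 : (0:ℝ) < (1/4)^(sg p (2*t)) := by positivity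
        have e5 : (0:ℝ) < (1/4)^(sg p (2*t+1)) := by positivity
        by_cases h1 : sg q l < J
        · rw [if_pos h1, if_neg (by omega)]; linarith
        · rw [if_neg h1, if_pos (by omega)]
          have := h.nonmatch_dif hW (hnm l hl).1 (hnm l hl).2
          linarith
      refine (Finset.sum_le_sum hterm).trans ?_
      rw [Finset.sum_add_distrib, Finset.sum_add_distrib, ← Finset.sum_filter,
        ← Finset.sum_filter, ← Finset.mul_sum]
      have e1 := sum_inv_sg q (S'.filter fun l => J ≤ sg q l) J
        (fun l hl => (Finset.mem_filter.1 hl).2)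
      have e2 : ∑ l ∈ S', ((1/4:ℝ)^(sg p (2*t)) + (1/4)^(sg p (2*t+1))) ≤ 2 * (1/2)^t := by
        rw [Finset.sum_const, nsmul_eq_mul, mul_add]
        have c1 := nat_mul_quarter ((Finset.card_le_card hS').trans hS1)
        have c2 := nat_mul_quarter ((Finset.card_le_card hS').trans hS2)
        have c3 := pow_half_le (show t ≤ sg p (2*t) by have := h.sg_ge (2*t); omega)
        have c4 := pow_half_le (show t ≤ sg p (2*t+1) by have := h.sg_ge (2*t+1); omega)
        linarith
      have e3 : ∑ l ∈ S'.filter (fun l => sg q l < J), |pr (res a b (g l)) (dif v t)| ≤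
          ∑ l ∈ S.filter (fun l => sg q l < J), |pr (res a b (g l)) (dif v t)| :=
        Finset.sum_le_sum_of_subset_of_nonneg (Finset.filter_subset_filter _ hS')
          fun _ _ _ => abs_nonneg _
      have e4 : 66 * (2 / mm J) = 132 / mm J := by ring
      linarith
    have hfin : 132 / mm J ≤ 256 / mm J := by gcongr; norm_num
    rw [pr_res_sum]
    by_cases hagt : ag (2*t)
    swap
    · -- no matching at all
      refine (Finset.abs_sum_le_sum_abs _ _).trans ((nm S (Finset.Subset.refl _) ?_).trans ?_)
      · intro l _
        refine ⟨fun hh => hagt (sg_inj hh).2, fun hh => hagt fun k hk => (sg_inj hh).2 k (by omega)⟩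
      · linarith
    · have hag2 : ag (2*t+2) := by
        by_contra hc; exact ht2 ⟨hagt, hc⟩
      rw [← Finset.sum_filter_add_sum_filter_not S fun l => l ≠ 2*t ∧ l ≠ 2*t+1]
      have e1 : |∑ l ∈ S.filter (fun l => l ≠ 2*t ∧ l ≠ 2*t+1), pr (res a b (g l)) (dif v t)| ≤
          ∑ l ∈ S.filter (fun l => sg q l < J), |pr (res a b (g l)) (dif v t)| + 132 / mm J +
            2 * (1/2)^t := by
        refine (Finset.abs_sum_le_sum_abs _ _).trans (nm _ (Finset.filter_subset _ _) ?_)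
        intro l hl
        have := (Finset.mem_filter.1 hl).2
        exact ⟨fun hh => this.1 (sg_inj hh).1, fun hh => this.2 (sg_inj hh).1⟩
      have e2 : ∑ l ∈ S.filter (fun l => ¬ (l ≠ 2*t ∧ l ≠ 2*t+1)), pr (res a b (g l)) (dif v t) =
          pr (res a b (g (2*t))) (dif v t) + pr (res a b (g (2*t+1))) (dif v t) := by
        rw [← Finset.sum_pair (f := fun l => pr (res a b (g l)) (dif v t))
          (show 2*t ≠ 2*t+1 by omega)]
        refine Finset.sum_subset ?_ ?_
        · intro l hl
          have := (Finset.mem_filter.1 hl).2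
          simp only [Finset.mem_insert, Finset.mem_singleton]
          omega
        · intro l hl hl2
          have : l ∉ S := by
            intro hlS
            apply hl2
            simp only [Finset.mem_insert, Finset.mem_singleton] at hl
            refine Finset.mem_filter.2 ⟨hlS, by omega⟩
          refine pr_eq_zero fun n _ => ?_
          simp [res, hS.h0 l this]
      -- not cut
      have hcut : (∀ l, l = 2*t ∨ l = 2*t+1 → res a b (g l) = g l) ∨
          (∀ l, l = 2*t ∨ l = 2*t+1 → res a b (g l) = 0) := by
        have toGs : ∀ l n, l = 2*t ∨ l = 2*t+1 → g l n ≠ 0 → gs t n := by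
          rintro l n (rfl | rfl) hh
          · exact Or.inl hh
          · exact Or.inr hh
        by_cases hin : ∃ n0, gs t n0 ∧ a ≤ n0 ∧ n0 < b
        · obtain ⟨n0, hn0, ha0, hb0⟩ := hin
          left
          intro l hl
          ext n
          unfold res
          split_ifs with hc
          · rfl
          · by_contra hne
            have hg := toGs l n hl (Ne.symm hne)
            rcases Nat.lt_or_ge n a with h1 | h1
            · exact ht3 ⟨n, n0, h1, ha0, hg, hn0⟩
            · exact ht4 ⟨n0, n, hb0, by omega, hn0, hg⟩
        · right
          intro l hl
          ext n
          by_contra hne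
          have := res_ne hne
          exact hin ⟨n, toGs l n hl this.2, this.1⟩
      have e3 : |pr (res a b (g (2*t))) (dif v t) + pr (res a b (g (2*t+1))) (dif v t)| ≤
          72 * (1/2)^t := by
        rcases hcut with hc | hc
        swap
        · rw [hc _ (Or.inl rfl), hc _ (Or.inr rfl)]
          rw [show pr 0 (dif v t) = 0 from pr_eq_zero (fun _ _ => rfl)]
          rw [add_zero, abs_zero]; positivity
        rw [hc _ (Or.inl rfl), hc _ (Or.inr rfl), pr_dif, pr_dif]
        have w1 : sg q (2*t) = sg p (2*t) := sg_congr fun k hk => hag2 k (by omega)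
        have w2 : sg q (2*t+1) = sg p (2*t+1) := sg_congr fun k hk => hag2 k (by omega)
        have hg1 := hS.hg (2*t)
        have hg2 := hS.hg (2*t+1)
        have hcc := hS.hc t
        rw [hag2 (2*t) (by omega), hag2 (2*t+1) (by omega)] at hcc
        rw [w1] at hg1
        rw [w2] at hg2
        have hne : sg p (2*t) ≠ sg p (2*t+1) := fun hh => by
          have := sg_inj_self hh; omega
        have c1 := h.nonmatch (i := 2*t+1) hg1 hne
        have c2 := h.nonmatch (i := 2*t) hg2 hne.symm
        have big : ∀ i, t ≤ i → 33 / mm (sg p i) ≤ 33 * (1/2)^t := by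
          intro i hi
          have : (2:ℝ)^t ≤ mm (sg p i) := le_trans
            (pow_le_pow_right₀ (by norm_num) (hi.trans (h.sg_ge i))) (mm_ge_pow' _)
          rw [one_div, inv_pow, ← div_eq_mul_inv]
          gcongr
        have c3 := big (2*t) (by omega)
        have c4 := big (2*t+1) (by omega)
        have c5 := h.quarter_sg (t := t) (i := 2*t) (by omega)
        have c6 := h.quarter_sg (t := t) (i := 2*t+1) (by omega)
        have l1' := (Wm_l1 hg1.mem (v (2*t) - castV (p (2*t)).1)).trans (h.ap (2*t))
        have l2' := (Wm_l1 hg2.mem (v (2*t+1) - castV (p (2*t+1)).1)).trans (h.ap (2*t+1))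
        rw [map_sub] at l1' l2'
        have c7 := pow_half_le (show t ≤ 2*t+1 by omega)
        have c8 := pow_half_le (show t ≤ 2*t+1+1 by omega)
        rw [abs_le] at *
        constructor <;> linarith [c1.1, c1.2, c2.1, c2.2, l1'.1, l1'.2, l2'.1, l2'.2, hcc.1, hcc.2]
      rw [e2]
      refine (abs_add_le _ _).trans ?_
      linarith
  hc f hf t := by
    rw [pr_dif]
    have e1 := (h.exact (2*t)).e1 f hf
    have e2 := (h.exact (2*t+1)).e1 f hf
    have e3 := abs_sub (pr f (v (2*t))) (pr f (v (2*t+1)))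
    linarith

end SSeq

end
end TS


namespace TS
noncomputable section

open Finset

lemma SpecData.sumW {p g S} (h : SpecData p g S) : Wm (fun n => ∑ l ∈ S, g l n) := by
  choose R hR using fun l => (W_bound (h.hg l)).2.2
  have := h.toW 0 (∑ l ∈ S, R l)
  convert this.mem using 1
  ext n
  unfold res
  split_ifs with hc
  · rfl
  · refine Finset.sum_eq_zero fun l hl => ?_
    by_contra hne
    have h1 := hR l n hne
    have h2 := Finset.single_le_sum (f := R) (fun _ _ => Nat.zero_le _) hl
    omega

namespace SSeq

variable {v : ℕ → Vec} {p : ℕ → Code} {A B : ℕ → ℕ}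

lemma specmk (h : SSeq v p A B) {g : ℕ → ℕ → ℝ} {S : Finset ℕ}
    (hg : ∀ l, W (some (sg p l)) (g l)) (hsup : ∀ l n, g l n ≠ 0 → A l ≤ n ∧ n < B l)
    (h0 : ∀ l, l ∉ S → g l = 0) (hS : ∀ l ∈ S, S.card ≤ A l)
    (hc : ∀ t, pr (g (2*t)) (v (2*t)) = pr (g (2*t+1)) (v (2*t+1))) : SpecData p g S where
  hg := hg
  hs r r' hr n n' hn hn' := by
    have h1 := hsup _ _ hn
    have h2 := hsup _ _ hn'
    have := h.BA hr
    omega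
  h0 := h0
  hn l n hn := by
    have hl : l ∈ S := by
      by_contra hc; rw [h0 l hc] at hn; exact hn rfl
    exact (hS l hl).trans (hsup l n hn).1
  hc t := by
    have l1' := (Wm_l1 (hg (2*t)).mem (v (2*t) - castV (p (2*t)).1)).trans (h.ap (2*t))
    have l2' := (Wm_l1 (hg (2*t+1)).mem (v (2*t+1) - castV (p (2*t+1)).1)).trans (h.ap (2*t+1))
    rw [map_sub] at l1' l2'
    have e := hc t
    have c7 := pow_half_le (show t+1 ≤ 2*t+1 by omega)
    have c8 := pow_half_le (show t+1 ≤ 2*t+1+1 by omega)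
    have c9 : (1/2:ℝ)^(t+1) = (1/2)^t * (1/2) := pow_succ _ _
    rw [abs_le] at *
    constructor <;> linarith [l1'.1, l1'.2, l2'.1, l2'.2]

lemma lower (h : SSeq v p A B) {f : ℕ → ℕ → ℝ} (hf : ∀ l, W (some (sg p l)) (f l))
    (hsup : ∀ l n, f l n ≠ 0 → A l ≤ n ∧ n < B l) (hfv : ∀ l, pr (f l) (v l) = 1/2)
    (o : ℕ) (ho : o < 2) (T F : Finset ℕ) (hFT : F ⊆ T) (hF : ∀ t ∈ F, 2 * F.card ≤ A (2*t))
    (a : ℕ → ℝ) (M : ℝ) (hM : ∀ k, Wm k → |pr k (∑ t ∈ T, a t • v (2*t+o))| ≤ M) :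
    ∑ t ∈ F, |a t| ≤ 2 * M := by
  classical
  set ε : ℕ → ℝ := fun t => if 0 ≤ a t then 1 else -1 with hε
  have hε1 : ∀ t, |ε t| ≤ 1 := by intro t; simp only [hε]; split_ifs <;> simp
  have hεa : ∀ t, ε t * a t = |a t| := by
    intro t; simp only [hε]; split_ifs with h1
    · rw [abs_of_nonneg h1, one_mul]
    · rw [abs_of_neg (not_le.1 h1)]; ring
  set g : ℕ → ℕ → ℝ := fun l n => (if l / 2 ∈ F then ε (l/2) else 0) * f l n with hgdef
  set S : Finset ℕ := F.biUnion fun t => {2*t, 2*t+1} with hSdef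
  have hSmem : ∀ l, l ∈ S ↔ l / 2 ∈ F := by
    intro l
    simp only [hSdef, Finset.mem_biUnion, Finset.mem_insert, Finset.mem_singleton]
    constructor
    · rintro ⟨t, ht, hl⟩
      have : l / 2 = t := by omega
      rwa [this]
    · intro hl
      exact ⟨l/2, hl, by omega⟩
  have hScard : S.card ≤ 2 * F.card := by
    rw [mul_comm]
    exact Finset.card_biUnion_le_card_mul _ _ _ fun t _ => Finset.card_le_two
  have d0 : ∀ t, (2*t) / 2 = t := by intro t; omega
  have d1 : ∀ t, (2*t+1) / 2 = t := by intro t; omega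
  have hgW : ∀ l, W (some (sg p l)) (g l) := by
    intro l
    refine W_smul (hf l) _ ?_
    split_ifs
    · exact hε1 _
    · simp
  have hSD : SpecData p g S := by
    refine h.specmk hgW ?_ ?_ ?_ ?_
    · intro l n hn
      exact hsup l n (right_ne_zero_of_mul hn)
    · intro l hl
      ext n
      simp only [hgdef, if_neg (fun hh => hl ((hSmem l).2 hh)), zero_mul, Pi.zero_apply]
    · intro l hl
      have h1 := (hSmem l).1 hl
      have h2 := hF _ h1
      have h3 : A (2*(l/2)) ≤ A l := h.A_mono (by omega)
      omega
    · intro t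
      simp only [hgdef, d0, d1]
      rw [pr_smul, pr_smul, hfv, hfv]
  have hval := hM _ hSD.sumW
  rw [pr_sum] at hval
  have key : ∀ l, pr (g l) (∑ t ∈ T, a t • v (2*t+o)) =
      if l / 2 ∈ F ∧ l % 2 = o then |a (l/2)| / 2 else 0 := by
    intro l
    have hoff : ∀ t, 2*t+o ≠ l → pr (g l) (v (2*t+o)) = 0 := by
      intro t hne
      refine pr_eq_zero fun n hn => ?_
      by_contra hc
      have h1 := hsup l n (right_ne_zero_of_mul hc)
      have h2 := h.supp _ _ hn
      rcases lt_or_gt_of_ne hne with h3 | h3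
      · have := h.BA h3; omega
      · have := h.BA h3; omega
    rw [map_sum]
    simp only [map_smul, smul_eq_mul]
    split_ifs with hl
    · rw [Finset.sum_eq_single_of_mem (l/2) (hFT hl.1)]
      · have : 2 * (l/2) + o = l := by omega
        rw [this]
        simp only [hgdef]
        rw [pr_smul, if_pos hl.1, hfv, ← hεa]; ring
      · intro t _ hne
        rw [hoff t (by omega), mul_zero]
    · refine Finset.sum_eq_zero fun t _ => ?_
      by_cases hne : 2*t+o = l
      · have : l / 2 ∉ F := fun hh => hl ⟨hh, by omega⟩
        have h0 : g l = 0 := by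
          ext n; simp only [hgdef, if_neg this, zero_mul, Pi.zero_apply]
        rw [h0, show pr 0 (v (2*t+o)) = 0 from pr_eq_zero (fun _ _ => rfl), mul_zero]
      · rw [hoff t hne, mul_zero]
  simp only [key] at hval
  have hsum : ∑ l ∈ S, (if l / 2 ∈ F ∧ l % 2 = o then |a (l/2)| / 2 else 0) = ∑ t ∈ F, |a t| / 2 := by
    rw [← Finset.sum_filter]
    symm
    refine Finset.sum_bij' (fun t _ => 2*t+o) (fun l _ => l/2) ?_ ?_ ?_ ?_ ?_
    · intro t ht
      rw [Finset.mem_filter, hSmem]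
      have : (2*t+o)/2 = t := by omega
      rw [this]
      exact ⟨ht, ht, by omega⟩
    · intro l hl
      exact (Finset.mem_filter.1 hl).2.1
    · intro t _; show (2*t+o)/2 = t; omega
    · intro l hl
      have := (Finset.mem_filter.1 hl).2.2
      show 2*(l/2)+o = l
      omega
    · intro t _
      have : (2*t+o)/2 = t := by omega
      rw [this]
  rw [hsum, ← Finset.sum_div] at hval
  have := (le_abs_self _).trans hval
  linarith

end SSeq

/-- summation lemma -/
lemma tsum_lemma {d : ℕ → Vec} (H : HP 256 d) (T : Finset ℕ) (a : ℕ → ℝ) (M : ℝ) (hM0 : 0 ≤ M)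
    (hM : ∀ F ⊆ T, (∀ t ∈ F, F.card ≤ NN (t+8) + 1) → ∑ t ∈ F, |a t| ≤ 2 * M)
    {f : ℕ → ℝ} (hf : Wm f) : |pr f (∑ t ∈ T, a t • d t)| ≤ 2052 * M := by
  classical
  set β : ℕ → ℝ := fun t => |pr f (d t)| with hβ
  have hβ0 : ∀ t, 0 ≤ β t := fun t => abs_nonneg _
  obtain ⟨K, hK⟩ : ∃ K, ∀ t ∈ T, t + 9 ≤ K := by
    refine ⟨T.sup id + 9, fun t ht => ?_⟩
    have : t ≤ T.sup id := Finset.le_sup (f := id) ht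
    omega
  have pt : ∀ t ∈ T, β t ≤ (1/2)^t + ∑ s ∈ range K,
      if s ≤ t + 8 ∧ 256 * (1/2)^s < β t then 512 * (1/2:ℝ)^s else 0 := by
    intro t ht
    have hnn : 0 ≤ ∑ s ∈ range K,
        if s ≤ t + 8 ∧ 256 * (1/2)^s < β t then 512 * (1/2:ℝ)^s else 0 :=
      Finset.sum_nonneg fun s _ => by split_ifs <;> positivity
    have hp : (0:ℝ) < (1/2)^t := by positivity
    by_cases h1 : β t ≤ (1/2)^t
    · linarith
    push Not at h1
    have hex : ∃ s, 256 * (1/2:ℝ)^s < β t := by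
      refine ⟨t+8, ?_⟩
      rw [pow_add]; norm_num; norm_num at h1; linarith
    have hs8 : Nat.find hex ≤ t + 8 := by
      apply Nat.find_min'
      rw [pow_add]; norm_num; norm_num at h1; linarith
    have hspec := Nat.find_spec hex
    have hmin := fun m => Nat.find_min hex (m := m)
    set s := Nat.find hex
    have hs0 : s ≠ 0 := by
      intro h0
      rw [h0] at hspec
      have := H.hc f hf t
      simp only [hβ] at hspec
      norm_num at hspec
      linarith
    obtain ⟨s', hs'⟩ : ∃ s', s = s' + 1 := ⟨s - 1, by omega⟩
    have h2 := hmin s' (by omega)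
    push Not at h2
    have h3 : β t ≤ 512 * (1/2)^s := by
      rw [hs', pow_succ]; linarith
    have hsK : s ∈ range K := Finset.mem_range.2 (by have := hK t ht; omega)
    have h4 := Finset.single_le_sum (f := fun s => if s ≤ t + 8 ∧ 256 * (1/2)^s < β t
      then 512 * (1/2:ℝ)^s else 0) (s := range K) (fun s _ => by
        show 0 ≤ if s ≤ t + 8 ∧ 256 * (1/2)^s < β t then 512 * (1/2:ℝ)^s else 0
        split_ifs <;> positivity) hsK
    simp only [if_pos (And.intro hs8 hspec)] at h4
    linarith
  have hsing : ∀ t ∈ T, |a t| ≤ 2 * M := by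
    intro t ht
    have := hM {t} (by simpa using ht) (by simp)
    simpa using this
  rw [map_sum]
  simp only [map_smul, smul_eq_mul]
  calc |∑ t ∈ T, a t * pr f (d t)| ≤ ∑ t ∈ T, |a t| * β t := by
        refine (Finset.abs_sum_le_sum_abs _ _).trans (le_of_eq ?_)
        exact Finset.sum_congr rfl fun t _ => abs_mul _ _
    _ ≤ ∑ t ∈ T, |a t| * ((1/2)^t + ∑ s ∈ range K,
          if s ≤ t + 8 ∧ 256 * (1/2)^s < β t then 512 * (1/2:ℝ)^s else 0) :=
        Finset.sum_le_sum fun t ht => mul_le_mul_of_nonneg_left (pt t ht) (abs_nonneg _)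
    _ = ∑ t ∈ T, |a t| * (1/2)^t + ∑ s ∈ range K, 512 * (1/2:ℝ)^s *
          ∑ t ∈ T.filter (fun t => s ≤ t + 8 ∧ 256 * (1/2)^s < β t), |a t| := by
        simp only [mul_add, Finset.sum_add_distrib]
        congr 1
        simp only [Finset.mul_sum]
        rw [Finset.sum_comm]
        refine Finset.sum_congr rfl fun s _ => ?_
        rw [Finset.sum_filter]
        refine Finset.sum_congr rfl fun t _ => ?_
        split_ifs
        · ring
        · simp
    _ ≤ ∑ t ∈ T, (2*M) * (1/2)^t + ∑ s ∈ range K, 512 * (1/2:ℝ)^s * (2 * M) := by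
        gcongr with t ht s hs
        · exact hsing t ht
        · refine hM _ (Finset.filter_subset _ _) fun t ht => ?_
          have h1 := (Finset.mem_filter.1 ht).2.1
          have h2 := count_univ H s hf (T.filter (fun t => s ≤ t + 8 ∧ 256 * (1/2)^s < β t))
            (fun k hk => (Finset.mem_filter.1 hk).2.2)
          have h3 := NN_mono h1
          omega
    _ = (2*M) * ∑ t ∈ T, (1/2:ℝ)^t + 1024 * M * ∑ s ∈ range K, (1/2:ℝ)^s := by
        rw [Finset.mul_sum, Finset.mul_sum]
        congr 1
        exact Finset.sum_congr rfl fun s _ => by ring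
    _ ≤ (2*M) * 2 + 1024 * M * 2 := by
        gcongr
        · exact sum_half _
        · exact sum_half _
    _ = _ := by ring

/-- sums of differences are `o(n)` uniformly -/
lemma sum_small {C : ℝ} {d : ℕ → Vec} (H : HP C d) (s n : ℕ) {f : ℕ → ℝ} (hf : Wm f) :
    |pr f (∑ t ∈ range n, d t)| ≤ NN s * C + n * (C * (1/2)^s) := by
  rw [map_sum]
  refine (Finset.abs_sum_le_sum_abs _ _).trans ?_
  exact sum_split H.pos.le (by have := H.pos; positivity) (H.hc f hf)
    (count_univ H s hf _ fun k hk => (Finset.mem_filter.1 hk).2)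

lemma exists_n (C ε : ℝ) (hC : 0 < C) (hε : 0 < ε) : ∃ s n : ℕ, 0 < n ∧
    NN s * C + n * (C * (1/2)^s) < n * ε := by
  obtain ⟨s, hs⟩ := exists_pow_lt_of_lt_one (show 0 < ε / (2*C) by positivity)
    (show (1/2:ℝ) < 1 by norm_num)
  have h1 : C * (1/2)^s < ε / 2 := by
    rw [lt_div_iff₀ (by positivity)] at hs; linarith
  obtain ⟨n, hn⟩ := exists_nat_gt (NN s * C / (ε / 2))
  refine ⟨s, n + 1, by omega, ?_⟩
  rw [div_lt_iff₀ (by positivity)] at hn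
  push_cast
  have : (0:ℝ) ≤ n := by positivity
  nlinarith

/-! ### construction of special sequences -/

lemma l1_le_sum (x : Vec) (s : Finset ℕ) (h : ∀ n, x n ≠ 0 → n ∈ s) : l1 x ≤ ∑ n ∈ s, |x n| :=
  Finset.sum_le_sum_of_subset_of_nonneg (fun n hn => h n (Finsupp.mem_support_iff.1 hn))
    fun _ _ _ => abs_nonneg _

lemma rat_approx (v : Vec) {ε : ℝ} (hε : 0 < ε) : ∃ q : ℕ →₀ ℚ, l1 (v - castV q) ≤ ε := by
  classical
  set δ : ℝ := ε / (v.support.card + 1) with hδ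
  have hδ0 : 0 < δ := by positivity
  have : ∀ n, ∃ r : ℚ, |v n - r| ≤ δ := by
    intro n
    obtain ⟨r, hr⟩ := exists_rat_btwn (show v n - δ < v n by linarith)
    exact ⟨r, by rw [abs_le]; constructor <;> linarith⟩
  choose r hr using this
  refine ⟨Finsupp.onFinset v.support (fun n => if n ∈ v.support then r n else 0) ?_, ?_⟩
  · intro n hn
    by_contra hc
    rw [if_neg hc] at hn
    exact hn rfl
  · refine (l1_le_sum _ v.support ?_).trans ?_
    · intro n hn
      by_contra hc
      apply hn
      simp [castV, Finsupp.notMem_support_iff.1 hc]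
    · calc _ ≤ ∑ n ∈ v.support, δ := by
            refine Finset.sum_le_sum fun n hn => ?_
            have : v n ≠ 0 := Finsupp.mem_support_iff.1 hn
            simpa [castV, this] using hr n
        _ = v.support.card * δ := by simp
        _ ≤ ε := by
            rw [hδ, mul_div_assoc', div_le_iff₀ (by positivity)]
            nlinarith

lemma exists_big_code (cs : List Code) (q : ℕ →₀ ℚ) (M : ℕ) :
    ∃ N : ℕ, M ≤ 2 * cod (cs ++ [(q, N)]) + 1 := by
  have hinj : Function.Injective fun N : ℕ => cod (cs ++ [(q, N)]) := by
    intro a b h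
    have := cod_inj h
    simpa using this
  obtain ⟨N, hN⟩ := (Set.infinite_range_of_injective hinj).exists_gt M
  obtain ⟨⟨N, rfl⟩, hN⟩ := hN
  exact ⟨N, by simp only at hN; omega⟩

theorem exists_SSeq (P : ℕ → ℕ → ℕ → ℕ → Vec → Prop) (h : ℕ → ℕ)
    (sup : ∀ i γ L, γ % 2 = 1 → ∃ R v, L ≤ R ∧ Exact γ v ∧ (∀ n, v n ≠ 0 → L ≤ n ∧ n < R) ∧
      P i γ L R v) :
    ∃ v p A B, SSeq v p A B ∧ (∀ i, h i ≤ A i) ∧ ∀ i, P i (sg p i) (A i) (B i) (v i) := by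
  have step : ∀ (i : ℕ) (st : List Code × ℕ), ∃ (R : ℕ) (v : Vec) (q : Code),
      max st.2 (h i) ≤ R ∧ Exact (2 * cod st.1 + 1) v ∧
      (∀ n, v n ≠ 0 → max st.2 (h i) ≤ n ∧ n < R) ∧
      P i (2 * cod st.1 + 1) (max st.2 (h i)) R v ∧ l1 (v - castV q.1) ≤ (1/2)^(i+1) ∧
      R + i + 1 ≤ 2 * cod (st.1 ++ [q]) + 1 := by
    intro i st
    obtain ⟨R, v, h1, h2, h3, h4⟩ := sup i (2 * cod st.1 + 1) (max st.2 (h i)) (by omega)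
    obtain ⟨q, hq⟩ := rat_approx v (show (0:ℝ) < (1/2)^(i+1) by positivity)
    obtain ⟨N, hN⟩ := exists_big_code st.1 q (R + i + 1)
    exact ⟨R, v, (q, N), h1, h2, h3, h4, hq, hN⟩
  choose R v q hq using step
  let st : ℕ → List Code × ℕ := fun i => Nat.rec (([], 0) : List Code × ℕ)
    (fun i s => (s.1 ++ [q i s], R i s)) i
  have st0 : st 0 = ([], 0) := rfl
  have sts : ∀ i, st (i+1) = ((st i).1 ++ [q i (st i)], R i (st i)) := fun i => rfl
  set p : ℕ → Code := fun i => q i (st i) with hp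
  have hst : ∀ i, (st i).1 = (List.range i).map p := by
    intro i
    induction i with
    | zero => simp [st0]
    | succ i ih => rw [sts, List.range_succ, List.map_append, ← ih]; simp [hp]
  have hsg : ∀ i, 2 * cod (st i).1 + 1 = sg p i := by
    intro i; rw [hst]; rfl
  have hB : ∀ i, (st (i+1)).2 = R i (st i) := fun i => by rw [sts]
  refine ⟨fun i => v i (st i), p, fun i => max (st i).2 (h i), fun i => R i (st i), ?_, ?_, ?_⟩
  · refine ⟨fun i => ?_, fun i => ?_, fun i => ?_, fun i => ?_, fun i => ?_, fun i => ?_⟩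
    · rw [← hsg]; exact (hq i (st i)).2.1
    · exact (hq i (st i)).2.2.1
    · exact (hq i (st i)).1
    · simp only [hB]; exact le_max_left _ _
    · rw [← hsg, sts]; exact (hq i (st i)).2.2.2.2.2
    · exact (hq i (st i)).2.2.2.2.1
  · intro i; exact le_max_right _ _
  · intro i
    rw [← hsg]; exact (hq i (st i)).2.2.2.1

end
end TS


namespace TS
noncomputable section

open Finset

/-! ### The space -/

/-- ambient space -/
abbrev Amb : Type := lp (fun _ : {f : ℕ → ℝ // Wm f} => ℝ) ⊤

lemma mem_amb (x : Vec) : Memℓp (fun f : {f : ℕ → ℝ // Wm f} => pr f.1 x) ⊤ := by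
  apply memℓp_infty
  refine ⟨l1 x, ?_⟩
  rintro _ ⟨f, rfl⟩
  exact Wm_l1 f.2 x

/-- embedding of finitely supported vectors -/
def ι0 : Vec →ₗ[ℝ] Amb where
  toFun x := ⟨fun f => pr f.1 x, mem_amb x⟩
  map_add' x y := by
    ext f
    exact map_add _ x y
  map_smul' c x := by
    ext f
    simp

/-- the space -/
abbrev XX : Type := ↥(LinearMap.range ι0).topologicalClosure

/-- the embedding into the space -/
def ιι : Vec →ₗ[ℝ] XX :=
  ι0.codRestrict _ fun x => Submodule.le_topologicalClosure _ ⟨x, rfl⟩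

/-- evaluation of functionals -/
def evL (f : ℕ → ℝ) (hf : Wm f) : XX →ₗ[ℝ] ℝ where
  toFun x := (x : Amb) ⟨f, hf⟩
  map_add' x y := by simp
  map_smul' c x := by simp

lemma evL_le (f : ℕ → ℝ) (hf : Wm f) (x : XX) : |evL f hf x| ≤ ‖x‖ :=
  lp.norm_apply_le_norm (by simp) (x : Amb) ⟨f, hf⟩

/-- continuous evaluation; junk zero outside the norming set -/
def ev (f : ℕ → ℝ) : XX →L[ℝ] ℝ := by
  classical
  exact if hf : Wm f then (evL f hf).mkContinuous 1 (fun x => by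
    simpa using evL_le f hf x) else 0

lemma ev_apply {f : ℕ → ℝ} (hf : Wm f) (x : XX) : ev f x = (x : Amb) ⟨f, hf⟩ := by
  unfold ev
  rw [dif_pos hf]
  rfl

lemma ev_le {f : ℕ → ℝ} (hf : Wm f) (x : XX) : |ev f x| ≤ ‖x‖ := by
  rw [ev_apply hf]; exact evL_le f hf x

lemma ev_ι {f : ℕ → ℝ} (hf : Wm f) (x : Vec) : ev f (ιι x) = pr f x := by
  rw [ev_apply hf]; rfl

lemma norm_le_of_ev {x : XX} {C : ℝ} (hC : 0 ≤ C) (h : ∀ f, Wm f → |ev f x| ≤ C) : ‖x‖ ≤ C := by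
  refine lp.norm_le_of_forall_le hC (f := (x : Amb)) fun f => ?_
  have := h f.1 f.2
  rw [ev_apply f.2] at this
  exact this

lemma norm_ι_le {x : Vec} {C : ℝ} (hC : 0 ≤ C) (h : ∀ f, Wm f → |pr f x| ≤ C) : ‖ιι x‖ ≤ C :=
  norm_le_of_ev hC fun f hf => by rw [ev_ι hf]; exact h f hf

lemma pr_le_norm {f : ℕ → ℝ} (hf : Wm f) (x : Vec) : |pr f x| ≤ ‖ιι x‖ := by
  rw [← ev_ι hf]; exact ev_le hf _

lemma dense_ι : Dense (Set.range ιι) := by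
  intro y
  rw [mem_closure_iff_nhds_basis Metric.nhds_basis_ball]
  intro ε hε
  have := y.2
  rw [← SetLike.mem_coe, Submodule.topologicalClosure_coe, Metric.mem_closure_iff] at this
  obtain ⟨_, ⟨z, rfl⟩, hz⟩ := this ε hε
  refine ⟨ιι z, ⟨z, rfl⟩, ?_⟩
  rw [Metric.mem_ball, dist_comm]
  exact hz

lemma approx_ι (x : XX) {ε : ℝ} (hε : 0 < ε) : ∃ z : Vec, ‖x - ιι z‖ < ε := by
  obtain ⟨_, ⟨z, rfl⟩, hz⟩ := Metric.mem_closure_iff.1 (dense_ι x) ε hε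
  exact ⟨z, by rwa [dist_eq_norm] at hz⟩

lemma ev_lin {J : Type*} (s : Finset J) (c : J → ℝ) (F : J → ℕ → ℝ) (hF : ∀ i ∈ s, Wm (F i))
    {f : ℕ → ℝ} (hf : Wm f) (h : ∀ n, f n = ∑ i ∈ s, c i * F i n) (x : XX) :
    ev f x = ∑ i ∈ s, c i * ev (F i) x := by
  refine dense_ι.induction (P := fun y => ev f y = ∑ i ∈ s, c i * ev (F i) y) ?_ ?_ x
  · rintro _ ⟨z, rfl⟩
    rw [ev_ι hf, show f = fun n => ∑ i ∈ s, c i * F i n from funext h, pr_sum]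
    refine Finset.sum_congr rfl fun i hi => ?_
    rw [pr_smul, ev_ι (hF i hi)]
  · exact isClosed_eq (ev _).continuous (by fun_prop)

lemma exists_near_norming {x : XX} {c : ℝ} (hc : 0 ≤ c) (h : c < ‖x‖) : ∃ f, Wm f ∧ c < ev f x := by
  by_contra hcon
  push Not at hcon
  refine absurd (norm_le_of_ev hc fun f hf => ?_) (not_le.2 h)
  rw [abs_le]
  refine ⟨?_, hcon f hf⟩
  have hneg := Wm_smul hf (-1) (by simp)
  have h1 := hcon _ hneg
  have h2 := ev_lin {()} (fun _ => -1) (fun _ => f) (fun _ _ => hf) hneg (by simp) x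
  simp at h2
  simp at h1
  linarith

lemma exists_near_norming_ι {x : Vec} {c : ℝ} (hc : 0 ≤ c) (h : c < ‖ιι x‖) :
    ∃ f, Wm f ∧ c < pr f x := by
  obtain ⟨f, hf, h1⟩ := exists_near_norming hc h
  exact ⟨f, hf, by rwa [ev_ι hf] at h1⟩

lemma norm_ι_le_l1 (x : Vec) : ‖ιι x‖ ≤ l1 x := norm_ι_le (l1_nonneg x) fun _ hf => Wm_l1 hf x

lemma Wbas (n : ℕ) : Wm (bas n 1) := (W.basis n 1 (by simp)).mem

/-- coordinate functionals -/
def co (n : ℕ) : XX →L[ℝ] ℝ := ev (bas n 1)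

lemma pr_bas (n : ℕ) (x : Vec) : pr (bas n 1) x = x n := by
  rw [pr_apply]
  simp only [bas, mul_ite, mul_one, mul_zero, Finset.sum_ite_eq', Finsupp.mem_support_iff]
  split_ifs with h
  · rfl
  · push Not at h; exact h.symm

lemma co_ι (n : ℕ) (x : Vec) : co n (ιι x) = x n := by
  rw [co, ev_ι (Wbas n), pr_bas]

lemma co_le (n : ℕ) (x : XX) : |co n x| ≤ ‖x‖ := ev_le (Wbas n) x

lemma ι_inj : Function.Injective ιι := by
  intro x y h
  ext n
  rw [← co_ι, ← co_ι, h]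

lemma ι_ne {x : Vec} (h : x ≠ 0) : ιι x ≠ 0 := fun hc => h (ι_inj (by simpa using hc))

/-- the basis -/
def eb (n : ℕ) : XX := ιι (Finsupp.single n 1)

lemma ι_eq_sum (x : Vec) : ιι x = ∑ n ∈ x.support, x n • eb n := by
  conv_lhs => rw [← Finsupp.sum_single x]
  rw [Finsupp.sum, map_sum]
  refine Finset.sum_congr rfl fun n _ => ?_
  rw [eb, ← map_smul]; simp

/-- restriction of a vector -/
def rv (a b : ℕ) (x : Vec) : Vec := x.filter fun n => a ≤ n ∧ n < b

lemma rv_apply (a b : ℕ) (x : Vec) (n : ℕ) : rv a b x n = if a ≤ n ∧ n < b then x n else 0 := by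
  unfold rv; rw [Finsupp.filter_apply]

lemma pr_eq_sum (f : ℕ → ℝ) (x : Vec) (s : Finset ℕ) (h : ∀ n, x n ≠ 0 → n ∈ s) :
    pr f x = ∑ n ∈ s, x n * f n := by
  rw [pr_apply]
  refine Finset.sum_subset (fun n hn => h n (Finsupp.mem_support_iff.1 hn)) fun n _ hn => ?_
  rw [Finsupp.notMem_support_iff.1 hn, zero_mul]

lemma pr_rv (f : ℕ → ℝ) (a b : ℕ) (x : Vec) : pr f (rv a b x) = pr (res a b f) x := by
  rw [pr_eq_sum f (rv a b x) x.support, pr_apply]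
  · refine Finset.sum_congr rfl fun n _ => ?_
    rw [rv_apply]; unfold res; split_ifs <;> simp
  · intro n hn
    rw [rv_apply] at hn
    split_ifs at hn
    · exact Finsupp.mem_support_iff.2 hn
    · exact absurd rfl hn

lemma norm_rv (a b : ℕ) (x : Vec) : ‖ιι (rv a b x)‖ ≤ ‖ιι x‖ :=
  norm_ι_le (norm_nonneg _) fun f hf => by
    rw [pr_rv]; exact pr_le_norm (Wm_res hf a b) x

lemma basis_XX : IsSchauderBasis eb := by
  refine ⟨fun n => ι_ne (by simp), ?_, 1, le_rfl, ?_⟩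
  · refine dense_ι.mono ?_
    rintro _ ⟨z, rfl⟩
    rw [ι_eq_sum]
    exact Submodule.sum_mem _ fun n _ => Submodule.smul_mem _ _ (Submodule.subset_span ⟨n, rfl⟩)
  · intro a m n hmn
    rw [one_mul]
    have key : ∀ k, ∑ i ∈ range k, a i • eb i = ιι (∑ i ∈ range k, Finsupp.single i (a i)) := by
      intro k
      rw [map_sum]
      refine Finset.sum_congr rfl fun i _ => ?_
      rw [eb, ← map_smul]; simp
    rw [key, key]
    have hap : ∀ k l, (∑ i ∈ range k, Finsupp.single i (a i) : Vec) l = if l < k then a l else 0 := by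
      intro k l
      rw [Finsupp.finsetSum_apply]
      simp only [Finsupp.single_apply]
      simp
    have : (∑ i ∈ range m, Finsupp.single i (a i) : Vec) =
        rv 0 m (∑ i ∈ range n, Finsupp.single i (a i)) := by
      ext l
      rw [rv_apply, hap, hap]
      by_cases h : l < m
      · rw [if_pos h, if_pos ⟨Nat.zero_le _, h⟩, if_pos (by omega)]
      · rw [if_neg h, if_neg (fun hh => h hh.2)]
    rw [this]
    exact norm_rv 0 m _

lemma infdim_XX : ¬ FiniteDimensional ℝ XX := by
  intro h
  have hfd : FiniteDimensional ℝ Vec := Module.Finite.of_injective ιι ι_inj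
  have := (Module.finite_finsupp_self_iff (R := ℝ) (ι := ℕ)).1 hfd
  rcases this with h | h
  · exact not_subsingleton ℝ h
  · exact not_finite ℕ

/-! ### Blocks -/

lemma hull {y : Vec} (h : y ≠ 0) : ∃ a b, y a ≠ 0 ∧ y b ≠ 0 ∧ ∀ n, y n ≠ 0 → a ≤ n ∧ n ≤ b := by
  have hne : y.support.Nonempty := Finsupp.support_nonempty_iff.2 h
  refine ⟨y.support.min' hne, y.support.max' hne, ?_, ?_, fun n hn => ?_⟩
  · exact Finsupp.mem_support_iff.1 (Finset.min'_mem _ _)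
  · exact Finsupp.mem_support_iff.1 (Finset.max'_mem _ _)
  · have := Finsupp.mem_support_iff.2 hn
    exact ⟨Finset.min'_le _ _ this, Finset.le_max' _ _ this⟩

/-- norming functionals for a normalized block sequence -/
lemma norming_block {y : ℕ → Vec} (hs : SuccV y) (hn : ∀ i, ‖ιι (y i)‖ = 1) :
    ∃ f : ℕ → ℕ → ℝ, (∀ i, Wm (f i)) ∧ SuccF f ∧ (∀ i, 1/2 < pr (f i) (y i)) ∧
      (∀ i j, i ≠ j → pr (f i) (y j) = 0) ∧
      ∀ i n, f i n ≠ 0 → ∃ a b, y i a ≠ 0 ∧ y i b ≠ 0 ∧ a ≤ n ∧ n ≤ b := by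
  have hy : ∀ i, y i ≠ 0 := by
    intro i hc
    have := hn i
    rw [hc] at this
    simp at this
  choose a b ha hb hab using fun i => hull (hy i)
  choose g hg hg' using fun i => exists_near_norming_ι (c := 1/2) (x := y i) (by norm_num)
    (by rw [hn i]; norm_num)
  have hsup : ∀ i n, res (a i) (b i + 1) (g i) n ≠ 0 → a i ≤ n ∧ n ≤ b i := by
    intro i n h
    have := (res_ne h).1
    omega
  refine ⟨fun i => res (a i) (b i + 1) (g i), fun i => Wm_res (hg i) _ _, ?_, ?_, ?_, ?_⟩
  · intro r r' hr n n' h1 h2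
    have := hs r r' hr _ _ (hb r) (ha r')
    have := hsup _ _ h1
    have := hsup _ _ h2
    omega
  · intro i
    rw [pr_congr (g := g i)]
    · exact hg' i
    · intro n h1
      have := hab i n h1
      unfold res
      beta_reduce
      rw [if_pos (by omega)]
  · intro i j hij
    refine pr_eq_zero fun n h1 => ?_
    by_contra hc
    have h2 := hsup _ _ hc
    rcases lt_or_gt_of_ne hij with h3 | h3
    · have := hs _ _ h3 _ _ (hb i) h1; omega
    · have := hs _ _ h3 _ _ h1 (ha i); omega
  · intro i n h
    exact ⟨a i, b i, ha i, hb i, hsup i n h⟩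

lemma SuccV.le_supp {y : ℕ → Vec} (hs : SuccV y) (hy : ∀ i, y i ≠ 0) :
    ∀ i n, y i n ≠ 0 → i ≤ n := by
  intro i
  induction i with
  | zero => intros; omega
  | succ i ih =>
    intro n hn
    obtain ⟨a, _, ha, _⟩ := hull (hy i)
    have := hs i (i+1) (by omega) a n ha hn
    have := ih a ha
    omega

lemma exists_blocks (Q : ℕ → Vec → Prop) (h : ∀ i L, ∃ y : Vec, (∀ n, y n ≠ 0 → L ≤ n) ∧ Q i y) :
    ∃ y : ℕ → Vec, SuccV y ∧ ∀ i, Q i (y i) := by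
  have step : ∀ i L, ∃ (y : Vec) (R : ℕ), (∀ n, y n ≠ 0 → L ≤ n ∧ n < R) ∧ L ≤ R ∧ Q i y := by
    intro i L
    obtain ⟨y, h1, h2⟩ := h i L
    obtain ⟨B, hB⟩ := exists_bound y
    exact ⟨y, max L B, fun n hn => ⟨h1 n hn, lt_max_of_lt_right (hB n hn)⟩, le_max_left _ _, h2⟩
  choose y R hyR hLR hQ using step
  let st : ℕ → ℕ := fun i => Nat.rec 0 (fun i s => R i s) i
  have sts : ∀ i, st (i+1) = R i (st i) := fun i => rfl
  have hmono : Monotone st := monotone_nat_of_le_succ fun i => by rw [sts]; exact hLR _ _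
  refine ⟨fun i => y i (st i), ?_, fun i => hQ _ _⟩
  intro r r' hr n n' h1 h2
  have e1 := (hyR _ _ _ h1).2
  have e2 := (hyR _ _ _ h2).1
  rw [← sts] at e1
  have : st (r+1) ≤ st r' := hmono hr
  omega

/-- approximating vectors in infinite dimensional subspaces -/
lemma approx_vec (U : Submodule ℝ XX) (hU : ¬ FiniteDimensional ℝ U) (L : ℕ) {ε : ℝ} (hε : 0 < ε) :
    ∃ y : Vec, (∀ n, y n ≠ 0 → L ≤ n) ∧ ‖ιι y‖ = 1 ∧ ∃ u ∈ U, ‖ιι y - u‖ ≤ ε := by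
  -- kernel vector
  obtain ⟨u0, hu0U, hu0ne, hu0⟩ : ∃ u ∈ U, u ≠ 0 ∧ ∀ n < L, co n u = 0 := by
    let Φ : U →ₗ[ℝ] (Fin L → ℝ) := LinearMap.pi fun i => (co i : XX →ₗ[ℝ] ℝ) ∘ₗ U.subtype
    have hni : ¬ Function.Injective Φ := fun hi => hU (Module.Finite.of_injective Φ hi)
    rw [← LinearMap.ker_eq_bot, Submodule.eq_bot_iff] at hni
    push Not at hni
    obtain ⟨u, hu, hune⟩ := hni
    refine ⟨u, u.2, fun hc => hune (Subtype.ext hc), fun n hn => ?_⟩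
    exact congrFun (LinearMap.mem_ker.1 hu) ⟨n, hn⟩
  have hpos : 0 < ‖u0‖ := norm_pos_iff.2 hu0ne
  set δ : ℝ := min (ε * ‖u0‖ / (2 * (L + 1))) (‖u0‖ / (2 * (L + 1))) with hδ
  have hδ0 : 0 < δ := by positivity
  obtain ⟨z, hz⟩ := approx_ι u0 hδ0
  obtain ⟨B, hB⟩ := exists_bound z
  set z' := rv L B z with hz'
  have hdiff : z - z' = rv 0 L z := by
    ext n
    rw [Finsupp.sub_apply, hz', rv_apply, rv_apply]
    by_cases h1 : n < L
    · rw [if_neg (by omega), if_pos (by omega), sub_zero]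
    · by_cases h2 : z n = 0
      · simp [h2]
      · have := hB n h2
        rw [if_pos (by omega), if_neg (by omega), sub_self]
  have hl1 : ‖ιι (rv 0 L z)‖ ≤ L * δ := by
    refine (norm_ι_le_l1 _).trans ((l1_le_sum _ (range L) ?_).trans ?_)
    · intro n hn
      rw [rv_apply] at hn
      have : 0 ≤ n ∧ n < L := by by_contra hc; rw [if_neg hc] at hn; exact hn rfl
      exact Finset.mem_range.2 this.2
    · calc _ ≤ ∑ n ∈ range L, δ := by
            refine Finset.sum_le_sum fun n hn => ?_
            have hn' := Finset.mem_range.1 hn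
            rw [rv_apply, if_pos ⟨Nat.zero_le _, hn'⟩, ← co_ι]
            have h1 := co_le n (u0 - ιι z)
            rw [map_sub, hu0 n hn', zero_sub, abs_neg] at h1
            linarith
        _ = L * δ := by simp
  have herr : ‖ιι z' - u0‖ ≤ (L + 1) * δ := by
    have : ιι z' - u0 = -(u0 - ιι z) - ιι (rv 0 L z) := by
      rw [← hdiff, map_sub]; abel
    rw [this]
    refine (norm_sub_le _ _).trans ?_
    rw [norm_neg]; linarith
  have hL : (0:ℝ) < L + 1 := by positivity
  have b1 : (L + 1) * δ ≤ ‖u0‖ / 2 := by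
    have := min_le_right (ε * ‖u0‖ / (2 * ((L:ℝ) + 1))) (‖u0‖ / (2 * (L + 1)))
    rw [← hδ, le_div_iff₀ (by positivity)] at this
    linarith
  have b2 : (L + 1) * δ ≤ ε * (‖u0‖ / 2) := by
    have := min_le_left (ε * ‖u0‖ / (2 * ((L:ℝ) + 1))) (‖u0‖ / (2 * (L + 1)))
    rw [← hδ, le_div_iff₀ (by positivity)] at this
    linarith
  have hnz : ‖u0‖ / 2 ≤ ‖ιι z'‖ := by
    have := norm_sub_norm_le u0 (ιι z')
    rw [norm_sub_rev] at this
    linarith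
  have hnzp : 0 < ‖ιι z'‖ := by linarith
  refine ⟨‖ιι z'‖⁻¹ • z', ?_, ?_, ‖ιι z'‖⁻¹ • u0, U.smul_mem _ hu0U, ?_⟩
  · intro n hn
    have : z' n ≠ 0 := fun hc => hn (by simp [hc])
    rw [hz', rv_apply] at this
    by_contra hc
    rw [if_neg (by omega)] at this
    exact this rfl
  · rw [map_smul, norm_smul, norm_inv, norm_norm, inv_mul_cancel₀ hnzp.ne']
  · rw [map_smul, ← smul_sub, norm_smul, norm_inv, norm_norm, inv_mul_le_iff₀ hnzp]
    nlinarith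

/-- a normalized block sequence close to a subspace -/
structure Near (U : Submodule ℝ XX) (ε : ℝ) (y : ℕ → Vec) : Prop where
  succ : SuccV y
  norm : ∀ i, ‖ιι (y i)‖ = 1
  near : ∀ i, ∃ u ∈ U, ‖ιι (y i) - u‖ ≤ ε * (1/2)^i

lemma exists_near (U : Submodule ℝ XX) (hU : ¬ FiniteDimensional ℝ U) {ε : ℝ} (hε : 0 < ε) :
    ∃ y, Near U ε y := by
  obtain ⟨y, h1, h2⟩ := exists_blocks
    (fun i y => ‖ιι y‖ = 1 ∧ ∃ u ∈ U, ‖ιι y - u‖ ≤ ε * (1/2)^i)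
    (fun i L => approx_vec U hU L (by positivity))
  exact ⟨y, h1, fun i => (h2 i).1, fun i => (h2 i).2⟩

lemma ne_of_norm {y : Vec} (h : ‖ιι y‖ = 1) : y ≠ 0 := by
  rintro rfl; simp at h

/-- span of a tail -/
def spn (y : ℕ → Vec) (L : ℕ) : Submodule ℝ Vec := Submodule.span ℝ (y '' Set.Ici L)

lemma spn_anti (y : ℕ → Vec) {L L' : ℕ} (h : L ≤ L') : spn y L' ≤ spn y L :=
  Submodule.span_mono (Set.image_mono (Set.Ici_subset_Ici.2 h))

lemma mem_spn (y : ℕ → Vec) {L i : ℕ} (h : L ≤ i) : y i ∈ spn y L :=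
  Submodule.subset_span ⟨i, h, rfl⟩

lemma spn_supp {y : ℕ → Vec} {L : ℕ} {M : ℕ} (hy : ∀ i, L ≤ i → ∀ n, y i n ≠ 0 → M ≤ n) {v : Vec}
    (hv : v ∈ spn y L) : ∀ n, v n ≠ 0 → M ≤ n := by
  induction hv using Submodule.span_induction with
  | mem x hx => obtain ⟨i, hi, rfl⟩ := hx; exact hy i hi
  | zero => intro n hn; exact absurd rfl hn
  | add x y _ _ h1 h2 =>
    intro n hn
    by_cases h : x n = 0
    · refine h2 n fun hc => hn (by simp [h, hc])
    · exact h1 n h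
  | smul a x _ h1 =>
    intro n hn
    exact h1 n fun hc => hn (by simp [hc])

lemma spn_trans {y w : ℕ → Vec} {L L' : ℕ} (h : ∀ k, L' ≤ k → w k ∈ spn y L) : spn w L' ≤ spn y L := by
  refine Submodule.span_le.2 ?_
  rintro _ ⟨k, hk, rfl⟩
  exact h k hk

lemma spn_exists {y : ℕ → Vec} {L : ℕ} {v : Vec} (hv : v ∈ spn y L) :
    ∃ κ : ℕ →₀ ℝ, (∀ i, κ i ≠ 0 → L ≤ i) ∧ v = ∑ i ∈ κ.support, κ i • y i := by
  obtain ⟨κ, h1, h2⟩ := (Finsupp.mem_span_image_iff_linearCombination ℝ).1 hv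
  refine ⟨κ, fun i hi => (Finsupp.mem_supported ℝ κ).1 h1 (by simpa using hi), ?_⟩
  rw [← h2, Finsupp.linearCombination_apply, Finsupp.sum]

lemma coef_le {y : ℕ → Vec} (hs : SuccV y) (hn : ∀ i, ‖ιι (y i)‖ = 1) (s : Finset ℕ) (κ : ℕ → ℝ)
    {i : ℕ} (hi : i ∈ s) : |κ i| ≤ 2 * ‖∑ i ∈ s, κ i • ιι (y i)‖ := by
  obtain ⟨f, hf, -, h2, h3, -⟩ := norming_block hs hn
  have h4 := ev_le (hf i) (∑ i ∈ s, κ i • ιι (y i))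
  rw [map_sum, Finset.sum_eq_single_of_mem i hi] at h4
  · rw [map_smul, ev_ι (hf i), smul_eq_mul, abs_mul] at h4
    have h5 := h2 i
    have h6 := le_abs_self (pr (f i) (y i))
    nlinarith [abs_nonneg (κ i)]
  · intro j _ hj
    rw [map_smul, ev_ι (hf i), h3 i j hj.symm, smul_zero]

lemma Near.approx {U : Submodule ℝ XX} {ε : ℝ} (hε : 0 ≤ ε) {y : ℕ → Vec} (h : Near U ε y) {L : ℕ} {v : Vec}
    (hv : v ∈ spn y L) : ∃ u ∈ U, ‖ιι v - u‖ ≤ 4 * ε * (1/2)^L * ‖ιι v‖ := by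
  obtain ⟨κ, hκ, hvκ⟩ := spn_exists hv
  choose u hu hyu using h.near
  refine ⟨∑ i ∈ κ.support, κ i • u i, U.sum_mem fun i _ => U.smul_mem _ (hu i), ?_⟩
  have hιv : ιι v = ∑ i ∈ κ.support, κ i • ιι (y i) := by
    rw [hvκ, map_sum]; simp only [map_smul]
  have hc : ∀ i ∈ κ.support, |κ i| ≤ 2 * ‖ιι v‖ := by
    intro i hi
    rw [hιv]; exact coef_le h.succ h.norm _ κ hi
  calc ‖ιι v - ∑ i ∈ κ.support, κ i • u i‖ = ‖∑ i ∈ κ.support, κ i • (ιι (y i) - u i)‖ := by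
        rw [hιv, ← Finset.sum_sub_distrib]; simp only [smul_sub]
    _ ≤ ∑ i ∈ κ.support, ‖κ i • (ιι (y i) - u i)‖ := norm_sum_le _ _
    _ ≤ ∑ i ∈ κ.support, (2 * ‖ιι v‖ * ε) * (1/2)^i := by
        refine Finset.sum_le_sum fun i hi => ?_
        rw [norm_smul, Real.norm_eq_abs]
        calc _ ≤ (2 * ‖ιι v‖) * (ε * (1/2)^i) :=
              mul_le_mul (hc i hi) (hyu i) (norm_nonneg _) (by positivity)
          _ = _ := by ring
    _ = (2 * ‖ιι v‖ * ε) * ∑ i ∈ κ.support, (1/2:ℝ)^i := by rw [Finset.mul_sum]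
    _ ≤ (2 * ‖ιι v‖ * ε) * (2 * (1/2)^L) := by
        gcongr
        have : ∑ i ∈ κ.support, (1/2:ℝ)^i = (1/2)^L * ∑ i ∈ κ.support, (1/2:ℝ)^(i-L) := by
          rw [Finset.mul_sum]
          refine Finset.sum_congr rfl fun i hi => ?_
          rw [← pow_add]; congr 1
          have := hκ i (Finsupp.mem_support_iff.1 hi); omega
        rw [this]
        have h2 : ∑ i ∈ κ.support, (1/2:ℝ)^(i-L) ≤ 2 := by
          rw [← Finset.sum_image (f := fun k => (1/2:ℝ)^k) (g := fun i => i - L) (s := κ.support)]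
          · exact sum_half _
          · intro i hi j hj hij
            have e1 := hκ i (Finsupp.mem_support_iff.1 hi)
            have e2 := hκ j (Finsupp.mem_support_iff.1 hj)
            simp only at hij
            omega
        have : (0:ℝ) < (1/2)^L := by positivity
        nlinarith
    _ = _ := by ring

end
end TS


namespace TS
noncomputable section

open Finset

/-! ### Averages -/

lemma sum_blocks {E : Type*} [AddCommMonoid E] (g : ℕ → E) (M : ℕ) (N : ℕ) :
    ∑ k ∈ range (N * M), g k = ∑ r ∈ range N, ∑ k ∈ range M, g (r * M + k) := by
  induction N with
  | zero => simp
  | succ N ih => rw [Finset.sum_range_succ, ← ih, Nat.succ_mul, Finset.sum_range_add]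

lemma james {E : Type*} [SeminormedAddCommGroup E] (y : ℕ → E) (hy : ∀ k, ‖y k‖ ≤ 1) (N : ℕ)
    (hN : 0 < N) (s : ℕ) : ∀ o, ((N:ℝ)/2)^s < ‖∑ k ∈ range (N^s), y (o + k)‖ →
    ∃ t o', o ≤ o' ∧ t + 1 ≤ s ∧ ((N:ℝ)/2)^(t+1) < ‖∑ k ∈ range (N^(t+1)), y (o' + k)‖ ∧
      ∀ r < N, ‖∑ k ∈ range (N^t), y (o' + r * N^t + k)‖ ≤
        2 / N * ‖∑ k ∈ range (N^(t+1)), y (o' + k)‖ := by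
  induction s with
  | zero =>
    intro o h
    have := hy o
    simp at h
    linarith
  | succ s ih =>
    intro o h
    by_cases hc : ∀ r < N, ‖∑ k ∈ range (N^s), y (o + r * N^s + k)‖ ≤
        2 / N * ‖∑ k ∈ range (N^(s+1)), y (o + k)‖
    · exact ⟨s, o, le_rfl, le_rfl, h, hc⟩
    · push Not at hc
      obtain ⟨r, hr, hc⟩ := hc
      have hNr : (0:ℝ) < N := by exact_mod_cast hN
      obtain ⟨t, o', h1, h2, h3⟩ := ih (o + r * N^s) (by
        refine lt_trans ?_ hc
        have : ((N:ℝ)/2)^s = 2 / N * ((N:ℝ)/2)^(s+1) := by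
          rw [pow_succ]; field_simp
        rw [this]
        gcongr)
      exact ⟨t, o', by omega, by omega, h3⟩

/-- lower estimate for sums of blocks -/
lemma sum_lower {y : ℕ → Vec} (hs : SuccV y) (hn : ∀ i, ‖ιι (y i)‖ = 1) (j d o : ℕ)
    (hd : d ≤ nn j) : (d:ℝ) / (2 * mm j) ≤ ‖∑ k ∈ range d, ιι (y (o + k))‖ := by
  obtain ⟨f, hf, hsf, h1, h2, _⟩ := norming_block hs hn
  choose τ hτ using hf
  have hW := W.op j d (fun r => f (o + r)) (fun r => τ (o + r)) hd (fun r => hτ _)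
    (fun r r' h => hsf _ _ (by omega))
  have h3 := pr_le_norm hW.mem (∑ k ∈ range d, y (o + k))
  rw [map_sum ιι] at h3
  refine le_trans ?_ h3
  refine le_trans ?_ (le_abs_self _)
  rw [pr_div, pr_sum]
  have h4 : ∀ r ∈ range d, (1/2:ℝ) ≤ pr (f (o + r)) (∑ k ∈ range d, y (o + k)) := by
    intro r hr
    rw [map_sum, Finset.sum_eq_single r]
    · exact (h1 _).le
    · intro b _ hb
      exact h2 _ _ (by omega)
    · intro h; exact absurd hr h
  have h5 := Finset.card_nsmul_le_sum _ _ _ h4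
  have := mm_pos j
  rw [div_le_div_iff₀ (by positivity) this]
  simp at h5 ⊢
  nlinarith

lemma avg {y : ℕ → Vec} (hs : SuccV y) (hn : ∀ i, ‖ιι (y i)‖ = 1) (c L : ℕ) :
    ∃ (o len : ℕ) (μ : ℝ), L ≤ o ∧ 0 < μ ∧ μ ≤ 2 / nn c ∧ μ * len ≤ 4 * mm (c+1) ∧
      ‖ιι (μ • ∑ k ∈ range len, y (o + k))‖ = 1 ∧
      ∀ j f, W (some j) f → j ≤ c → |pr f (μ • ∑ k ∈ range len, y (o + k))| ≤ 4 / mm j := by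
  classical
  set N := nn c with hNdef
  have hN2 : 2 ≤ N := nn_ge_two c
  have hNr : (2:ℝ) ≤ N := by exact_mod_cast hN2
  have hmm := mm_pos (c+1)
  have e2 : (2:ℝ)^(ex (c+1) + 2) = 4 * mm (c+1) := by
    unfold mm; rw [pow_add]; ring
  obtain ⟨t, o, h1, h2, h3, h4⟩ := james (fun k => ιι (y k)) (fun k => (hn k).le) N (by omega)
    (ex (c+1) + 2) L (by
      refine lt_of_lt_of_le ?_ (sum_lower hs hn (c+1) _ L (nn_pow_le c))
      rw [div_pow, e2]
      push_cast
      gcongr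
      linarith)
  set A := ∑ k ∈ range (N^(t+1)), y (o + k) with hA
  have hιA : ∑ k ∈ range (N^(t+1)), ιι (y (o + k)) = ιι A := by rw [hA, map_sum]
  simp only [hιA] at h3 h4
  have hone : (1:ℝ) ≤ N / 2 := by linarith
  have hApos : 0 < ‖ιι A‖ := lt_of_le_of_lt (by positivity) h3
  refine ⟨o, N^(t+1), ‖ιι A‖⁻¹, h1, by positivity, ?_, ?_, ?_, ?_⟩
  · rw [← inv_div]
    gcongr
    refine le_trans ?_ h3.le
    exact le_self_pow₀ hone (by omega)
  · rw [← e2, inv_mul_le_iff₀ hApos]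
    push_cast
    have : (N:ℝ)^(t+1) = (N/2)^(t+1) * 2^(t+1) := by rw [← mul_pow]; congr 1; field_simp
    rw [this]
    gcongr
    · norm_num
  · rw [← hA, map_smul, norm_smul, norm_inv, norm_norm, inv_mul_cancel₀ hApos.ne']
  · intro j f hf hj
    rw [← hA]
    cases hf with
    | op _ d f τ hd hf hsf =>
    set x : ℕ → Vec := fun r => if r < N then ‖ιι A‖⁻¹ • ∑ k ∈ range (N^t), y (o + r * N^t + k)
      else 0 with hx
    have hxs : SuccV x := by
      intro r r' hr n n' h5 h6
      have hr' : r' < N := by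
        by_contra hc; simp [hx, hc] at h6
      simp only [hx, if_pos hr', if_pos (hr.trans hr'), Finsupp.smul_apply, Finsupp.finsetSum_apply,
        smul_eq_mul] at h5 h6
      obtain ⟨k, hk, h7⟩ := Finset.exists_ne_zero_of_sum_ne_zero (right_ne_zero_of_mul h5)
      obtain ⟨k', hk', h8⟩ := Finset.exists_ne_zero_of_sum_ne_zero (right_ne_zero_of_mul h6)
      refine hs _ _ ?_ _ _ h7 h8
      have := Finset.mem_range.1 hk
      have : (r+1) * N^t ≤ r' * N^t := Nat.mul_le_mul_right _ hr
      nlinarith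
    have hAx : ‖ιι A‖⁻¹ • A = ∑ r ∈ range N, x r := by
      have : A = ∑ r ∈ range N, ∑ k ∈ range (N^t), y (o + (r * N^t + k)) := by
        rw [hA, pow_succ', sum_blocks]
      generalize ‖ιι A‖⁻¹ = μ at *
      rw [this, Finset.smul_sum]
      refine Finset.sum_congr rfl fun r hr => ?_
      simp only [hx, if_pos (Finset.mem_range.1 hr)]
      simp only [add_assoc]
    have hxb : ∀ r k, |pr (f r) (x k)| ≤ 2 / N := by
      intro r k
      by_cases hk : k < N
      · refine (pr_le_norm (hf r).mem _).trans ?_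
        simp only [hx, if_pos hk, map_smul, norm_smul, norm_inv, norm_norm, map_sum]
        rw [inv_mul_le_iff₀ hApos, mul_comm ‖ιι A‖]
        exact h4 k hk
      · simp only [hx, if_neg hk, map_zero, abs_zero]; positivity
    have h5 := stair_bound hsf hxs d N hxb
    have hm := mm_pos j
    rw [hAx, pr_div, pr_sum, abs_div, abs_of_pos hm]
    gcongr
    calc _ ≤ ∑ r ∈ range d, ∑ k ∈ range N, |pr (f r) (x k)| := by
          refine (Finset.abs_sum_le_sum_abs _ _).trans ?_
          gcongr with r hr
          rw [map_sum]
          exact Finset.abs_sum_le_sum_abs _ _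
      _ ≤ _ := h5
      _ ≤ (N + N) * (2 / N) := by
          gcongr
          exact hd.trans (nn_mono hj)
      _ = 4 := by field_simp; norm_num

/-- recursive choice of blocks with parameters -/
lemma exists_rec (Q : ℕ → ℕ → Vec → Prop) (F : ℕ → Vec → ℕ)
    (h : ∀ i c L, c % 2 = 1 → ∃ u, (∀ n, u n ≠ 0 → L ≤ n) ∧ Q i c u) :
    ∃ u c, SuccV u ∧ StrictMono c ∧ ∀ i, c i % 2 = 1 ∧ Q i (c i) (u i) ∧ F i (u i) ≤ c (i+1) := by
  choose! G hG1 hG2 using h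
  let nx : ℕ → ℕ × ℕ → ℕ × ℕ := fun i s =>
    (2 * (s.1 + F i (G i s.1 s.2)) + 1, s.2 + (G i s.1 s.2).support.sup id + 1)
  let st : ℕ → ℕ × ℕ := fun i => Nat.rec (1, 0) nx i
  have hst : ∀ i, st (i+1) = nx i (st i) := fun i => rfl
  have hodd : ∀ i, (st i).1 % 2 = 1 := by
    intro i
    cases i with
    | zero => rfl
    | succ i => rw [hst]; simp only [nx]; omega
  have hL : Monotone fun i => (st i).2 := monotone_nat_of_le_succ fun i => by
    rw [hst]; simp only [nx]; omega
  have hb : ∀ i n, G i (st i).1 (st i).2 n ≠ 0 → n < (st (i+1)).2 := by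
    intro i n hn
    have : n ≤ (G i (st i).1 (st i).2).support.sup id :=
      Finset.le_sup (f := id) (Finsupp.mem_support_iff.2 hn)
    rw [hst]; simp only [nx]; omega
  refine ⟨fun i => G i (st i).1 (st i).2, fun i => (st i).1, ?_, ?_, ?_⟩
  · intro r r' hr n n' h1 h2
    have h3 := hb _ _ h1
    have h4 := hG1 _ _ _ (hodd r') _ h2
    have : (st (r+1)).2 ≤ (st r').2 := hL (by omega : r + 1 ≤ r')
    omega
  · refine strictMono_nat_of_lt_succ fun i => ?_
    rw [hst]; simp only [nx]; omega
  · intro i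
    refine ⟨hodd i, hG2 _ _ _ (hodd i), ?_⟩
    simp only [hst, nx]; omega

lemma spn_sum_mem (y : ℕ → Vec) {L o : ℕ} (h : L ≤ o) (μ : ℝ) (len : ℕ) :
    μ • ∑ k ∈ range len, y (o + k) ∈ spn y L :=
  Submodule.smul_mem _ _ (Submodule.sum_mem _ fun k _ => mem_spn y (by omega))

/-- first level sequences -/
lemma exists_ris1 {y : ℕ → Vec} (hs : SuccV y) (hn : ∀ i, ‖ιι (y i)‖ = 1) :
    ∃ (u : ℕ → Vec) (q : ℕ → ℕ), SuccV u ∧ StrictMono q ∧ ∀ i, ‖ιι (u i)‖ = 1 ∧ u i ∈ spn y i ∧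
      (∀ j f, W (some j) f → j ≤ q i → |pr f (u i)| ≤ 4 / mm j) ∧
      l1 (u i) ≤ (1/2)^i * mm (q (i+1)) := by
  have hex : ∀ (i : ℕ) (u : Vec), ∃ F : ℕ, 2^i * l1 u ≤ 2^F := by
    intro i u
    obtain ⟨F, hF⟩ := pow_unbounded_of_one_lt (2^i * l1 u) (one_lt_two (α := ℝ))
    exact ⟨F, hF.le⟩
  choose F hF using hex
  obtain ⟨u, q, h1, h2, h3⟩ := exists_rec (fun i c u => ‖ιι u‖ = 1 ∧ u ∈ spn y i ∧
      (∀ j f, W (some j) f → j ≤ c → |pr f u| ≤ 4 / mm j)) F (by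
    intro i c L _
    obtain ⟨o, len, μ, g1, g2, g3, g4, g5, g6⟩ := avg hs hn c (max i L)
    refine ⟨_, ?_, g5, spn_sum_mem y (by omega) _ _, g6⟩
    refine spn_supp (L := L) (M := L) ?_ (spn_sum_mem y (by omega) _ _)
    intro i hi n hn'
    exact hi.trans (hs.le_supp (fun i => ne_of_norm (hn i)) i n hn'))
  refine ⟨u, q, h1, h2, fun i => ?_⟩
  obtain ⟨_, ⟨g1, g2, g3⟩, g4⟩ := h3 i
  refine ⟨g1, g2, g3, ?_⟩
  have h5 : 2^i * l1 (u i) ≤ mm (q (i+1)) :=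
    (hF i (u i)).trans ((pow_le_pow_right₀ one_le_two g4).trans (mm_ge_pow' _))
  rw [one_div, inv_pow, ← div_eq_inv_mul, le_div_iff₀ (by positivity)]
  linarith

lemma exists_RIS {y : ℕ → Vec} (hs : SuccV y) (hn : ∀ i, ‖ιι (y i)‖ = 1) :
    ∃ (w : ℕ → Vec) (c : ℕ → ℕ), RIS w c ∧ ∀ k, ‖ιι (w k)‖ = 1 ∧ w k ∈ spn y k := by
  classical
  obtain ⟨u, q, hu, hq, hu'⟩ := exists_ris1 hs hn
  have hun : ∀ i, ‖ιι (u i)‖ = 1 := fun i => (hu' i).1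
  obtain ⟨w, c, h1, h2, h3⟩ := exists_rec (fun i c w => ‖ιι w‖ = 1 ∧ w ∈ spn y i ∧
      (∀ j f, W (some j) f → j ≤ c → |pr f w| ≤ 4 / mm j) ∧
      (∀ j f, W (some j) f → c + 2 ≤ j → |pr f w| ≤ (1/4)^c))
      (fun k u => u.support.sup id + k + 10) (by
    intro i c L _
    obtain ⟨o, len, μ, g1, g2, g3, g4, g5, g6⟩ := avg hu hun c (max i L)
    have hsp : μ • ∑ k ∈ range len, u (o + k) ∈ spn u (max i L) := spn_sum_mem u g1 _ _
    have hle : ∀ L', spn u L' ≤ spn y L' := fun L' =>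
      spn_trans fun k hk => spn_anti y hk (hu' k).2.1
    refine ⟨_, ?_, g5, spn_anti y (le_max_left i L) (hle _ hsp), g6, ?_⟩
    · refine spn_supp (L := L) (M := L) ?_ (spn_anti u (le_max_right i L) hsp)
      intro i hi n hn'
      exact hi.trans (hu.le_supp (fun i => ne_of_norm (hun i)) i n hn')
    · intro j f hf hj
      have hmj := mm_pos j
      have hk : ∀ k, |pr f (u k)| ≤ (if q k < j ∧ j < q (k+1) then 1 else 0) + (1/2)^k + 4 / mm j := by
        intro k
        have hp : (0:ℝ) < (1/2)^k := by positivity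
        have hp' : (0:ℝ) < 4 / mm j := by positivity
        by_cases c1 : j ≤ q k
        · have := (hu' k).2.2.1 j f hf c1
          rw [if_neg (by omega)]
          linarith
        · by_cases c2 : j < q (k+1)
          · have := pr_le_norm hf.mem (u k)
            rw [hun k] at this
            rw [if_pos (by omega)]
            linarith
          · have h5 := Wj_l1 hf (u k)
            have h6 := (hu' k).2.2.2
            have h7 : mm (q (k+1)) ≤ mm j := mm_mono (by omega)
            have h8 : l1 (u k) / mm j ≤ (1/2)^k := by
              rw [div_le_iff₀ hmj]
              refine h6.trans ?_
              gcongr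
            rw [if_neg (by omega)]
            linarith
      have hsum : ∑ k ∈ range len, |pr f (u (o+k))| ≤ 3 + len * (4 / mm j) := by
        calc _ ≤ ∑ k ∈ range len, ((if q (o+k) < j ∧ j < q (o+k+1) then 1 else 0)
              + (1/2)^(o+k) + 4 / mm j) := Finset.sum_le_sum fun k _ => hk _
          _ = (∑ k ∈ range len, (if q (o+k) < j ∧ j < q (o+k+1) then (1:ℝ) else 0))
              + ∑ k ∈ range len, (1/2:ℝ)^(o+k) + len * (4 / mm j) := by
              rw [Finset.sum_add_distrib, Finset.sum_add_distrib]; simp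
          _ ≤ 1 + 2 + len * (4 / mm j) := by
              gcongr
              · rw [← Finset.sum_filter, Finset.sum_const, nsmul_eq_mul, mul_one]
                have : ((range len).filter fun k => q (o+k) < j ∧ j < q (o+k+1)).card ≤ 1 := by
                  rw [Finset.card_le_one]
                  intro a ha b hb
                  simp only [Finset.mem_filter] at ha hb
                  by_contra hne
                  rcases lt_or_gt_of_ne hne with hlt | hlt
                  · have := hq.monotone (show o + a + 1 ≤ o + b by omega)
                    omega
                  · have := hq.monotone (show o + b + 1 ≤ o + a by omega)
                    omega
                exact_mod_cast this
              · refine le_trans ?_ (sum_half (range len))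
                exact Finset.sum_le_sum fun k _ => pow_half_le (by omega)
          _ = _ := by ring
      have hN := nn_pos c
      have hq1 := (QQ_facts c).1
      have hN12 : (12:ℝ) * 4^c ≤ nn c := by exact_mod_cast hq1
      have hm1 := mm_pos (c+1)
      have hmj2 : mm (c+1) * (2^7 * 4^(c+1)) ≤ mm j := by
        rw [← mm_succ]; exact mm_mono (by omega)
      rw [map_smul, smul_eq_mul, abs_mul, abs_of_pos g2, map_sum]
      calc _ ≤ μ * (3 + len * (4 / mm j)) := by
            gcongr
            exact (Finset.abs_sum_le_sum_abs _ _).trans hsum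
        _ = 3 * μ + 4 * (μ * len) / mm j := by ring
        _ ≤ 3 * (2 / nn c) + 4 * (4 * mm (c+1)) / mm j := by gcongr
        _ ≤ 3 * (2 / (12 * 4^c)) + 4 * (4 * mm (c+1)) / (mm (c+1) * (2^7 * 4^(c+1))) := by gcongr
        _ ≤ (1/4)^c := by
            have h4 : (0:ℝ) < 4^c := by positivity
            have e1 : 4 * (4 * mm (c+1)) / (mm (c+1) * (2^7 * 4^(c+1))) = (1/32) * (1/4)^c := by
              rw [one_div_pow]; field_simp; ring
            have e2 : (3:ℝ) * (2 / (12 * 4^c)) = (1/2) * (1/4)^c := by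
              rw [one_div_pow]; field_simp; norm_num
            rw [e1, e2]
            have : (0:ℝ) < (1/4)^c := by positivity
            linarith)
  refine ⟨w, c, ⟨h1, ?_, ?_, ?_, h2, fun k => (h3 k).1, ?_⟩, fun k => ⟨(h3 k).2.1.1, (h3 k).2.1.2.1⟩⟩
  · intro f hf k
    have := pr_le_norm hf (w k)
    rwa [(h3 k).2.1.1] at this
  · intro j f hf k hj
    exact (h3 k).2.1.2.2.1 j f hf hj
  · intro j f hf k hj
    exact (h3 k).2.1.2.2.2 j f hf hj
  · intro k n hn'
    have h5 := (h3 k).2.2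
    have : n ≤ (w k).support.sup id := Finset.le_sup (f := id) (Finsupp.mem_support_iff.2 hn')
    omega

end
end TS


namespace TS
noncomputable section

open Finset

lemma RIS.shift {w c} (h : RIS w c) (K : ℕ) : RIS (fun k => w (K + k)) (fun k => c (K + k)) :=
  h.comp (fun a b hab => by simpa using hab)

lemma vec_bdd (v : Vec) : ∃ R, ∀ n, v n ≠ 0 → n < R :=
  ⟨v.support.sup id + 1, fun n hn => Nat.lt_succ_of_le
    (Finset.le_sup (f := id) (Finsupp.mem_support_iff.2 hn))⟩

lemma exv_mem (γ : ℕ) (w : ℕ → Vec) {L : ℕ} {y : ℕ → Vec} (h : ∀ k, w k ∈ spn y L) :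
    exv γ w ∈ spn y L :=
  Submodule.smul_mem _ _ (Submodule.sum_mem _ fun k _ => h k)

lemma exact_supply {y : ℕ → Vec} (hs : SuccV y) (hn : ∀ i, ‖ιι (y i)‖ = 1) (γ L : ℕ) :
    ∃ R v f, L ≤ R ∧ Exact γ v ∧ (∀ n, v n ≠ 0 → L ≤ n ∧ n < R) ∧ v ∈ spn y L ∧
      W (some γ) f ∧ (∀ n, f n ≠ 0 → L ≤ n ∧ n < R) ∧ pr f v = 1/2 := by
  obtain ⟨w, c, hw, hw'⟩ := exists_RIS hs hn
  set K := L + γ with hK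
  have hR := hw.shift K
  have hE : Exact γ (exv γ fun k => w (K + k)) := exv_exact hR (by have := hw.ck K; simp; omega)
  have hwn : ∀ k, ‖ιι (w (K + k))‖ = 1 := fun k => (hw' _).1
  obtain ⟨g, hg, hsg, h1, h2, h3⟩ := norming_block hR.succ hwn
  choose τ hτ using hg
  have hF := W.op γ (nn γ) g τ le_rfl hτ hsg
  set F : ℕ → ℝ := fun n => (∑ r ∈ range (nn γ), g r n) / mm γ with hFd
  set v := exv γ fun k => w (K + k) with hv
  have hvm : v ∈ spn y L := exv_mem _ _ fun k => spn_anti y (by omega) (hw' (K + k)).2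
  have hsup : ∀ i n, y i n ≠ 0 → i ≤ n := hs.le_supp fun i => ne_of_norm (hn i)
  have hsupw : ∀ i n, w i n ≠ 0 → i ≤ n := hw.succ.le_supp fun i => ne_of_norm (hw' i).1
  have hval : 1/2 ≤ pr F v := by
    have e : pr F v = (∑ k ∈ range (nn γ), pr (g k) (w (K + k))) / nn γ := by
      rw [hv, pr_exv]
      have : ∀ k ∈ range (nn γ), pr F (w (K + k)) = pr (g k) (w (K + k)) / mm γ := by
        intro k hk
        rw [hFd, pr_div, pr_sum, Finset.sum_eq_single k]
        · intro b _ hb; exact h2 b k hb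
        · intro h; exact absurd hk h
      rw [Finset.sum_congr rfl this, ← Finset.sum_div]
      have := mm_pos γ
      field_simp
    rw [e, le_div_iff₀ (nn_pos γ)]
    have := Finset.card_nsmul_le_sum (range (nn γ)) (fun k => pr (g k) (w (K + k))) (1/2)
      fun k _ => (h1 k).le
    simp at this ⊢
    linarith
  obtain ⟨R1, hR1⟩ := vec_bdd v
  obtain ⟨R2, hR2⟩ := (W_bound hF).2.2
  refine ⟨L + R1 + R2, v, fun n => (1 / (2 * pr F v)) * F n, by omega, hE, ?_, hvm,
    W_smul hF _ ?_, ?_, ?_⟩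
  · intro n hn'
    have := hR1 n hn'
    have := spn_supp (M := L) (fun i hi n hn => hi.trans (hsup i n hn)) hvm n hn'
    omega
  · rw [abs_of_pos (by positivity), div_le_one (by positivity)]
    linarith
  · intro n hn'
    have hn' : F n ≠ 0 := right_ne_zero_of_mul hn'
    have := hR2 n hn'
    have hne : ∑ r ∈ range (nn γ), g r n ≠ 0 := fun h => hn' (by simp [hFd, h])
    obtain ⟨r, _, hr⟩ := Finset.exists_ne_zero_of_sum_ne_zero hne
    obtain ⟨a, b, ha, _, hab, _⟩ := h3 r n hr
    have := hsupw _ _ ha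
    omega
  · rw [pr_smul]
    have : pr F v ≠ 0 := by linarith
    field_simp

lemma Exact.norm_le {γ v} (h : Exact γ v) : ‖ιι v‖ ≤ 33 := norm_ι_le (by norm_num) h.e1

lemma norm_ge_half {f v} (hf : Wm f) (h : pr f v = 1/2) : 1/2 ≤ ‖ιι v‖ := by
  have := pr_le_norm hf v
  rw [h] at this
  exact (le_abs_self _).trans this

end
end TS


namespace TS
noncomputable section

open Finset

/-- a supplier of exact vectors with norming functionals -/
def Supplier (D : ℕ → Vec → Prop) : Prop :=
  ∀ i γ L, γ % 2 = 1 → ∃ R v f, L ≤ R ∧ Exact γ v ∧ (∀ n, v n ≠ 0 → L ≤ n ∧ n < R) ∧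
    W (some γ) f ∧ (∀ n, f n ≠ 0 → L ≤ n ∧ n < R) ∧ pr f v = 1/2 ∧ D i v

/-- being close to a subspace -/
def Dn (U : Submodule ℝ XX) (ε : ℝ) (i : ℕ) (v : Vec) : Prop :=
  ∃ u ∈ U, ‖ιι v - u‖ ≤ ε * (1/2)^i

lemma supplier_near (U : Submodule ℝ XX) (hU : ¬ FiniteDimensional ℝ U) {ε : ℝ} (hε : 0 < ε) :
    Supplier (Dn U ε) := by
  obtain ⟨y, hy⟩ := exists_near U hU (ε := ε / 132) (by positivity)
  intro i γ L _
  obtain ⟨R, v, f, h1, h2, h3, h4, h5, h6, h7⟩ := exact_supply hy.succ hy.norm γ (L + i)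
  refine ⟨R, v, f, by omega, h2, fun n hn => ?_, h5, fun n hn => ?_, h7, ?_⟩
  · have := h3 n hn; omega
  · have := h6 n hn; omega
  · obtain ⟨u, hu, hu'⟩ := hy.approx (by positivity) h4
    refine ⟨u, hu, hu'.trans ?_⟩
    have := h2.norm_le
    calc 4 * (ε/132) * (1/2)^(L+i) * ‖ιι v‖ ≤ 4 * (ε/132) * (1/2)^i * 33 := by
          have := pow_half_le (show i ≤ L + i by omega)
          gcongr
      _ = _ := by ring

/-- a paired special sequence -/
structure Pair (v : ℕ → Vec) (p : ℕ → Code) (A B : ℕ → ℕ) (f : ℕ → ℕ → ℝ) : Prop where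
  ss : SSeq v p A B
  hf : ∀ l, W (some (sg p l)) (f l)
  hsup : ∀ l n, f l n ≠ 0 → A l ≤ n ∧ n < B l
  hfv : ∀ l, pr (f l) (v l) = 1/2

lemma exists_pair {D0 D1 : ℕ → Vec → Prop} (h0 : Supplier D0) (h1 : Supplier D1) (h : ℕ → ℕ) :
    ∃ v p A B f, Pair v p A B f ∧ (∀ i, h i ≤ A i) ∧ ∀ t, D0 t (v (2*t)) ∧ D1 t (v (2*t+1)) := by
  obtain ⟨v, p, A, B, hS, hA, hP⟩ := exists_SSeq
    (fun i γ L R v => (∃ f, W (some γ) f ∧ (∀ n, f n ≠ 0 → L ≤ n ∧ n < R) ∧ pr f v = 1/2) ∧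
      if i % 2 = 0 then D0 (i/2) v else D1 (i/2) v) h (by
    intro i γ L hγ
    by_cases hi : i % 2 = 0
    · obtain ⟨R, v, f, g1, g2, g3, g4, g5, g6, g7⟩ := h0 (i/2) γ L hγ
      exact ⟨R, v, g1, g2, g3, ⟨f, g4, g5, g6⟩, by rw [if_pos hi]; exact g7⟩
    · obtain ⟨R, v, f, g1, g2, g3, g4, g5, g6, g7⟩ := h1 (i/2) γ L hγ
      exact ⟨R, v, g1, g2, g3, ⟨f, g4, g5, g6⟩, by rw [if_neg hi]; exact g7⟩)
  choose f hf using fun i => (hP i).1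
  refine ⟨v, p, A, B, f, ⟨hS, fun l => (hf l).1, fun l => (hf l).2.1, fun l => (hf l).2.2⟩, hA,
    fun t => ⟨?_, ?_⟩⟩
  · have := (hP (2*t)).2
    rw [if_pos (by omega)] at this
    rwa [show 2*t/2 = t by omega] at this
  · have := (hP (2*t+1)).2
    rw [if_neg (by omega)] at this
    rwa [show (2*t+1)/2 = t by omega] at this

lemma Pair.sum_ge {v p A B f} (h : Pair v p A B f) (o : ℕ) (ho : o < 2) (T F : Finset ℕ)
    (hFT : F ⊆ T) (hF : ∀ t ∈ F, 2 * F.card ≤ A (2*t)) (a : ℕ → ℝ) :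
    ∑ t ∈ F, |a t| ≤ 2 * ‖∑ t ∈ T, a t • ιι (v (2*t+o))‖ := by
  refine h.ss.lower h.hf h.hsup h.hfv o ho T F hFT hF a _ fun k hk => ?_
  have := pr_le_norm hk (∑ t ∈ T, a t • v (2*t+o))
  simpa [map_sum] using this

/-- growth function for the equivalence theorem -/
def hgr (i : ℕ) : ℕ := 2 * (NN (i + 8) + 1)

lemma Pair.dif_le {v p A B f} (h : Pair v p A B f) (hA : ∀ i, hgr i ≤ A i) (o : ℕ) (ho : o < 2)
    (T : Finset ℕ) (a : ℕ → ℝ) :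
    ‖∑ t ∈ T, a t • ιι (dif v t)‖ ≤ 2052 * ‖∑ t ∈ T, a t • ιι (v (2*t+o))‖ := by
  have := norm_ι_le (x := ∑ t ∈ T, a t • dif v t)
    (C := 2052 * ‖∑ t ∈ T, a t • ιι (v (2*t+o))‖) (by positivity) (fun g hg =>
      tsum_lemma h.ss.mainB T a _ (norm_nonneg _) (fun F hF hF' => by
        refine h.sum_ge o ho T F hF (fun t ht => ?_) a
        have h1 := hA (2*t)
        have h2 := hF' t ht
        have h3 := NN_mono (show t + 8 ≤ 2*t + 8 by omega)
        unfold hgr at h1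
        omega) hg)
  simpa [map_sum] using this

lemma Pair.coef {v p A B f} (h : Pair v p A B f) (hA : ∀ i, hgr i ≤ A i) (o : ℕ) (ho : o < 2)
    (T : Finset ℕ) (a : ℕ → ℝ) {t : ℕ} (ht : t ∈ T) :
    |a t| ≤ 2 * ‖∑ t ∈ T, a t • ιι (v (2*t+o))‖ := by
  have := h.sum_ge o ho T {t} (by simpa using ht) (by
    intro s _
    have := hA (2*s)
    unfold hgr at this
    simp; omega) a
  simpa using this

/-- small perturbations -/
lemma perturb {E : Type*} [NormedAddCommGroup E] [NormedSpace ℝ E] {x u : ℕ → E} {T : Finset ℕ}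
    {a : ℕ → ℝ} (hc : ∀ t ∈ T, |a t| ≤ 2 * ‖∑ t ∈ T, a t • x t‖)
    (hu : ∀ t, ‖x t - u t‖ ≤ 1/8 * (1/2)^t) :
    ‖∑ t ∈ T, a t • x t‖ ≤ 2 * ‖∑ t ∈ T, a t • u t‖ ∧
    ‖∑ t ∈ T, a t • u t‖ ≤ 2 * ‖∑ t ∈ T, a t • x t‖ := by
  have h1 : ‖∑ t ∈ T, a t • x t - ∑ t ∈ T, a t • u t‖ ≤ 1/2 * ‖∑ t ∈ T, a t • x t‖ := by
    rw [← Finset.sum_sub_distrib]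
    refine (norm_sum_le _ _).trans ?_
    set M := ‖∑ t ∈ T, a t • x t‖
    calc _ ≤ ∑ t ∈ T, (2 * M) * (1/8) * (1/2)^t := by
          refine Finset.sum_le_sum fun t ht => ?_
          rw [← smul_sub, norm_smul, Real.norm_eq_abs, mul_assoc]
          exact mul_le_mul (hc t ht) (hu t) (norm_nonneg _) (by positivity)
      _ = (2 * M) * (1/8) * ∑ t ∈ T, (1/2)^t := by rw [Finset.mul_sum]
      _ ≤ (2 * M) * (1/8) * 2 := by gcongr; exact sum_half T
      _ = _ := by ring
  have h2 := norm_sub_norm_le (∑ t ∈ T, a t • x t) (∑ t ∈ T, a t • u t)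
  have h3 := norm_sub_norm_le (∑ t ∈ T, a t • u t) (∑ t ∈ T, a t • x t)
  rw [norm_sub_rev] at h3
  have h4 := norm_nonneg (∑ t ∈ T, a t • x t)
  constructor <;> linarith

lemma Pair.equiv {v p A B f} (h : Pair v p A B f) (hA : ∀ i, hgr i ≤ A i) {u u' : ℕ → XX}
    (hu : ∀ t, ‖ιι (v (2*t)) - u t‖ ≤ 1/8 * (1/2)^t)
    (hu' : ∀ t, ‖ιι (v (2*t+1)) - u' t‖ ≤ 1/8 * (1/2)^t) (T : Finset ℕ) (a : ℕ → ℝ) :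
    ‖∑ t ∈ T, a t • u t‖ ≤ 8212 * ‖∑ t ∈ T, a t • u' t‖ ∧
    ‖∑ t ∈ T, a t • u' t‖ ≤ 8212 * ‖∑ t ∈ T, a t • u t‖ ∧
    ∀ t ∈ T, |a t| ≤ 4 * ‖∑ t ∈ T, a t • u t‖ ∧ |a t| ≤ 4 * ‖∑ t ∈ T, a t • u' t‖ := by
  have c0 := fun t ht => h.coef hA 0 (by omega) T a (t := t) ht
  have c1 := fun t ht => h.coef hA 1 (by omega) T a (t := t) ht
  have d0 := h.dif_le hA 0 (by omega) T a
  have d1 := h.dif_le hA 1 (by omega) T a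
  simp only [add_zero] at c0 d0
  have p1 : ‖∑ t ∈ T, a t • ιι (v (2*t))‖ ≤ 2 * ‖∑ t ∈ T, a t • u t‖ := (perturb c0 hu).1
  have p2 : ‖∑ t ∈ T, a t • u t‖ ≤ 2 * ‖∑ t ∈ T, a t • ιι (v (2*t))‖ := (perturb c0 hu).2
  have q1 : ‖∑ t ∈ T, a t • ιι (v (2*t+1))‖ ≤ 2 * ‖∑ t ∈ T, a t • u' t‖ := (perturb c1 hu').1
  have q2 : ‖∑ t ∈ T, a t • u' t‖ ≤ 2 * ‖∑ t ∈ T, a t • ιι (v (2*t+1))‖ := (perturb c1 hu').2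
  have e : ∑ t ∈ T, a t • ιι (dif v t) = ∑ t ∈ T, a t • ιι (v (2*t)) -
      ∑ t ∈ T, a t • ιι (v (2*t+1)) := by
    rw [← Finset.sum_sub_distrib]
    refine Finset.sum_congr rfl fun t _ => ?_
    rw [dif, map_sub, smul_sub]
  rw [e] at d0 d1
  have h2 := norm_sub_norm_le (∑ t ∈ T, a t • ιι (v (2*t))) (∑ t ∈ T, a t • ιι (v (2*t+1)))
  have h3 := norm_sub_norm_le (∑ t ∈ T, a t • ιι (v (2*t+1))) (∑ t ∈ T, a t • ιι (v (2*t)))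
  rw [norm_sub_rev] at h3
  refine ⟨by linarith, by linarith, fun t ht => ⟨?_, ?_⟩⟩
  · have := c0 t ht; linarith
  · have := c1 t ht; linarith

/-- equivalent sequences span isomorphic subspaces -/
lemma iso_of_equiv {E : Type*} [NormedAddCommGroup E] [NormedSpace ℝ E] [CompleteSpace E]
    {x x' : ℕ → E} {C : ℝ} (hC : 0 ≤ C)
    (h1 : ∀ (T : Finset ℕ) (a : ℕ → ℝ), ‖∑ t ∈ T, a t • x t‖ ≤ C * ‖∑ t ∈ T, a t • x' t‖)
    (h2 : ∀ (T : Finset ℕ) (a : ℕ → ℝ), ‖∑ t ∈ T, a t • x' t‖ ≤ C * ‖∑ t ∈ T, a t • x t‖) :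
    Nonempty (↥(closedSpan (Set.range x)) ≃L[ℝ] ↥(closedSpan (Set.range x'))) := by
  set G : Submodule ℝ (E × E) := closedSpan (Set.range fun n => (x n, x' n)) with hG
  have hGc : IsClosed (G : Set (E × E)) := Submodule.isClosed_topologicalClosure _
  have : CompleteSpace G := hGc.completeSpace_coe
  have hmem : ∀ n, (x n, x' n) ∈ G := fun n =>
    Submodule.le_topologicalClosure _ (Submodule.subset_span ⟨n, rfl⟩)
  have hGle : (G : Set (E × E)) ⊆ {q | ‖q.1‖ ≤ C * ‖q.2‖ ∧ ‖q.2‖ ≤ C * ‖q.1‖} := by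
    have hcl : IsClosed {q : E × E | ‖q.1‖ ≤ C * ‖q.2‖ ∧ ‖q.2‖ ≤ C * ‖q.1‖} := by
      have e : {q : E × E | ‖q.1‖ ≤ C * ‖q.2‖ ∧ ‖q.2‖ ≤ C * ‖q.1‖} =
          {q : E × E | ‖q.1‖ ≤ C * ‖q.2‖} ∩ {q : E × E | ‖q.2‖ ≤ C * ‖q.1‖} := by ext; simp
      rw [e]
      exact (isClosed_le (by fun_prop) (by fun_prop)).inter (isClosed_le (by fun_prop) (by fun_prop))
    refine closure_minimal ?_ hcl
    intro q hq
    obtain ⟨κ, rfl⟩ := (Finsupp.mem_span_range_iff_exists_finsupp).1 hq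
    have e1 : (κ.sum fun i a => a • (x i, x' i)).1 = ∑ t ∈ κ.support, κ t • x t := by
      simp [Finsupp.sum, Prod.fst_sum]
    have e2 : (κ.sum fun i a => a • (x i, x' i)).2 = ∑ t ∈ κ.support, κ t • x' t := by
      simp [Finsupp.sum, Prod.snd_sum]
    simp only [Set.mem_ofPred_eq, e1, e2]
    exact ⟨h1 _ _, h2 _ _⟩
  have main : ∀ (P : E × E →L[ℝ] E) (z : ℕ → E), (∀ n, P (x n, x' n) = z n) →
      (∀ q ∈ G, ‖q‖ ≤ (C + 1) * ‖P q‖) → Nonempty (↥G ≃L[ℝ] ↥(closedSpan (Set.range z))) := by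
    intro P z hz hP
    set Q : G →L[ℝ] E := P.comp G.subtypeL with hQ
    have hanti : AntilipschitzWith ⟨C + 1, by positivity⟩ Q :=
      AddMonoidHomClass.antilipschitz_of_bound Q fun q => hP q.1 q.2
    have hcl : IsClosed (Set.range Q) := hanti.isClosed_range Q.uniformContinuous
    have hr : Q.range = closedSpan (Set.range z) := by
      apply le_antisymm
      · rintro _ ⟨q, rfl⟩
        have : ∀ q ∈ (G : Set (E × E)), P q ∈ closure (Submodule.span ℝ (Set.range z) : Set E) := by
          intro q hq
          refine map_mem_closure P.continuous hq ?_
          intro r hr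
          have : r ∈ Submodule.span ℝ (Set.range fun n => (x n, x' n)) := hr
          have h3 : Submodule.span ℝ (Set.range fun n => (x n, x' n)) ≤
              (Submodule.span ℝ (Set.range z)).comap P.toLinearMap := by
            rw [Submodule.span_le]
            rintro _ ⟨n, rfl⟩
            simp only [Submodule.comap_coe, Set.mem_preimage, SetLike.mem_coe]
            have := hz n
            refine Submodule.subset_span ⟨n, ?_⟩
            exact this.symm
          exact h3 this
        exact this q.1 q.2
      · refine Submodule.topologicalClosure_minimal _ ?_ hcl
        rw [Submodule.span_le]
        rintro _ ⟨n, rfl⟩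
        exact ⟨⟨_, hmem n⟩, hz n⟩
    have e := Q.equivRange hanti.injective hcl
    rw [hr] at e
    exact ⟨e⟩
  obtain ⟨e1⟩ := main (ContinuousLinearMap.fst ℝ E E) x (fun n => rfl) (by
    intro q hq
    have := hGle hq
    simp only [Set.mem_ofPred_eq] at this
    have h0 := norm_nonneg q.1
    rw [Prod.norm_def]
    refine max_le ?_ ?_ <;> simp <;> nlinarith)
  obtain ⟨e2⟩ := main (ContinuousLinearMap.snd ℝ E E) x' (fun n => rfl) (by
    intro q hq
    have := hGle hq
    simp only [Set.mem_ofPred_eq] at this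
    have h0 := norm_nonneg q.2
    rw [Prod.norm_def]
    refine max_le ?_ ?_ <;> simp <;> nlinarith)
  exact ⟨e1.symm.trans e2⟩

lemma infdim_closedSpan {E : Type*} [NormedAddCommGroup E] [NormedSpace ℝ E] {x : ℕ → E} {C : ℝ}
    (h : ∀ (T : Finset ℕ) (a : ℕ → ℝ), ∀ t ∈ T, |a t| ≤ C * ‖∑ t ∈ T, a t • x t‖) :
    ¬ FiniteDimensional ℝ ↥(closedSpan (Set.range x)) := by
  intro hfd
  have hli : LinearIndependent ℝ x := by
    rw [linearIndependent_iff']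
    intro s g hg i hi
    have := h s g i hi
    rw [hg, norm_zero, mul_zero] at this
    exact abs_nonpos_iff.1 this
  have hli' : LinearIndependent ℝ (fun n => (⟨x n, Submodule.le_topologicalClosure _
      (Submodule.subset_span ⟨n, rfl⟩)⟩ : closedSpan (Set.range x))) :=
    LinearIndependent.of_comp (closedSpan (Set.range x)).subtype hli
  have := hli'.finite
  exact not_finite ℕ

lemma isClosed_closedSpan {E : Type*} [NormedAddCommGroup E] [NormedSpace ℝ E] (s : Set E) :
    IsClosed (closedSpan s : Set E) := Submodule.isClosed_topologicalClosure _

lemma closedSpan_le {E : Type*} [NormedAddCommGroup E] [NormedSpace ℝ E] {x : ℕ → E}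
    {Y : Submodule ℝ E} (hY : IsClosed (Y : Set E)) (h : ∀ n, x n ∈ Y) :
    closedSpan (Set.range x) ≤ Y := by
  refine Submodule.topologicalClosure_minimal _ ?_ hY
  rw [Submodule.span_le]
  rintro _ ⟨n, rfl⟩
  exact h n

instance complXX : CompleteSpace XX :=
  (Submodule.isClosed_topologicalClosure (LinearMap.range ι0)).completeSpace_coe

theorem quasi_XX : QuasiMinimal XX := by
  intro Y Z hY hYf hZ hZf
  obtain ⟨v, p, A, B, f, hP, hA, hD⟩ := exists_pair (supplier_near Y hYf (ε := 1/8) (by norm_num))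
    (supplier_near Z hZf (ε := 1/8) (by norm_num)) hgr
  choose u hu hu' using fun t => (hD t).1
  choose w hw hw' using fun t => (hD t).2
  have key := hP.equiv hA hu' hw'
  refine ⟨closedSpan (Set.range u), closedSpan (Set.range w), closedSpan_le hY hu,
    closedSpan_le hZ hw, isClosed_closedSpan _,
    infdim_closedSpan fun T a t ht => ((key T a).2.2 t ht).1,
    isClosed_closedSpan _,
    infdim_closedSpan fun T a t ht => ((key T a).2.2 t ht).2,
    iso_of_equiv (by norm_num) (fun T a => (key T a).1) (fun T a => (key T a).2.1)⟩

lemma sum_antilip {E : Type*} [NormedAddCommGroup E] [NormedSpace ℝ E] [CompleteSpace E]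
    {Y U V : Submodule ℝ E} (hY : IsClosed (Y : Set E)) (hU : IsClosed (U : Set E))
    (hV : IsClosed (V : Set E)) (hUV : U ⊓ V = ⊥) (hsum : U ⊔ V = Y) :
    ∃ k : ℝ, 0 ≤ k ∧ ∀ u ∈ U, ∀ v ∈ V, ‖u‖ ≤ k * ‖u - v‖ := by
  have : CompleteSpace U := hU.completeSpace_coe
  have : CompleteSpace V := hV.completeSpace_coe
  set Q : U × V →L[ℝ] E := U.subtypeL.coprod V.subtypeL with hQ
  have hinj : Function.Injective Q := by
    rw [injective_iff_map_eq_zero]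
    rintro ⟨u, v⟩ h
    have h : (u : E) + v = 0 := by simpa [hQ] using h
    have hu : (u : E) ∈ U ⊓ V := ⟨u.2, by
      rw [eq_neg_of_add_eq_zero_left h]; exact V.neg_mem v.2⟩
    rw [hUV, Submodule.mem_bot] at hu
    have hv : (v : E) = 0 := by rw [hu, zero_add] at h; exact h
    ext1
    · exact Subtype.ext hu
    · exact Subtype.ext hv
  have hr : Set.range Q = (Y : Set E) := by
    rw [← hsum]
    ext z
    simp only [Set.mem_range, SetLike.mem_coe, Submodule.mem_sup]
    constructor
    · rintro ⟨⟨u, v⟩, rfl⟩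
      exact ⟨u, u.2, v, v.2, by simp [hQ]⟩
    · rintro ⟨u, hu, v, hv, rfl⟩
      exact ⟨(⟨u, hu⟩, ⟨v, hv⟩), by simp [hQ]⟩
  obtain ⟨K, hK⟩ := Q.antilipschitz_of_injective_of_isClosed_range hinj (by rw [hr]; exact hY)
  have hK' : ∀ u ∈ U, ∀ v ∈ V, ‖u‖ ≤ K * ‖u - v‖ := by
    intro u hu v hv
    have := hK.le_mul_norm_sub (x := (⟨u, hu⟩, ⟨-v, V.neg_mem hv⟩)) (y := 0)
    rw [add_zero, map_zero, add_zero, norm_neg, norm_neg] at this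
    have h2 : Q (⟨u, hu⟩, ⟨-v, V.neg_mem hv⟩) = u - v := by simp [hQ, sub_eq_add_neg]
    rw [h2] at this
    exact (norm_fst_le (⟨⟨u, hu⟩, ⟨-v, V.neg_mem hv⟩⟩ : U × V)).trans this
  have hK0 : (0:ℝ) ≤ K := K.2
  exact ⟨K, hK0, hK'⟩

theorem HI_XX : HeredIndec XX := by
  intro Y U V hY _ hU hV hUf hVf hUV hsum
  obtain ⟨k, hK0, hK'⟩ := sum_antilip hY hU hV hUV hsum
  set δ : ℝ := 1 / (8 * (k + 1)) with hδ
  have hδ0 : 0 < δ := by positivity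
  obtain ⟨s, n, hn, hsn⟩ := exists_n 256 δ (by norm_num) hδ0
  obtain ⟨v, p, A, B, f, hP, hA, hD⟩ := exists_pair (supplier_near U hUf hδ0)
    (supplier_near V hVf hδ0) (fun _ => 2 * n)
  choose u hu hu' using fun t => (hD t).1
  choose w hw hw' using fun t => (hD t).2
  have b1 : (n:ℝ) ≤ 2 * ‖∑ t ∈ range n, ιι (v (2*t))‖ := by
    have := hP.sum_ge 0 (by omega) (range n) (range n) subset_rfl (fun t _ => by simpa using hA _)
      (fun _ => 1)
    simpa using this
  have b2 : ‖∑ t ∈ range n, ιι (dif v t)‖ ≤ n * δ := by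
    have := norm_ι_le (x := ∑ t ∈ range n, dif v t) (C := n * δ) (by positivity)
      (fun g hg => (sum_small hP.ss.mainB s n hg).trans hsn.le)
    simpa [map_sum] using this
  have hh : ∀ t : ℕ, δ * (1/2)^t ≤ δ := fun t =>
    mul_le_of_le_one_right hδ0.le (pow_le_one₀ (by norm_num) (by norm_num))
  have b3 : ‖∑ t ∈ range n, ιι (v (2*t)) - ∑ t ∈ range n, u t‖ ≤ n * δ := by
    rw [← Finset.sum_sub_distrib]
    have := norm_sum_le_of_le (range n) fun t _ => (hu' t).trans (hh t)
    simpa using this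
  have b4 : ‖∑ t ∈ range n, ιι (v (2*t+1)) - ∑ t ∈ range n, w t‖ ≤ n * δ := by
    rw [← Finset.sum_sub_distrib]
    have := norm_sum_le_of_le (range n) fun t _ => (hw' t).trans (hh t)
    simpa using this
  have b5 := hK' (∑ t ∈ range n, u t) (Submodule.sum_mem _ fun t _ => hu t)
    (∑ t ∈ range n, w t) (Submodule.sum_mem _ fun t _ => hw t)
  have e : ∑ t ∈ range n, ιι (dif v t) = ∑ t ∈ range n, ιι (v (2*t)) -
      ∑ t ∈ range n, ιι (v (2*t+1)) := by
    rw [← Finset.sum_sub_distrib]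
    exact Finset.sum_congr rfl fun t _ => by rw [dif, map_sub]
  rw [e] at b2
  generalize ∑ t ∈ range n, ιι (v (2*t)) = a at *
  generalize ∑ t ∈ range n, ιι (v (2*t+1)) = b at *
  generalize ∑ t ∈ range n, u t = c at *
  generalize ∑ t ∈ range n, w t = d at *
  have b6 : ‖c - d‖ ≤ 3 * (n * δ) := by
    have : c - d = (a - b) - (a - c) + (b - d) := by abel
    rw [this]
    refine (norm_add_le _ _).trans ?_
    have := norm_sub_le (a - b) (a - c)
    linarith
  have b7 := norm_sub_norm_le a c
  have b8 : k * ‖c - d‖ ≤ k * (3 * (n * δ)) := by gcongr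
  have hn' : (0:ℝ) < n := by exact_mod_cast hn
  have hδk : δ * (k + 1) = 1/8 := by rw [hδ]; field_simp
  have : (n:ℝ) * (δ * (k+1)) = n / 8 := by rw [hδk]; ring
  nlinarith [mul_pos hn' hδ0]

end
end TS


namespace TS
noncomputable section

open Finset

lemma embeds_of_iso {E : Type*} [NormedAddCommGroup E] [NormedSpace ℝ E] {A B Y : Submodule ℝ E}
    (e : A ≃L[ℝ] B) (h : B ≤ Y) : Embeds A Y := by
  refine ⟨(B.subtypeL.comp (e : A →L[ℝ] B)).codRestrict Y fun x => h (e x).2,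
    (‖(e.symm : B →L[ℝ] A)‖ + 1)⁻¹, by positivity, fun y => ?_⟩
  have h1 := (e.symm : B →L[ℝ] A).le_opNorm (e y)
  simp only [ContinuousLinearEquiv.coe_coe, ContinuousLinearEquiv.symm_apply_apply] at h1
  have h2 : ‖(B.subtypeL.comp (e : A →L[ℝ] B)).codRestrict Y (fun x => h (e x).2) y‖ = ‖e y‖ := rfl
  rw [h2, inv_mul_le_iff₀ (by positivity)]
  have := norm_nonneg (e y)
  linarith

lemma SuccV.lt_of {x : ℕ → Vec} (h : SuccV x) {r r' : ℕ} (hr : x r ≠ 0) (hr' : x r' ≠ 0)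
    (hlt : ∀ n n', x r n ≠ 0 → x r' n' ≠ 0 → n < n') : r < r' := by
  obtain ⟨a, _, ha, _⟩ := hull hr
  obtain ⟨b, _, hb, _⟩ := hull hr'
  by_contra hc
  rcases eq_or_lt_of_le (not_lt.1 hc) with h1 | h1
  · subst h1
    exact lt_irrefl _ (hlt a a ha ha)
  · have h2 := h _ _ h1 _ _ hb ha
    have h3 := hlt _ _ ha hb
    omega

lemma res_hull {γ : ℕ} {f : ℕ → ℝ} {v : Vec} (hf : W (some γ) f) (hv : v ≠ 0) :
    ∃ g a b, W (some γ) g ∧ pr g v = pr f v ∧ v a ≠ 0 ∧ v b ≠ 0 ∧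
      (∀ n, v n ≠ 0 → a ≤ n ∧ n ≤ b) ∧ ∀ n, g n ≠ 0 → a ≤ n ∧ n ≤ b := by
  obtain ⟨a, b, ha, hb, hab⟩ := hull hv
  refine ⟨res a (b+1) f, a, b, W_res hf _ _, ?_, ha, hb, hab, fun n hn => ?_⟩
  · refine pr_congr fun n hn => ?_
    have := hab n hn
    unfold res
    rw [if_pos (by omega)]
  · have := (res_ne hn).1
    omega

/-- coefficients of a vector in a span -/
lemma block_coef {y : ℕ → Vec} (hs : SuccV y) {v : Vec} (κ : ℕ →₀ ℝ)
    (hv : v = ∑ i ∈ κ.support, κ i • y i) {i n : ℕ} (hi : i ∈ κ.support) (hn : y i n ≠ 0) :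
    v n ≠ 0 := by
  rw [hv, Finsupp.finsetSum_apply, Finset.sum_eq_single i]
  · simpa [hn] using Finsupp.mem_support_iff.1 hi
  · intro j _ hj
    by_contra hc
    have : y j n ≠ 0 := fun h => hc (by simp [h])
    exact hj (hs.unique this hn)
  · intro h; exact absurd hi h

lemma blocks_of_isBlock {y : ℕ → XX} (h : IsBlockSeq eb y) :
    ∃ x : ℕ → Vec, SuccV x ∧ (∀ i, ‖ιι (x i)‖ = 1) ∧ ∀ i, ∃ c : ℝ, ιι (x i) = c • y i := by
  classical
  obtain ⟨hne, I, a, h1, h2⟩ := h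
  set x : ℕ → Vec := fun n => ∑ i ∈ I n, a n i • Finsupp.single i 1 with hx
  have hιx : ∀ n, ιι (x n) = y n := by
    intro n
    rw [h1 n, hx, map_sum]
    refine Finset.sum_congr rfl fun i _ => ?_
    rw [map_smul]; rfl
  have hsupp : ∀ n k, x n k ≠ 0 → k ∈ I n := by
    intro n k hk
    rw [hx, Finsupp.finsetSum_apply] at hk
    obtain ⟨i, hi, hik⟩ := Finset.exists_ne_zero_of_sum_ne_zero hk
    by_cases h : i = k
    · rwa [← h]
    · exact absurd (by simp [Finsupp.single_apply, h]) hik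
  refine ⟨fun n => ‖y n‖⁻¹ • x n, ?_, ?_, ?_⟩
  · intro r r' hr n n' g1 g2
    refine h2 r r' hr n (hsupp _ _ ?_) n' (hsupp _ _ ?_)
    · intro h; exact g1 (by simp [h])
    · intro h; exact g2 (by simp [h])
  · intro i
    have := norm_ne_zero_iff.2 (hne i)
    rw [map_smul, hιx, norm_smul, norm_inv, norm_norm, inv_mul_cancel₀ this]
  · intro i
    exact ⟨‖y i‖⁻¹, by rw [map_smul, hιx]⟩

theorem seqmin_XX : SeqMinimalBasis eb := by
  refine ⟨quasi_XX, fun y hy => ?_⟩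
  obtain ⟨x, hx, hxn, hxy⟩ := blocks_of_isBlock hy
  choose cx hcx using hxy
  have hxs : ∀ i n, x i n ≠ 0 → i ≤ n := hx.le_supp fun i => ne_of_norm (hxn i)
  set g : ℕ → ℕ := fun n => 2 * (Nat.unpair n).1 + 1 with hg
  obtain ⟨Z, hZ, hZ'⟩ := exists_blocks (fun i v => Exact (g i) v ∧ v ∈ spn x 0 ∧
      ∃ f, W (some (g i)) f ∧ pr f v = 1/2) (by
    intro i L
    obtain ⟨R, v, f, h1, h2, h3, h4, h5, h6, h7⟩ := exact_supply hx hxn (g i) L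
    exact ⟨v, fun n hn => (h3 n hn).1, h2, spn_anti x (Nat.zero_le _) h4, f, h5, h7⟩)
  have hZne : ∀ i, Z i ≠ 0 := by
    intro i h
    obtain ⟨_, _, f, _, hf⟩ := hZ' i
    rw [h, map_zero] at hf
    norm_num at hf
  have hZs : ∀ i n, Z i n ≠ 0 → i ≤ n := hZ.le_supp hZne
  refine ⟨fun n => ιι (Z n), ⟨fun n => ι_ne (hZne n), ?_⟩, ?_⟩
  · choose κ hκ0 hκ using fun n => spn_exists (hZ' n).2.1
    refine ⟨fun n => (κ n).support, fun n i => κ n i * cx i, fun n => ?_, ?_⟩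
    · beta_reduce
      conv_lhs => rw [hκ n]
      rw [map_sum]
      refine Finset.sum_congr rfl fun i _ => ?_
      rw [map_smul, hcx, smul_smul]
    · intro n m hnm i hi j hj
      refine hx.lt_of (ne_of_norm (hxn i)) (ne_of_norm (hxn j)) fun a b ha hb => ?_
      exact hZ n m hnm a b (block_coef hx _ (hκ n) hi ha) (block_coef hx _ (hκ m) hj hb)
  · intro Y _ hYc hYf
    have hsup : Supplier (fun _ v => ∃ n, v = Z n) := by
      intro i γ L hγ
      set n := Nat.pair (γ / 2) L with hn
      have hgn : g n = γ := by simp only [hg, hn, Nat.unpair_pair]; omega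
      have hLn : L ≤ n := Nat.right_le_pair _ _
      obtain ⟨h1, h2, f, h3, h4⟩ := hZ' n
      rw [hgn] at h1 h3
      obtain ⟨f', a, b, q1, q2, q3, q4, q5, q6⟩ := res_hull h3 (hZne n)
      have ha := hZs n a q3
      have hb := hZs n b q4
      refine ⟨b + 1, Z n, f', by omega, h1, fun k hk => ?_, q1, fun k hk => ?_, q2.trans h4, n, rfl⟩
      · have := q5 k hk; omega
      · have := q6 k hk; omega
    obtain ⟨v, p, A, B, f, hP, hA, hD⟩ := exists_pair hsup
      (supplier_near Y hYf (ε := 1/8) (by norm_num)) hgr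
    choose φ hφ using fun t => (hD t).1
    choose w hw hw' using fun t => (hD t).2
    have key := hP.equiv hA (u := fun t => ιι (v (2*t))) (fun t => by
      rw [sub_self, norm_zero]; positivity) hw'
    obtain ⟨e⟩ := iso_of_equiv (by norm_num) (fun T a => (key T a).1) (fun T a => (key T a).2.1)
    refine ⟨φ, ?_, ?_⟩
    · intro t t' htt
      refine hZ.lt_of (hZne _) (hZne _) fun n n' h1 h2 => ?_
      rw [← hφ] at h1 h2
      have h3 := hP.ss.supp _ _ h1
      have h4 := hP.ss.supp _ _ h2
      have h5 := hP.ss.BA (show 2*t < 2*t' by omega)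
      omega
    · have e2 : (fun t => ιι (v (2*t))) = (fun n => ιι (Z n)) ∘ φ := by
        ext1 t; simp only [Function.comp, hφ]
      rw [e2] at e
      exact embeds_of_iso e (closedSpan_le hYc hw)

end
end TS

namespace TS
noncomputable section
open Finset

/-! ### Tightness -/

lemma ev_eq_sum {f : ℕ → ℝ} (hf : Wm f) {R : ℕ} (hR : ∀ n, f n ≠ 0 → n < R) (x : XX) :
    ev f x = ∑ n ∈ range R, f n * co n x := by
  refine ev_lin (range R) f (fun n => bas n 1) (fun n _ => Wbas n) hf (fun n => ?_) x
  by_cases h : f n = 0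
  · rw [h]
    symm
    refine Finset.sum_eq_zero fun i _ => ?_
    unfold bas
    split_ifs with hi
    · rw [← hi, h]; ring
    · ring
  · rw [Finset.sum_eq_single n]
    · simp [bas]
    · intro i _ hi
      simp [bas, Ne.symm hi]
    · intro h'
      exact absurd (Finset.mem_range.2 (hR n h)) h'

lemma Wm_bdd {f : ℕ → ℝ} (hf : Wm f) : ∃ R, ∀ n, f n ≠ 0 → n < R := by
  obtain ⟨τ, h⟩ := hf
  exact (W_bound h).2.2

lemma Wm_abs_le {f : ℕ → ℝ} (hf : Wm f) (n : ℕ) : |f n| ≤ 1 := by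
  obtain ⟨τ, h⟩ := hf
  exact (W_bound h).1 n

lemma res_le_supp {a b : ℕ} {f : ℕ → ℝ} {R : ℕ} (hR : ∀ n, f n ≠ 0 → n < R) :
    ∀ n, res a b f n ≠ 0 → n < R := by
  intro n hn
  refine hR n fun h => hn ?_
  simp [res, h]

/-- one-sided weak nullness -/
lemma weak_null_side {w : ℕ → Vec} {c : ℕ → ℕ} (h : RIS w c) {Y : Submodule ℝ XX} {u : ℕ → Y}
    (hu : ∀ k, ‖ιι (w k) - (u k : XX)‖ ≤ (1/2)^k) {M : ℝ} (hM : 0 ≤ M) (φ : Y →ₗ[ℝ] ℝ)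
    (hφ : ∀ z : Y, φ z ≤ M * ‖(z : XX)‖) {δ : ℝ} (hδ : 0 < δ) :
    ∃ k0, ∀ k, k0 ≤ k → φ (u k) ≤ δ := by
  by_contra hcon
  push Not at hcon
  obtain ⟨s, n, hn, hlt⟩ := exists_n 16 (δ / (M+1)) (by norm_num) (by positivity)
  choose k hk hk' using hcon
  obtain ⟨ψ, hψ⟩ : ∃ ψ : ℕ → ℕ, ∀ r, StrictMono ψ ∧ s ≤ ψ r ∧ δ < φ (u (ψ r)) := by
    let ψ : ℕ → ℕ := fun r => Nat.rec (k s) (fun _ q => k (q+1)) r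
    have hm : StrictMono ψ := strictMono_nat_of_lt_succ fun r => hk (ψ r + 1)
    refine ⟨ψ, fun r => ⟨hm, (hk s).trans (hm.monotone (Nat.zero_le r)), ?_⟩⟩
    cases r with
    | zero => exact hk' s
    | succ r => exact hk' _
  have hRIS := h.comp (hψ 0).1
  have h1 : ‖ιι (∑ t ∈ range n, w (ψ t))‖ ≤ NN s * 8 + n * (8 * (1/2)^s) :=
    norm_ι_le (by positivity) fun f hf => sum_small hRIS.HP s n hf
  have h2 : ‖ιι (∑ t ∈ range n, w (ψ t)) - ((∑ t ∈ range n, u (ψ t) : Y) : XX)‖ ≤ n * (1/2)^s := by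
    rw [map_sum, Submodule.coe_sum, ← Finset.sum_sub_distrib]
    refine (norm_sum_le _ _).trans ?_
    refine (Finset.sum_le_sum fun t _ => (hu (ψ t)).trans (pow_half_le (hψ t).2.1)).trans ?_
    simp
  have h3 : ‖((∑ t ∈ range n, u (ψ t) : Y) : XX)‖ ≤ NN s * 16 + n * (16 * (1/2)^s) := by
    have p := norm_le_norm_add_norm_sub (ιι (∑ t ∈ range n, w (ψ t))) ((∑ t ∈ range n, u (ψ t) : Y) : XX)
    have q : (0:ℝ) ≤ NN s := Nat.cast_nonneg _
    have q' : (0:ℝ) ≤ n * (1/2)^s := by positivity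
    refine p.trans ((add_le_add h1 h2).trans ?_)
    linarith
  have h4 : n * δ ≤ φ (∑ t ∈ range n, u (ψ t)) := by
    rw [map_sum]
    have := Finset.sum_le_sum fun t (_ : t ∈ range n) => (hψ t).2.2.le
    simpa using this
  have h5 := hφ (∑ t ∈ range n, u (ψ t))
  have h6 : M * ‖((∑ t ∈ range n, u (ψ t) : Y) : XX)‖ ≤ M * (n * (δ / (M+1))) :=
    mul_le_mul_of_nonneg_left (h3.trans hlt.le) hM
  have h7 : M * (n * (δ / (M+1))) < n * δ := by
    have hn' : (0:ℝ) < n := by exact_mod_cast hn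
    have : M * (n * (δ / (M+1))) = (n * δ) * (M / (M+1)) := by ring
    rw [this]
    have : M / (M+1) < 1 := by rw [div_lt_one (by linarith)]; linarith
    have h8 : 0 < n * δ := by positivity
    nlinarith
  exact absurd (h4.trans (h5.trans h6)) (not_le.2 h7)

lemma weak_null {w : ℕ → Vec} {c : ℕ → ℕ} (h : RIS w c) {Y : Submodule ℝ XX} {u : ℕ → Y}
    (hu : ∀ k, ‖ιι (w k) - (u k : XX)‖ ≤ (1/2)^k) {M : ℝ} (hM : 0 ≤ M) (φ : Y →ₗ[ℝ] ℝ)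
    (hφ : ∀ z : Y, |φ z| ≤ M * ‖(z : XX)‖) {δ : ℝ} (hδ : 0 < δ) :
    ∃ k0, ∀ k, k0 ≤ k → |φ (u k)| ≤ δ := by
  obtain ⟨k1, h1⟩ := weak_null_side h hu hM φ (fun z => (le_abs_self _).trans (hφ z)) hδ
  obtain ⟨k2, h2⟩ := weak_null_side h hu hM (-φ) (fun z => (neg_le_abs _).trans (hφ z)) hδ
  refine ⟨max k1 k2, fun k hk => abs_le.2 ⟨?_, h1 k ((le_max_left _ _).trans hk)⟩⟩
  have := h2 k ((le_max_right _ _).trans hk)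
  rw [LinearMap.neg_apply] at this
  linarith

/-- vanishing on a long window makes a functional small -/
lemma small_off {x : XX} {L R : ℕ} {η : ℝ} (h1 : ∑ n ∈ range L, |co n x| ≤ η/2)
    {z : Vec} (hz : ‖x - ιι z‖ ≤ η/2) (hzR : ∀ n, z n ≠ 0 → n < R) (hLR : L ≤ R)
    {h : ℕ → ℝ} (hh : Wm h) (h0 : ∀ n, L ≤ n → n < R → h n = 0) : |ev h x| ≤ η := by
  obtain ⟨R', hR'⟩ := Wm_bdd hh
  have e : ev h x = ev (res 0 L h) x + ev (res R R' h) x := by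
    rw [ev_eq_sum hh hR', ev_eq_sum (Wm_res hh 0 L) (res_le_supp hR'),
      ev_eq_sum (Wm_res hh R R') (res_le_supp hR'), ← Finset.sum_add_distrib]
    refine Finset.sum_congr rfl fun n hn => ?_
    rw [← add_mul]
    congr 1
    have hn' := Finset.mem_range.1 hn
    unfold res
    by_cases c1 : n < L
    · rw [if_pos ⟨Nat.zero_le _, c1⟩, if_neg (by omega), add_zero]
    · by_cases c2 : n < R
      · rw [if_neg (by omega), if_neg (by omega), h0 n (by omega) c2, add_zero]
      · rw [if_neg (by omega), if_pos ⟨by omega, hn'⟩, zero_add]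
  have e1 : |ev (res 0 L h) x| ≤ η/2 := by
    rw [ev_eq_sum (R := L) (Wm_res hh 0 L) (fun n hn => by
      by_contra hc
      exact hn (by unfold res; rw [if_neg (by omega)]))]
    refine (Finset.abs_sum_le_sum_abs _ _).trans (le_trans (Finset.sum_le_sum fun n _ => ?_) h1)
    rw [abs_mul]
    have := Wm_abs_le (Wm_res hh 0 L) n
    have q := abs_nonneg (co n x)
    nlinarith
  have e2 : |ev (res R R' h) x| ≤ η/2 := by
    have hw := Wm_res hh R R'
    have p : ev (res R R' h) (ιι z) = 0 := by
      rw [ev_ι hw]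
      refine pr_eq_zero fun n hn => ?_
      unfold res
      rw [if_neg]
      have := hzR n hn
      omega
    have q : ev (res R R' h) x = ev (res R R' h) (x - ιι z) := by
      rw [map_sub, p, sub_zero]
    rw [q]
    exact (ev_le hw _).trans hz
  rw [e]
  exact (abs_add_le _ _).trans (by linarith)

/-- the window lemma -/
lemma window {x : ℕ → XX} {a b : ℕ → ℕ} {J : Set ℕ} (hJ : J.Infinite) {c0 : ℝ} (hc0 : 0 < c0)
    (hlow : ∀ k, c0 ≤ ‖x k‖)
    (hwn : ∀ n (δ : ℝ), 0 < δ → ∃ k0, ∀ k, k0 ≤ k → |co n (x k)| ≤ δ)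
    (hz : ∀ k ∈ J, ∀ n, a k ≤ n → n ≤ b k → co n (x k) = 0)
    (hka : ∀ k, k ≤ a k) (hab : ∀ k, a k ≤ b k) (L K : ℕ) {η : ℝ} (hη : 0 < η) (hη' : η ≤ c0/8) :
    ∃ (k R : ℕ) (g : ℕ → ℝ), K ≤ k ∧ L ≤ a k ∧ b k < R ∧ Wm g ∧ (∀ n, g n ≠ 0 → L ≤ n ∧ n < R) ∧
      (∀ n, a k ≤ n → n ≤ b k → g n = 0) ∧ c0/8 ≤ ev g (x k) ∧
      ∀ h, Wm h → (∀ n, L ≤ n → n < R → h n = 0) → |ev h (x k)| ≤ η := by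
  choose κ hκ using fun n => hwn n (η / (2 * (L+1))) (by positivity)
  obtain ⟨k, hkJ, hk⟩ := hJ.exists_gt (K + L + ∑ n ∈ range L, κ n)
  have hkκ : ∀ n ∈ range L, |co n (x k)| ≤ η / (2 * (L+1)) := fun n hn => by
    refine hκ n k ?_
    have := Finset.single_le_sum (f := κ) (fun i _ => Nat.zero_le _) hn
    omega
  have hs : ∑ n ∈ range L, |co n (x k)| ≤ η/2 := by
    refine (Finset.sum_le_sum hkκ).trans ?_
    rw [Finset.sum_const, card_range, nsmul_eq_mul]
    have hL : (0:ℝ) ≤ L := Nat.cast_nonneg _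
    rw [← mul_div_assoc, div_le_div_iff₀ (by positivity) (by norm_num)]
    nlinarith
  obtain ⟨z, hzz⟩ := approx_ι (x k) (show 0 < η/2 by linarith)
  obtain ⟨R0, hR0⟩ := vec_bdd z
  set R := max R0 (b k + 1) with hR
  have hka' := hka k
  have hab' := hab k
  have hRb : b k < R := by omega
  have hzR : ∀ n, z n ≠ 0 → n < R := fun n hn => (hR0 n hn).trans_le (le_max_left _ _)
  have hoff : ∀ h, Wm h → (∀ n, L ≤ n → n < R → h n = 0) → |ev h (x k)| ≤ η := fun h hh h0 =>
    small_off hs hzz.le hzR (by omega) hh h0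
  obtain ⟨f, hf, hfx⟩ := exists_near_norming (x := x k) (c := 7*c0/8) (by linarith)
    (lt_of_lt_of_le (by linarith) (hlow k))
  obtain ⟨R', hR'⟩ := Wm_bdd hf
  have e : ev f (x k) = ev (res 0 L f) (x k) + ev (res L (a k) f) (x k)
      + ev (res (b k + 1) R f) (x k) + ev (res R R' f) (x k) := by
    rw [ev_eq_sum hf hR', ev_eq_sum (Wm_res hf 0 L) (res_le_supp hR'),
      ev_eq_sum (Wm_res hf R R') (res_le_supp hR'),
      ev_eq_sum (Wm_res hf L (a k)) (res_le_supp hR'),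
      ev_eq_sum (Wm_res hf (b k + 1) R) (res_le_supp hR'),
      ← Finset.sum_add_distrib, ← Finset.sum_add_distrib, ← Finset.sum_add_distrib]
    refine Finset.sum_congr rfl fun n hn => ?_
    have hn' := Finset.mem_range.1 hn
    rw [← add_mul, ← add_mul, ← add_mul]
    by_cases cz : a k ≤ n ∧ n ≤ b k
    · rw [hz k hkJ n cz.1 cz.2, mul_zero, mul_zero]
    congr 1
    unfold res
    by_cases c1 : n < L
    · rw [if_pos (by omega), if_neg (by omega), if_neg (by omega), if_neg (by omega)]; ring
    by_cases c2 : n < a k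
    · rw [if_neg (by omega), if_pos (by omega), if_neg (by omega), if_neg (by omega)]; ring
    by_cases c3 : n < R
    · rw [if_neg (by omega), if_neg (by omega), if_pos (by omega), if_neg (by omega)]; ring
    · rw [if_neg (by omega), if_neg (by omega), if_neg (by omega), if_pos (by omega)]; ring
  have e1 : |ev (res 0 L f) (x k)| ≤ η := hoff _ (Wm_res hf _ _) fun n h1 h2 => by
    unfold res; rw [if_neg (by omega)]
  have e2 : |ev (res R R' f) (x k)| ≤ η := hoff _ (Wm_res hf _ _) fun n h1 h2 => by
    unfold res; rw [if_neg (by omega)]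
  have e1' := (abs_le.1 e1).2
  have e2' := (abs_le.1 e2).2
  have : c0/8 ≤ ev (res L (a k) f) (x k) ∨ c0/8 ≤ ev (res (b k + 1) R f) (x k) := by
    by_contra hc
    push Not at hc
    obtain ⟨q1, q2⟩ := hc
    rw [e] at hfx
    linarith
  rcases this with h1 | h1
  · refine ⟨k, R, res L (a k) f, by omega, by omega, hRb, Wm_res hf _ _, fun n hn => ?_, fun n p1 p2 => ?_,
      h1, hoff⟩
    · have : L ≤ n ∧ n < a k := by
        by_contra hc; exact hn (by unfold res; rw [if_neg hc])
      omega
    · unfold res; rw [if_neg (by omega)]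
  · refine ⟨k, R, res (b k + 1) R f, by omega, by omega, hRb, Wm_res hf _ _, fun n hn => ?_, fun n p1 p2 => ?_,
      h1, hoff⟩
    · have : b k + 1 ≤ n ∧ n < R := by
        by_contra hc; exact hn (by unfold res; rw [if_neg hc])
      omega
    · unfold res; rw [if_neg (by omega)]

end
end TS

namespace TS
noncomputable section
open Finset

lemma mm_div_nn_le (γ : ℕ) : mm γ / nn γ ≤ 1/4 := by
  have hn : (0:ℝ) < nn γ := by exact_mod_cast nn_pos γ
  rw [div_le_div_iff₀ hn (by norm_num)]
  have h := (QQ_facts γ).2.1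
  have h1 : 4 * 2 ^ ex γ ≤ nn γ := by
    refine le_trans ?_ h
    exact Nat.le_mul_of_pos_right _ (by positivity)
  have h2 : (4 * 2 ^ ex γ : ℝ) ≤ nn γ := by exact_mod_cast h1
  have h3 : mm γ = 2 ^ ex γ := rfl
  rw [h3]; linarith

lemma ev_mid {h g : ℕ → ℝ} (hh : Wm h) (hg : Wm g) {L R : ℕ} (hLR : L ≤ R) {m : ℝ}
    (e : ∀ n, L ≤ n → n < R → h n = g n / m) (hs : ∀ n, g n ≠ 0 → L ≤ n ∧ n < R) {x : XX} {η : ℝ}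
    (hoff : ∀ h, Wm h → (∀ n, L ≤ n → n < R → h n = 0) → |ev h x| ≤ η) :
    ev g x / m - 2 * η ≤ ev h x := by
  obtain ⟨R', hR'⟩ := Wm_bdd hh
  have e0 : ev h x = ev (res 0 L h) x + ev (res L R h) x + ev (res R R' h) x := by
    rw [ev_eq_sum hh hR', ev_eq_sum (Wm_res hh 0 L) (res_le_supp hR'),
      ev_eq_sum (Wm_res hh R R') (res_le_supp hR'),
      ev_eq_sum (Wm_res hh L R) (res_le_supp hR'),
      ← Finset.sum_add_distrib, ← Finset.sum_add_distrib]
    refine Finset.sum_congr rfl fun n hn => ?_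
    have hn' := Finset.mem_range.1 hn
    rw [← add_mul, ← add_mul]
    congr 1
    unfold res
    by_cases c1 : n < L
    · rw [if_pos (by omega), if_neg (by omega), if_neg (by omega)]; ring
    by_cases c3 : n < R
    · rw [if_neg (by omega), if_pos (by omega), if_neg (by omega)]; ring
    · rw [if_neg (by omega), if_neg (by omega), if_pos (by omega)]; ring
  have e1 : |ev (res 0 L h) x| ≤ η := hoff _ (Wm_res hh _ _) fun n h1 h2 => by
    unfold res; rw [if_neg (by omega)]
  have e2 : |ev (res R R' h) x| ≤ η := hoff _ (Wm_res hh _ _) fun n h1 h2 => by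
    unfold res; rw [if_neg (by omega)]
  have e3 : ev (res L R h) x = ev g x / m := by
    have := ev_lin {()} (fun _ => 1/m) (fun _ => g) (fun _ _ => hg) (Wm_res hh L R) (fun n => by
      rw [Finset.sum_singleton]
      unfold res
      split_ifs with c1
      · rw [e n c1.1 c1.2]; ring
      · have : g n = 0 := by
          by_contra hc; exact c1 (hs n hc)
        rw [this]; ring) x
    rw [this, Finset.sum_singleton]; ring
  have e1' := (abs_le.1 e1).1
  have e2' := (abs_le.1 e2).1
  rw [e0, e3]
  linarith

lemma tsupply {x : ℕ → XX} {w : ℕ → Vec} {a b : ℕ → ℕ} {J : Set ℕ} (hJ : J.Infinite) {c0 : ℝ}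
    (hc0 : 0 < c0)
    (hlow : ∀ k, c0 ≤ ‖x k‖)
    (hwn : ∀ n (δ : ℝ), 0 < δ → ∃ k0, ∀ k, k0 ≤ k → |co n (x k)| ≤ δ)
    (hz : ∀ k ∈ J, ∀ n, a k ≤ n → n ≤ b k → co n (x k) = 0)
    (hka : ∀ k, k ≤ a k) (hab : ∀ k, a k ≤ b k) (hw : ∀ k n, w k n ≠ 0 → a k ≤ n ∧ n ≤ b k)
    (γ L K : ℕ) :
    ∃ (φ : ℕ → ℕ) (R : ℕ) (f : ℕ → ℝ), StrictMono φ ∧ (∀ r, K + r ≤ φ r) ∧ L ≤ R ∧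
      W (some γ) f ∧ (∀ n, f n ≠ 0 → L ≤ n ∧ n < R) ∧
      (∀ n, exv γ (fun r => w (φ r)) n ≠ 0 → L ≤ n ∧ n < R) ∧
      pr f (exv γ (fun r => w (φ r))) = 0 ∧
      (∀ h, Wm h → (∀ n, L ≤ n → n < R → h n = f n) →
        c0/16 ≤ (mm γ / nn γ) * ∑ r ∈ range (nn γ), ev h (x (φ r))) ∧
      (∀ h, Wm h → (∀ n, L ≤ n → n < R → h n = 0) →
        |(mm γ / nn γ) * ∑ r ∈ range (nn γ), ev h (x (φ r))| ≤ c0/64) := by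
  have hηp : ∀ r : ℕ, 0 < c0/64 * (1/2)^r := fun r => by positivity
  have hηl : ∀ r : ℕ, c0/64 * (1/2)^r ≤ c0/8 := fun r => by
    have : (1/2:ℝ)^r ≤ 1 := pow_le_one₀ (by norm_num) (by norm_num)
    nlinarith
  choose κ ρ g hκ1 hκ2 hρ hg hgs hg0 hgx hoff using fun (r L K : ℕ) =>
    window hJ hc0 hlow hwn hz hka hab L K (hηp r) (hηl r)
  let St : ℕ → ℕ × ℕ := fun r => Nat.rec (L, K) (fun r s => (ρ r s.1 s.2, κ r s.1 s.2 + 1)) r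
  let Lr : ℕ → ℕ := fun r => (St r).1
  let φ : ℕ → ℕ := fun r => κ r (St r).1 (St r).2
  let G : ℕ → ℕ → ℝ := fun r => g r (St r).1 (St r).2
  have hL0 : Lr 0 = L := rfl
  have hLs : ∀ r, Lr (r+1) = ρ r (St r).1 (St r).2 := fun r => rfl
  have hφs : ∀ r, φ r < φ (r+1) := fun r => hκ1 (r+1) (St (r+1)).1 (St (r+1)).2
  have hφm : StrictMono φ := strictMono_nat_of_lt_succ hφs
  have hφK : ∀ r, K + r ≤ φ r := by
    intro r
    induction r with
    | zero => exact hκ1 0 L K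
    | succ r ih => have := hφs r; omega
  have hLa : ∀ r, Lr r ≤ a (φ r) := fun r => hκ2 r _ _
  have hbL : ∀ r, b (φ r) < Lr (r+1) := fun r => hρ r _ _
  have hLm : Monotone Lr := monotone_nat_of_le_succ fun r => by
    have h1 := hLa r; have h2 := hbL r; have h3 := hab (φ r); omega
  have hGs : ∀ r n, G r n ≠ 0 → Lr r ≤ n ∧ n < Lr (r+1) := fun r => hgs r _ _
  have hGW : ∀ r, Wm (G r) := fun r => hg r _ _
  have hG0 : ∀ r n, a (φ r) ≤ n → n ≤ b (φ r) → G r n = 0 := fun r => hg0 r _ _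
  have hGx : ∀ r, c0/8 ≤ ev (G r) (x (φ r)) := fun r => hgx r _ _
  have hGo : ∀ r h, Wm h → (∀ n, Lr r ≤ n → n < Lr (r+1) → h n = 0) →
      |ev h (x (φ r))| ≤ c0/64 * (1/2)^r := fun r => hoff r _ _
  have hdis : ∀ r r' n, Lr r ≤ n → n < Lr (r+1) → Lr r' ≤ n → n < Lr (r'+1) → r = r' := by
    intro r r' n h1 h2 h3 h4
    by_contra hne
    rcases Nat.lt_or_gt_of_ne hne with h | h
    · have := hLm (show r+1 ≤ r' by omega); omega
    · have := hLm (show r'+1 ≤ r by omega); omega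
  choose τ hτ using hGW
  have hsucc : SuccF G := by
    intro r r' hr n n' h1 h2
    have h3 := hGs r n h1
    have h4 := hGs r' n' h2
    have := hLm (show r+1 ≤ r' by omega)
    omega
  have hmp : 0 < mm γ := mm_pos γ
  have hnp : (0:ℝ) < nn γ := by exact_mod_cast nn_pos γ
  have hq := mm_div_nn_le γ
  have hq0 : 0 < mm γ / nn γ := by positivity
  have hsub : ∀ r, r < nn γ → L ≤ Lr r ∧ Lr (r+1) ≤ Lr (nn γ) := fun r hr =>
    ⟨hLm (Nat.zero_le r), hLm (show r + 1 ≤ nn γ by omega)⟩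
  set f : ℕ → ℝ := fun n => (∑ r ∈ range (nn γ), G r n) / mm γ with hf
  have hfW : W (some γ) f := W.op γ (nn γ) G τ le_rfl hτ hsucc
  have hfr : ∀ r, r < nn γ → ∀ n, Lr r ≤ n → n < Lr (r+1) → f n = G r n / mm γ := by
    intro r hr n h1 h2
    rw [hf]
    beta_reduce
    rw [Finset.sum_eq_single r]
    · intro r' _ hne
      by_contra hc
      have := hGs r' n hc
      exact hne (hdis _ _ n this.1 this.2 h1 h2)
    · intro h'
      exact absurd (Finset.mem_range.2 hr) h'
  have hwin : ∀ r n, w (φ r) n ≠ 0 → Lr r ≤ n ∧ n < Lr (r+1) := by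
    intro r n hn
    have h1 := hw _ n hn
    have h2 := hLa r
    have h3 := hbL r
    omega
  have hsum : ∀ (t : ℝ), 0 ≤ t → (mm γ / nn γ) * ∑ r ∈ range (nn γ), t * (1/2)^r ≤ t / 2 := by
    intro t ht
    have h1 := sum_half (range (nn γ))
    rw [← Finset.mul_sum]
    have h2 : t * ∑ r ∈ range (nn γ), (1/2:ℝ)^r ≤ t * 2 := mul_le_mul_of_nonneg_left h1 ht
    have h3 : (mm γ / nn γ) * (t * ∑ r ∈ range (nn γ), (1/2:ℝ)^r) ≤ (mm γ / nn γ) * (t * 2) :=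
      mul_le_mul_of_nonneg_left h2 hq0.le
    nlinarith
  refine ⟨φ, Lr (nn γ), f, hφm, hφK, hLm (Nat.zero_le _), hfW, ?_, ?_, ?_, ?_, ?_⟩
  · intro n hn
    have : ∃ r ∈ range (nn γ), G r n ≠ 0 := by
      by_contra hc
      push Not at hc
      exact hn (by rw [hf]; beta_reduce; rw [Finset.sum_eq_zero hc, zero_div])
    obtain ⟨r, hr, hr'⟩ := this
    have h1 := hGs r n hr'
    have h2 := hsub r (Finset.mem_range.1 hr)
    omega
  · intro n hn
    have : ∃ r ∈ range (nn γ), w (φ r) n ≠ 0 := by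
      by_contra hc
      push Not at hc
      refine hn ?_
      unfold exv
      rw [Finsupp.smul_apply, Finsupp.finsetSum_apply, Finset.sum_eq_zero hc, smul_zero]
    obtain ⟨r, hr, hr'⟩ := this
    have h1 := hwin r n hr'
    have h2 := hsub r (Finset.mem_range.1 hr)
    omega
  · rw [pr_exv]
    rw [Finset.sum_eq_zero, mul_zero]
    intro r hr
    refine pr_eq_zero fun n hn => ?_
    have h1 := hwin r n hn
    have h2 := hw _ n hn
    rw [hfr r (Finset.mem_range.1 hr) n h1.1 h1.2, hG0 r n h2.1 h2.2, zero_div]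
  · intro h hh he
    have key : ∀ r ∈ range (nn γ), c0/8/mm γ - (c0/32) * (1/2)^r ≤ ev h (x (φ r)) := by
      intro r hr
      have hr' := Finset.mem_range.1 hr
      have h2 := hsub r hr'
      have h3 := ev_mid (m := mm γ) hh ⟨_, hτ r⟩ (hLm (Nat.le_succ r)) (fun n p q => by
        rw [he n (by omega) (lt_of_lt_of_le q h2.2), hfr r hr' n p q]) (hGs r) (hGo r)
      have h4 : c0/8/mm γ ≤ ev (G r) (x (φ r)) / mm γ := by
        have := hGx r
        gcongr
      linarith
    have h5 := Finset.sum_le_sum key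
    rw [Finset.sum_sub_distrib, Finset.sum_const, card_range, nsmul_eq_mul] at h5
    have h6 := mul_le_mul_of_nonneg_left h5 hq0.le
    rw [mul_sub] at h6
    have h7 : mm γ / nn γ * (nn γ * (c0/8/mm γ)) = c0/8 := by field_simp
    rw [h7] at h6
    have h8 := hsum (c0/32) (by positivity)
    linarith
  · intro h hh he
    rw [abs_mul, abs_of_pos hq0]
    have h1 : |∑ r ∈ range (nn γ), ev h (x (φ r))| ≤ ∑ r ∈ range (nn γ), c0/64 * (1/2)^r := by
      refine (Finset.abs_sum_le_sum_abs _ _).trans (Finset.sum_le_sum fun r hr => ?_)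
      have h2 := hsub r (Finset.mem_range.1 hr)
      exact hGo r h hh fun n p q => he n (by omega) (by omega)
    have h2 := mul_le_mul_of_nonneg_left h1 hq0.le
    have h3 := hsum (c0/64) (by positivity)
    linarith

end
end TS

namespace TS
noncomputable section
open Finset

set_option maxHeartbeats 2000000 in
lemma tight_contra {w : ℕ → Vec} {cc : ℕ → ℕ} (hR : RIS w cc) {Y : Submodule ℝ XX} {u : ℕ → Y}
    (hu : ∀ k, ‖ιι (w k) - (u k : XX)‖ ≤ (1/2)^k) {M : ℝ} (hM : 0 ≤ M) (S : Y →ₗ[ℝ] XX)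
    (hS : ∀ z : Y, ‖S z‖ ≤ M * ‖(z : XX)‖)
    {a b : ℕ → ℕ} {J : Set ℕ} (hJ : J.Infinite) {c0 : ℝ} (hc0 : 0 < c0)
    (hlow : ∀ k, c0 ≤ ‖S (u k)‖)
    (hz : ∀ k ∈ J, ∀ n, a k ≤ n → n ≤ b k → co n (S (u k)) = 0)
    (hka : ∀ k, k ≤ a k) (hab : ∀ k, a k ≤ b k)
    (hw : ∀ k n, w k n ≠ 0 → a k ≤ n ∧ n ≤ b k) : False := by
  have hwn : ∀ n (δ : ℝ), 0 < δ → ∃ k0, ∀ k, k0 ≤ k → |co n (S (u k))| ≤ δ := by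
    intro n δ hδ
    exact weak_null hR hu hM ((co n : XX →ₗ[ℝ] ℝ).comp S)
      (fun z => (co_le n (S z)).trans (hS z)) hδ
  set δ : ℝ := c0 / (64 * (M+1)) with hδ
  have hδp : 0 < δ := by positivity
  obtain ⟨K1, hK1⟩ := exists_pow_lt_of_lt_one hδp (show (1/2:ℝ) < 1 by norm_num)
  obtain ⟨s, n, hn, hlt⟩ := exists_n 256 δ (by norm_num) hδp
  obtain ⟨v, p, A, B, hSS, hA, hP⟩ := exists_SSeq (fun _ γ L R v => ∃ (u' : Y) (f : ℕ → ℝ),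
      ‖ιι v - (u' : XX)‖ ≤ δ ∧ W (some γ) f ∧ (∀ n, f n ≠ 0 → L ≤ n ∧ n < R) ∧ pr f v = 0 ∧
      (∀ h, Wm h → (∀ n, L ≤ n → n < R → h n = f n) → c0/16 ≤ ev h (S u')) ∧
      (∀ h, Wm h → (∀ n, L ≤ n → n < R → h n = 0) → |ev h (S u')| ≤ c0/64))
      (fun _ => n) (by
    intro i γ L _
    obtain ⟨φ, R, f, h1, h2, h3, h4, h5, h6, h7, h8, h9⟩ := tsupply hJ hc0 hlow hwn hz hka hab hw
      γ L (γ + K1)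
    have hevS : ∀ h : ℕ → ℝ, ev h (S ((mm γ / nn γ) • ∑ r ∈ range (nn γ), u (φ r)))
        = (mm γ / nn γ) * ∑ r ∈ range (nn γ), ev h (S (u (φ r))) := by
      intro h
      rw [map_smul, map_sum, map_smul, map_sum, smul_eq_mul]
    refine ⟨R, exv γ (fun r => w (φ r)), h3, exv_exact (hR.comp h1) ?_, h6,
      (mm γ / nn γ) • ∑ r ∈ range (nn γ), u (φ r), f, ?_, h4, h5, h7, ?_, ?_⟩
    · have q1 := hR.ck (φ 0)
      have q2 := h2 0
      omega
    · have hq := mm_div_nn_le γ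
      have hq0 : 0 ≤ mm γ / nn γ := (div_pos (mm_pos γ) (nn_pos γ)).le
      have e : ιι (exv γ (fun r => w (φ r))) - (((mm γ / nn γ) • ∑ r ∈ range (nn γ), u (φ r) : Y) : XX)
          = (mm γ / nn γ) • ∑ r ∈ range (nn γ), (ιι (w (φ r)) - (u (φ r) : XX)) := by
        unfold exv
        rw [map_smul, map_sum, Submodule.coe_smul, Submodule.coe_sum, Finset.sum_sub_distrib, smul_sub]
      rw [e, norm_smul, Real.norm_of_nonneg hq0]
      have k1 : ‖∑ r ∈ range (nn γ), (ιι (w (φ r)) - (u (φ r) : XX))‖ ≤ (1/2)^K1 * 2 := by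
        refine (norm_sum_le _ _).trans ?_
        have k2 : ∀ r ∈ range (nn γ), ‖ιι (w (φ r)) - (u (φ r) : XX)‖ ≤ (1/2)^K1 * (1/2)^r := by
          intro r _
          refine (hu (φ r)).trans ?_
          rw [← pow_add]
          refine pow_half_le ?_
          have := h2 r
          omega
        refine (Finset.sum_le_sum k2).trans ?_
        rw [← Finset.mul_sum]
        exact mul_le_mul_of_nonneg_left (sum_half _) (by positivity)
      have k3 := mul_le_mul hq k1 (norm_nonneg _) (by norm_num)
      refine k3.trans ?_
      have k4 : (0:ℝ) ≤ (1/2)^K1 := by positivity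
      linarith
    · intro h hh he
      rw [hevS]
      exact h8 h hh he
    · intro h hh he
      rw [hevS]
      exact h9 h hh he)
  choose u' f hu' hfW hfs hf0 hfa hfb using hP
  set E : Finset ℕ := (range n).image (fun t => 2 * t) with hE
  have hEm : ∀ l, l ∈ E ↔ ∃ t, t < n ∧ 2 * t = l := by
    intro l; simp [hE]
  set g : ℕ → ℕ → ℝ := fun l => if l ∈ E then f l else 0 with hg
  have hgin : ∀ l, l ∈ E → g l = f l := fun l hl => by rw [hg]; beta_reduce; rw [if_pos hl]
  have hgout : ∀ l, l ∉ E → g l = 0 := fun l hl => by rw [hg]; beta_reduce; rw [if_neg hl]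
  have hgs : ∀ l n, g l n ≠ 0 → A l ≤ n ∧ n < B l := by
    intro l m hm
    by_cases hl : l ∈ E
    · rw [hgin l hl] at hm; exact hfs l m hm
    · rw [hgout l hl] at hm; exact absurd rfl hm
  have hg0 : ∀ l, pr (g l) (v l) = 0 := by
    intro l
    by_cases hl : l ∈ E
    · rw [hgin l hl]; exact hf0 l
    · rw [hgout l hl]; exact pr_eq_zero fun _ _ => rfl
  have hspec : SpecData p g E := hSS.specmk (fun l => by
      by_cases hl : l ∈ E
      · rw [hgin l hl]; exact hfW l
      · rw [hgout l hl]; exact W_zero _) hgs hgout (fun l _ => by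
      have h1 : E.card ≤ n := by
        have := Finset.card_image_le (s := range n) (f := fun t => 2 * t)
        rwa [card_range] at this
      exact h1.trans (hA l)) (fun t => by rw [hg0, hg0])
  have hFW := hspec.sumW
  set F : ℕ → ℝ := fun n => ∑ l ∈ E, g l n with hF
  have hFw : ∀ l m, A l ≤ m → m < B l → F m = g l m := by
    intro l m h1 h2
    rw [hF]
    beta_reduce
    have hne : ∀ l', l' ≠ l → g l' m = 0 := by
      intro l' hl
      by_contra hc
      have h3 := hgs l' m hc
      rcases Nat.lt_or_gt_of_ne hl with h | h
      · have := hSS.BA h; omega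
      · have := hSS.BA h; omega
    by_cases hl : l ∈ E
    · exact Finset.sum_eq_single_of_mem l hl fun l' _ h => hne l' h
    · rw [hgout l hl, Pi.zero_apply]
      refine Finset.sum_eq_zero fun l' hl' => hne l' ?_
      rintro rfl
      exact hl hl'
  have hev : ∀ t ∈ range n, c0/16 ≤ ev F (S (u' (2*t))) := fun t ht =>
    hfa (2*t) F hFW fun m h1 h2 => by
      rw [hFw (2*t) m h1 h2, hgin _ ((hEm _).2 ⟨t, Finset.mem_range.1 ht, rfl⟩)]
  have hod : ∀ t, |ev F (S (u' (2*t+1)))| ≤ c0/64 := fun t =>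
    hfb (2*t+1) F hFW fun m h1 h2 => by
      rw [hFw (2*t+1) m h1 h2, hgout]
      · rfl
      · intro hc
        obtain ⟨t', _, h⟩ := (hEm _).1 hc
        omega
  have hlo : n * (3*c0/64) ≤ ev F (S (∑ t ∈ range n, (u' (2*t) - u' (2*t+1)))) := by
    rw [map_sum, map_sum]
    have : ∀ t ∈ range n, 3*c0/64 ≤ ev F (S (u' (2*t) - u' (2*t+1))) := by
      intro t ht
      rw [map_sub, map_sub]
      have h1 := hev t ht
      have h2 := (abs_le.1 (hod t)).2
      linarith
    have := Finset.sum_le_sum this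
    rwa [Finset.sum_const, card_range, nsmul_eq_mul] at this
  have hup1 : ‖ιι (∑ t ∈ range n, dif v t)‖ ≤ n * δ := by
    refine norm_ι_le (by positivity) fun h hh => ?_
    exact (sum_small hSS.mainB s n hh).trans hlt.le
  have hup2 : ‖ιι (∑ t ∈ range n, dif v t) - ((∑ t ∈ range n, (u' (2*t) - u' (2*t+1)) : Y) : XX)‖
      ≤ n * (2 * δ) := by
    rw [map_sum, Submodule.coe_sum, ← Finset.sum_sub_distrib]
    refine (norm_sum_le _ _).trans ?_
    have : ∀ t ∈ range n, ‖ιι (dif v t) - ((u' (2*t) - u' (2*t+1) : Y) : XX)‖ ≤ 2 * δ := by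
      intro t _
      have e : ιι (dif v t) - ((u' (2*t) - u' (2*t+1) : Y) : XX)
          = (ιι (v (2*t)) - (u' (2*t) : XX)) - (ιι (v (2*t+1)) - (u' (2*t+1) : XX)) := by
        unfold dif
        rw [map_sub, Submodule.coe_sub]; abel
      rw [e]
      refine (norm_sub_le _ _).trans ?_
      have h1 := hu' (2*t)
      have h2 := hu' (2*t+1)
      refine (add_le_add h1 h2).trans (by linarith)
    refine (Finset.sum_le_sum this).trans ?_
    rw [Finset.sum_const, card_range, nsmul_eq_mul]
  have hup3 : ‖((∑ t ∈ range n, (u' (2*t) - u' (2*t+1)) : Y) : XX)‖ ≤ n * (3 * δ) := by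
    have q := norm_le_norm_add_norm_sub (ιι (∑ t ∈ range n, dif v t))
      ((∑ t ∈ range n, (u' (2*t) - u' (2*t+1)) : Y) : XX)
    refine q.trans ((add_le_add hup1 hup2).trans ?_)
    linarith
  have hup4 : ev F (S (∑ t ∈ range n, (u' (2*t) - u' (2*t+1)))) ≤ M * (n * (3 * δ)) :=
    (le_abs_self _).trans ((ev_le hFW _).trans ((hS _).trans (mul_le_mul_of_nonneg_left hup3 hM)))
  have hn' : (0:ℝ) < n := by exact_mod_cast hn
  have h7 : M * (n * (3 * δ)) < n * (3*c0/64) := by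
    have e : M * (n * (3 * δ)) = (n * (3*c0/64)) * (M / (M+1)) := by
      rw [hδ]; field_simp
    rw [e]
    have : M / (M+1) < 1 := by rw [div_lt_one (by linarith)]; linarith
    have h8 : 0 < n * (3*c0/64) := by positivity
    nlinarith
  exact absurd (hlo.trans hup4) (not_le.2 h7)

lemma co_eb (n i : ℕ) : co n (eb i) = if i = n then 1 else 0 := by
  unfold eb
  rw [co_ι, Finsupp.single_apply]

lemma co_closedSpan {s : Set ℕ} {n : ℕ} (hn : n ∉ s) {z : XX} (hz : z ∈ closedSpan (eb '' s)) :
    co n z = 0 := by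
  have h1 : closedSpan (eb '' s) ≤ LinearMap.ker (co n : XX →ₗ[ℝ] ℝ) := by
    refine Submodule.topologicalClosure_minimal _ (Submodule.span_le.2 ?_) (co n).isClosed_ker
    rintro _ ⟨i, hi, rfl⟩
    have : co n (eb i) = 0 := by
      rw [co_eb, if_neg]
      rintro rfl
      exact hn hi
    exact this
  exact h1 hz

lemma exists_opbound {E : Type*} [NormedAddCommGroup E] [NormedSpace ℝ E] {Y Z : Submodule ℝ E}
    (T : Y →L[ℝ] Z) : ∃ M : ℝ, 0 ≤ M ∧ ∀ z : Y, ‖(T z : E)‖ ≤ M * ‖(z : E)‖ :=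
  ⟨‖T‖, T.opNorm_nonneg, fun z => T.le_opNorm z⟩

theorem tight_XX : TightBasis eb := by
  intro Y _ hYf
  obtain ⟨y, hy⟩ := exists_near Y hYf (ε := 1/8) (by norm_num)
  obtain ⟨w, cc, hR, hw⟩ := exists_RIS hy.succ hy.norm
  have hwne : ∀ k, w k ≠ 0 := fun k => ne_of_norm (hw k).1
  choose u0 hu0 hu1 using fun k => Near.approx (by norm_num) hy (hw k).2
  choose a b ha hb hab using fun k => hull (hwne k)
  have hab' : ∀ k, a k ≤ b k := fun k => (hab k _ (ha k)).2
  have hka : ∀ k, k ≤ a k := fun k => hR.succ.le_supp hwne k _ (ha k)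
  refine ⟨fun k => Finset.Icc (a k) (b k), fun k => ⟨a k, Finset.mem_Icc.2 ⟨le_rfl, hab' k⟩⟩, ?_, ?_⟩
  · intro n m hnm i hi j hj
    have h1 := (Finset.mem_Icc.1 hi).2
    have h2 := (Finset.mem_Icc.1 hj).1
    have h3 := hR.succ n m hnm _ _ (hb n) (ha m)
    omega
  · rintro J hJ ⟨T, c, hc, hT⟩
    have hu : ∀ k, ‖ιι (w k) - u0 k‖ ≤ (1/2) * (1/2)^k := fun k => by
      refine (hu1 k).trans (le_of_eq ?_)
      rw [(hw k).1]; ring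
    have hlow : ∀ k, 1/2 ≤ ‖u0 k‖ := fun k => by
      have h1 := norm_le_norm_add_norm_sub (u0 k) (ιι (w k))
      rw [(hw k).1] at h1
      have h2 : ‖u0 k - ιι (w k)‖ ≤ 1/2 := by
        rw [norm_sub_rev]
        refine (hu k).trans ?_
        have : (1/2:ℝ)^k ≤ 1 := pow_le_one₀ (by norm_num) (by norm_num)
        linarith
      have h3 := h1.trans (add_le_add_right h2 _)
      linarith
    obtain ⟨M, hM0, hM⟩ := exists_opbound T
    let u : ℕ → Y := fun k => ⟨u0 k, hu0 k⟩
    let S : Y →ₗ[ℝ] XX := (Submodule.subtype _).comp T.toLinearMap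
    refine tight_contra (u := u) (M := M) (a := a) (b := b) (J := J) (c0 := c/2) hR (fun k => ?_)
      hM0 S hM hJ (by linarith) (fun k => ?_) ?_ hka hab' hab
    · refine (hu k).trans ?_
      have : (0:ℝ) ≤ (1/2)^k := by positivity
      linarith
    · have h1 := hT (u k)
      have h2 : c * (1/2) ≤ c * ‖u k‖ := mul_le_mul_of_nonneg_left (hlow k) hc.le
      refine le_trans ?_ h1
      linarith
    · intro k hk n h1 h2
      refine co_closedSpan ?_ (T (u k)).2
      intro hcon
      exact hcon k hk (Finset.mem_Icc.2 ⟨h1, h2⟩)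

end
end TS

theorem exists_tight_HI_seqMinimal_space :
    ∃ (X : Type) (_ : NormedAddCommGroup X) (_ : NormedSpace ℝ X) (x : ℕ → X),
      CompleteSpace X ∧ ¬FiniteDimensional ℝ X ∧ IsSchauderBasis x ∧
      HeredIndec X ∧ TightBasis x ∧ SeqMinimalBasis x := by
  exact ⟨TS.XX, inferInstance, inferInstance, TS.eb, TS.complXX, TS.infdim_XX, TS.basis_XX,
    TS.HI_XX, TS.tight_XX, TS.seqmin_XX⟩
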